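/- Let U be an open neighborhood of the closed unit ball closure(𝔹ₙ) in ℂⁿ and let f be holomorphic and injective on U such that f(U) is a Runge domain. Then the restriction of f to 𝔹ₙ belongs to E(𝔹ₙ), i.e., it is the initial element of some Loewner chain on 𝔹ₙ whose range is all of ℂⁿ. -/

import Mathlib

open Metric Filter Set MeasureTheory

noncomputable section

/-- ℂⁿ with the Euclidean (Hermitian) norm. -/
abbrev En (n : ℕ) : Type := EuclideanSpace ℂ (Fin n)

/-- The open Euclidean unit ball 𝔹ₙ ⊂ ℂⁿ. -/
def Ball (n : ℕ) : Set (En n) := Metric.ball 0 1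

/-- A map is univalent on 𝔹ₙ if it is holomorphic and injective there. -/
def UnivalentOn (n : ℕ) (f : En n → En n) : Prop :=
  DifferentiableOn ℂ f (Ball n) ∧ Set.InjOn f (Ball n)

/-- A polynomial map ℂⁿ → ℂⁿ: each of the n components is a polynomial in the
n complex coordinates. -/
def IsPolyMap (n : ℕ) (p : En n → En n) : Prop :=
  ∃ q : Fin n → MvPolynomial (Fin n) ℂ,
    ∀ z : En n, ∀ i : Fin n, p z i = MvPolynomial.eval (fun j => z j) (q i)

/-- The Runge approximation property for a set Ω ⊆ ℂⁿ: every holomorphic map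
Ω → ℂⁿ is a locally uniform limit on Ω of polynomial maps. -/
def RungeOn (n : ℕ) (Ω : Set (En n)) : Prop :=
  ∀ g : En n → En n, DifferentiableOn ℂ g Ω →
    ∃ p : ℕ → En n → En n, (∀ k, IsPolyMap n (p k)) ∧
      TendstoLocallyUniformlyOn p g atTop Ω

/-- A Loewner chain on 𝔹ₙ: a family (f_t)_{t ≥ 0} of univalent maps with
increasing images, locally absolutely continuous in t, uniformly on compacta. -/
def IsLoewnerChain (n : ℕ) (f : ℝ → En n → En n) : Prop :=
  (∀ t, 0 ≤ t → UnivalentOn n (f t)) ∧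
  (∀ s t, 0 ≤ s → s ≤ t → f s '' Ball n ⊆ f t '' Ball n) ∧
  (∀ K : Set (En n), K ⊆ Ball n → IsCompact K → ∀ T : ℝ, 0 < T →
    ∃ c : ℝ → ℝ, (∀ τ, 0 ≤ c τ) ∧ IntegrableOn c (Set.Icc 0 T) ∧
      ∀ z ∈ K, ∀ s t : ℝ, 0 ≤ s → s ≤ t → t ≤ T →
        ‖f s z - f t z‖ ≤ ∫ τ in Set.Icc s t, c τ)

/-- The range of a Loewner chain: ⋃_{t ≥ 0} f_t(𝔹ₙ). -/
def ChainRange (n : ℕ) (f : ℝ → En n → En n) : Set (En n) :=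
  ⋃ t ∈ Set.Ici (0 : ℝ), f t '' Ball n

/-- E(𝔹ₙ): univalent maps embeddable as initial element of a Loewner chain
with range all of ℂⁿ. -/
def MemE (n : ℕ) (f : En n → En n) : Prop :=
  UnivalentOn n f ∧ ∃ F : ℝ → En n → En n,
    IsLoewnerChain n F ∧ F 0 = f ∧ ChainRange n F = Set.univ

section P0
open scoped Topology
variable {E F : Type*} [NormedAddCommGroup E] [NormedSpace ℂ E]
  [NormedAddCommGroup F] [NormedSpace ℂ F]

theorem cauchy_fderiv {f : E → F} {c : E} {r M : ℝ} (hr : 0 < r)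
    (hd : DifferentiableOn ℂ f (ball c r)) (hM : ∀ z ∈ ball c r, ‖f z‖ ≤ M) :
    ‖fderiv ℂ f c‖ ≤ 2 * M / r := by
  refine Complex.norm_fderiv_le_div_of_mapsTo_ball hd (fun z hz => ?_) hr
  rw [mem_closedBall, dist_eq_norm]
  have := norm_sub_le (f z) (f c)
  have := hM z hz
  have := hM c (mem_ball_self hr)
  linarith

theorem taylor_two {f : E → F} {c z : E} {r M : ℝ}
    (hd : DifferentiableOn ℂ f (ball c r)) (hM : ∀ z ∈ ball c r, ‖f z‖ ≤ M)
    (hz : z ∈ ball c r) :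
    ‖f z - f c - fderiv ℂ f c (z - c)‖ ≤ 4 * M * (‖z - c‖ / r) ^ 2 := by
  have hr : 0 < r := nonempty_ball.1 ⟨z, hz⟩
  have hc := hM c (mem_ball_self hr)
  have hM0 : 0 ≤ M := (norm_nonneg _).trans hc
  set L := fderiv ℂ f c with hL
  have hLn : ‖L‖ ≤ 2 * M / r := cauchy_fderiv hr hd hM
  have hfd : HasFDerivAt f L c :=
    (hd.differentiableAt (isOpen_ball.mem_nhds (mem_ball_self hr))).hasFDerivAt
  have := Complex.dist_le_mul_div_pow_of_mapsTo_ball_of_isLittleO (n := 1)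
    (f := fun w => f w - f c - L (w - c)) (c := c) (z := z) (R₁ := r) (R₂ := 4 * M)
    ((hd.sub_const _).sub (by fun_prop)) (fun w hw => ?_) ?_ hz
  · simpa [dist_eq_norm] using this
  · simp only [sub_self, map_zero, mem_closedBall, dist_zero_right]
    have h1 : ‖L (w - c)‖ ≤ 2 * M := by
      calc ‖L (w - c)‖ ≤ ‖L‖ * ‖w - c‖ := L.le_opNorm _
        _ ≤ 2 * M / r * r := by
          gcongr
          rw [mem_ball, dist_eq_norm] at hw; exact hw.le
        _ = 2 * M := by field_simp
    have := norm_sub_le (f w - f c) (L (w - c))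
    have := norm_sub_le (f w) (f c)
    have := hM w hw
    linarith
  · simpa using hfd.isLittleO.norm_right

theorem diff_of_unif {f : ℕ → E → F} {g : E → F} [CompleteSpace F] {x : E} {r : ℝ} (hr : 0 < r)
    (hf : ∀ n, DifferentiableOn ℂ (f n) (ball x r))
    (hu : TendstoUniformlyOn f g atTop (ball x r)) : DifferentiableAt ℂ g x := by
  have hb : ∀ y ∈ ball x (r/2), ball y (r/2) ⊆ ball x r := by
    intro y hy
    apply ball_subset_ball'
    rw [mem_ball] at hy; linarith
  have hmem : ∀ y ∈ ball x (r/2), ball x r ∈ 𝓝 y := fun y hy =>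
    isOpen_ball.mem_nhds (hb y hy (mem_ball_self (by linarith)))
  have hC : UniformCauchySeqOn (fun n => fderiv ℂ (f n)) atTop (ball x (r/2)) := by
    rw [Metric.uniformCauchySeqOn_iff]
    intro ε hε
    obtain ⟨N, hN⟩ := (Metric.uniformCauchySeqOn_iff.1 hu.uniformCauchySeqOn) (ε * r / 8) (by positivity)
    refine ⟨N, fun m hm n hn y hy => ?_⟩
    rw [dist_eq_norm, ← fderiv_sub ((hf m).differentiableAt (hmem y hy))
      ((hf n).differentiableAt (hmem y hy))]
    refine (cauchy_fderiv (M := ε * r / 8) (half_pos hr) (((hf m).sub (hf n)).mono (hb y hy)) ?_).trans_lt ?_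
    · intro z hz
      have := (hN m hm n hn z (hb y hy hz)).le
      rwa [dist_eq_norm] at this
    · field_simp; linarith
  choose! g' hg' using fun y (hy : y ∈ ball x (r/2)) => cauchySeq_tendsto_of_complete (hC.cauchySeq hy)
  have hU := hC.tendstoUniformlyOn_of_tendsto hg'
  exact (hasFDerivAt_of_tendstoUniformlyOn isOpen_ball hU
    (fun n y hy => ((hf n).differentiableAt (hmem y hy)).hasFDerivAt)
    (fun y hy => hu.tendsto_at (ball_subset_ball (by linarith) hy)) (mem_ball_self (half_pos hr))).differentiableAt

theorem exists_bdd_ball {f : E → F} {U : Set E} (hU : IsOpen U) (hf : ContinuousOn f U) {x : E}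
    (hx : x ∈ U) : ∃ r M, 0 < r ∧ ball x r ⊆ U ∧ ∀ z ∈ ball x r, ‖f z‖ ≤ M := by
  have h1 := (hf.continuousAt (hU.mem_nhds hx)).norm
  have h2 : ∀ᶠ z in 𝓝 x, ‖f z‖ < ‖f x‖ + 1 := h1.eventually (gt_mem_nhds (by linarith))
  obtain ⟨r, hr, hb⟩ := Metric.mem_nhds_iff.1 (h2.and (hU.mem_nhds hx))
  exact ⟨r, ‖f x‖ + 1, hr, fun z hz => (hb hz).2, fun z hz => (hb hz).1.le⟩

theorem diff_fderiv_apply [CompleteSpace F] {f : E → F} {U : Set E} (hU : IsOpen U)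
    (hf : DifferentiableOn ℂ f U) (v : E) : DifferentiableOn ℂ (fun x => fderiv ℂ f x v) U := by
  intro x hx
  apply DifferentiableAt.differentiableWithinAt
  obtain ⟨r, M, hr, hrU, hM⟩ := exists_bdd_ball hU hf.continuousOn hx
  have hM0 : 0 ≤ M := (norm_nonneg _).trans (hM x (mem_ball_self hr))
  have hb : ∀ y ∈ ball x (r/2), ball y (r/2) ⊆ ball x r := by
    intro y hy
    apply ball_subset_ball'
    rw [mem_ball] at hy; linarith
  -- step sizes
  obtain ⟨N, hN⟩ := exists_nat_gt (‖v‖ / (r / 2))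
  let h : ℕ → ℂ := fun n => ((n + N + 1 : ℕ) : ℂ)⁻¹
  have hh0 : ∀ n, h n ≠ 0 := fun n => by simp only [h]; exact inv_ne_zero (Nat.cast_ne_zero.2 (by omega))
  have hhn : ∀ n, ‖h n‖ = ((n + N + 1 : ℕ) : ℝ)⁻¹ := fun n => by
    simp only [h, norm_inv, Complex.norm_natCast]
  have hhv : ∀ n, ‖h n • v‖ < r / 2 := by
    intro n
    rw [norm_smul, hhn, inv_mul_lt_iff₀ (by positivity)]
    rw [div_lt_iff₀ (by positivity)] at hN
    refine hN.trans_le ?_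
    gcongr
    omega
  refine diff_of_unif (half_pos hr) (f := fun n y => (h n)⁻¹ • (f (y + h n • v) - f y)) ?_ ?_
  · intro n
    refine ((hf.mono hrU).comp (s := ball x (r/2)) (f := fun y => y + h n • v) (by fun_prop) ?_ |>.sub (hf.mono ?_)).const_smul _
    · intro y hy
      apply hb y hy
      simpa using hhv n
    · exact (ball_subset_ball (by linarith)).trans hrU
  · rw [Metric.tendstoUniformlyOn_iff]
    intro ε hε
    have hlim : Tendsto (fun n : ℕ => 4 * M * (‖v‖ / (r/2)) ^ 2 * ‖h n‖) atTop (𝓝 0) := by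
      have : Tendsto (fun n : ℕ => ‖h n‖) atTop (𝓝 0) := by
        simp only [hhn]
        have := tendsto_inv_atTop_nhds_zero_nat (𝕜 := ℝ)
        exact this.comp (tendsto_atTop_mono (fun n => (by simp only [id]; omega)) tendsto_id)
      simpa using this.const_mul (4 * M * (‖v‖ / (r/2)) ^ 2)
    filter_upwards [hlim.eventually (gt_mem_nhds hε)] with n hn y hy
    refine lt_of_le_of_lt ?_ hn
    have ht := taylor_two (M := M) (c := y) (z := y + h n • v) (r := r/2) (hf.mono ((hb y hy).trans hrU))
      (fun z hz => hM z (hb y hy hz)) (by simpa using hhv n)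
    rw [add_sub_cancel_left, map_smul, norm_smul] at ht
    rw [dist_comm, dist_eq_norm]
    have : (h n)⁻¹ • (f (y + h n • v) - f y) - fderiv ℂ f y v
        = (h n)⁻¹ • (f (y + h n • v) - f y - h n • fderiv ℂ f y v) := by
      rw [smul_sub (h n)⁻¹ (_ - _), inv_smul_smul₀ (hh0 n)]
    rw [this, norm_smul, norm_inv]
    have hp : 0 < ‖h n‖ := norm_pos_iff.2 (hh0 n)
    rw [inv_mul_le_iff₀ hp]
    refine ht.trans (le_of_eq ?_)
    ring

theorem diff_fderiv [FiniteDimensional ℂ E] [CompleteSpace F] {f : E → F} {U : Set E} (hU : IsOpen U)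
    (hf : DifferentiableOn ℂ f U) : DifferentiableOn ℂ (fderiv ℂ f) U := by
  have h1 : ∀ v, DifferentiableOn ℂ (fun x => fderiv ℂ f x v) U := diff_fderiv_apply hU hf
  let b := Module.finBasis ℂ E
  have : fderiv ℂ f = fun x => ∑ i, (ContinuousLinearMap.smulRightL ℂ E F
      (LinearMap.toContinuousLinearMap (b.coord i))) (fderiv ℂ f x (b i)) := by
    funext x
    ext v
    conv_lhs => rw [← b.sum_repr v, map_sum]
    simp
  rw [this]
  refine DifferentiableOn.fun_sum fun i _ => ?_
  exact (ContinuousLinearMap.differentiable _).comp_differentiableOn (h1 _)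

theorem contDiffOn_one [FiniteDimensional ℂ E] [CompleteSpace F] {f : E → F} {U : Set E} (hU : IsOpen U)
    (hf : DifferentiableOn ℂ f U) : ContDiffOn ℂ 1 f U := by
  have := (contDiffOn_succ_iff_fderiv_of_isOpen (n := 0) (𝕜 := ℂ) (f := f) hU).2
    ⟨hf, by simp, contDiffOn_zero.2 (diff_fderiv hU hf).continuousOn⟩
  simpa using this

theorem strict_of_diff [FiniteDimensional ℂ E] [CompleteSpace F] {f : E → F} {U : Set E} (hU : IsOpen U)
    (hf : DifferentiableOn ℂ f U) {x : E} (hx : x ∈ U) : HasStrictFDerivAt f (fderiv ℂ f x) x :=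
  ((contDiffOn_one hU hf).contDiffAt (hU.mem_nhds hx)).hasStrictFDerivAt (by norm_num)

end P0

section P1
open scoped Topology

theorem ift_holo {E F : Type*} [NormedAddCommGroup E] [NormedSpace ℂ E] [FiniteDimensional ℂ E]
    [NormedAddCommGroup F] [NormedSpace ℂ F] [FiniteDimensional ℂ F]
    {f : E → F} {U : Set E} (hU : IsOpen U) (hf : DifferentiableOn ℂ f U) {a : E} (ha : a ∈ U)
    (A : E ≃L[ℂ] F) (hA : fderiv ℂ f a = A) :
    ∃ (W : Set F) (S : F → E), IsOpen W ∧ f a ∈ W ∧ DifferentiableOn ℂ S W ∧ S (f a) = a ∧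
      MapsTo S W U ∧ (∀ w ∈ W, f (S w) = w) ∧ HasFDerivAt S (A.symm : F →L[ℂ] E) (f a) := by
  have : CompleteSpace E := FiniteDimensional.complete ℂ E
  have : CompleteSpace F := FiniteDimensional.complete ℂ F
  have hc : ContDiffAt ℂ 1 f a := (contDiffOn_one hU hf).contDiffAt (hU.mem_nhds ha)
  have hd : HasFDerivAt f (A : E →L[ℂ] F) a := hA ▸
    (hf.differentiableAt (hU.mem_nhds ha)).hasFDerivAt
  let S := hc.localInverse hd one_ne_zero
  have hs : HasStrictFDerivAt f (A : E →L[ℂ] F) a := hA ▸ strict_of_diff hU hf ha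
  have hSc : ContDiffAt ℂ 1 S (f a) := hc.to_localInverse hd one_ne_zero
  have hSa : S (f a) = a := hs.localInverse_apply_image
  have hr : ∀ᶠ w in 𝓝 (f a), f (S w) = w := hs.eventually_right_inverse
  have hU' : ∀ᶠ w in 𝓝 (f a), S w ∈ U := hSc.continuousAt (by rw [hSa]; exact hU.mem_nhds ha)
  have hD : ∀ᶠ w in 𝓝 (f a), DifferentiableAt ℂ S w :=
    (hSc.eventually (by simp)).mono fun w hw => hw.differentiableAt one_ne_zero
  obtain ⟨W, hW, hWo, haW⟩ := _root_.mem_nhds_iff.1 (hr.and (hU'.and hD))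
  exact ⟨W, S, hWo, haW, fun w hw => (hW hw).2.2.differentiableWithinAt, hSa,
    fun w hw => (hW hw).2.1, fun w hw => (hW hw).1, hs.to_localInverse.hasFDerivAt⟩

theorem straighten {E : Type*} [NormedAddCommGroup E] [NormedSpace ℂ E] [FiniteDimensional ℂ E]
    {h : E → ℂ} {U : Set E} (hU : IsOpen U) (hf : DifferentiableOn ℂ h U) {a : E} (ha : a ∈ U)
    (h0 : h a = 0) (hL : fderiv ℂ h a ≠ 0) :
    ∃ (W : Set E) (S : E → E), IsOpen W ∧ 0 ∈ W ∧ DifferentiableOn ℂ S W ∧ S 0 = a ∧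
      MapsTo S W U ∧ InjOn S W ∧ (∀ w ∈ W, h (S w) = fderiv ℂ h a w) ∧
      HasFDerivAt S (ContinuousLinearMap.id ℂ E) 0 := by
  set L := fderiv ℂ h a with hLd
  obtain ⟨v, hv⟩ : ∃ v, L v = 1 := by
    obtain ⟨v, hv⟩ := DFunLike.ne_iff.1 hL
    exact ⟨(L v)⁻¹ • v, by simp at hv; simp [hv]⟩
  let Ψ : E → E := fun x => h x • v + (x - a - L (x - a) • v)
  have hΨd : DifferentiableOn ℂ Ψ U := by
    refine (hf.smul_const v).add ?_
    fun_prop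
  have hΨa : Ψ a = 0 := by simp [Ψ, h0]
  have hha : HasFDerivAt h L a := (hf.differentiableAt (hU.mem_nhds ha)).hasFDerivAt
  have hΨ' : fderiv ℂ Ψ a = (ContinuousLinearEquiv.refl ℂ E : E →L[ℂ] E) := by
    have h1 : HasFDerivAt (fun x => x - a) (ContinuousLinearMap.id ℂ E) a :=
      (hasFDerivAt_id a).sub_const a
    have h2 : HasFDerivAt (fun x => L (x - a)) (L.comp (ContinuousLinearMap.id ℂ E)) a :=
      L.hasFDerivAt.comp a h1
    have h3 : HasFDerivAt Ψ _ a := (hha.smul_const v).add (h1.sub (h2.smul_const v))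
    rw [h3.fderiv]
    ext x
    simp
  obtain ⟨W, S, hWo, haW, hSd, hSa, hSU, hS, hS'⟩ := ift_holo hU hΨd ha _ hΨ'
  rw [hΨa] at haW hSa hS'
  refine ⟨W, S, hWo, haW, hSd, hSa, hSU, fun x hx y hy hxy => ?_, fun w hw => ?_, ?_⟩
  · rw [← hS x hx, ← hS y hy, hxy]
  · have := congrArg L (hS w hw)
    simpa [Ψ, hv] using this
  · simpa using hS'

theorem inj_deriv_ne_zero {f : ℂ → ℂ} {U : Set ℂ} (hU : IsOpen U) (hf : DifferentiableOn ℂ f U)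
    (hinj : InjOn f U) {a : ℂ} (ha : a ∈ U) : deriv f a ≠ 0 := by
  intro hd
  have han : AnalyticAt ℂ (fun z => f z - f a) a :=
    (hf.analyticAt (hU.mem_nhds ha)).sub analyticAt_const
  have hUa := hU.mem_nhds ha
  have hne : ¬ ∀ᶠ z in 𝓝 a, f z - f a = 0 := by
    intro h
    have h2 : ∀ᶠ z in 𝓝[≠] a, z ∈ U ∧ f z - f a = 0 :=
      (Filter.Eventually.and hUa h).filter_mono nhdsWithin_le_nhds
    obtain ⟨z, ⟨hzU, hz⟩, hza⟩ := (h2.and self_mem_nhdsWithin).exists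
    exact hza (hinj hzU ha (sub_eq_zero.1 hz))
  obtain ⟨k, g, hg, hg0, hfg⟩ := (han.exists_eventuallyEq_pow_smul_nonzero_iff).2 hne
  have hk : 2 ≤ k := by
    by_contra hk
    push Not at hk
    interval_cases k
    · have := hfg.self_of_nhds
      simp at this; exact hg0 this.symm
    · have h1 : HasDerivAt (fun z => f z - f a) (deriv f a) a :=
        ((hf.differentiableAt hUa).hasDerivAt).sub_const _
      have h2 : HasDerivAt (fun z => (z - a) ^ 1 • g z) (g a) a := by
        have := (((hasDerivAt_id a).sub_const a).fun_mul hg.differentiableAt.hasDerivAt)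
        simpa using this
      have h3 := h1.congr_of_eventuallyEq (Filter.EventuallyEq.symm hfg)
      rw [hd] at h3
      exact hg0 (h2.unique h3)
  have hk0 : (k : ℂ) ≠ 0 := Nat.cast_ne_zero.2 (by omega)
  -- local root
  let u : ℂ → ℂ := fun z => Complex.exp (Complex.log (g z / g a) / k)
  have hga : g a / g a ∈ Complex.slitPlane := by rw [div_self hg0]; exact Complex.one_mem_slitPlane
  have hu : AnalyticAt ℂ u a := by
    refine (((hg.div analyticAt_const hg0).clog hga).div analyticAt_const hk0).cexp
  have hua : u a = 1 := by simp [u, div_self hg0]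
  have huk : ∀ᶠ z in 𝓝 a, u z ^ k = g z / g a := by
    have : ∀ᶠ z in 𝓝 a, g z ≠ 0 := hg.continuousAt.eventually_ne hg0
    filter_upwards [this] with z hz
    simp only [u]
    rw [← Complex.exp_nat_mul, mul_div_cancel₀ _ hk0, Complex.exp_log (div_ne_zero hz hg0)]
  let φ : ℂ → ℂ := fun z => (z - a) * u z
  have hφa : AnalyticAt ℂ φ a := (analyticAt_id.sub analyticAt_const).mul hu
  have hφ' : HasStrictDerivAt φ 1 a := by
    have h1 : HasDerivAt φ 1 a := by
      have := ((hasDerivAt_id a).sub_const a).fun_mul hu.differentiableAt.hasDerivAt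
      simpa [hua] using this
    have h2 := hφa.hasStrictDerivAt
    rwa [h1.deriv] at h2
  have hmap := hφ'.map_nhds_eq one_ne_zero
  have hφ0 : φ a = 0 := by simp [φ]
  rw [hφ0] at hmap
  -- good neighborhood
  have hgood : {z | z ∈ U ∧ f z - f a = φ z ^ k * g a} ∈ 𝓝 a := by
    filter_upwards [hUa, hfg, huk] with z h1 h2 h3
    refine ⟨h1, ?_⟩
    rw [h2, mul_pow, h3, smul_eq_mul]
    field_simp
  have him : φ '' {z | z ∈ U ∧ f z - f a = φ z ^ k * g a} ∈ 𝓝 (0 : ℂ) := by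
    rw [← hmap]; exact image_mem_map hgood
  obtain ⟨ε, hε, hb⟩ := Metric.mem_nhds_iff.1 him
  let ξ : ℂ := Complex.exp (2 * Real.pi * Complex.I / k)
  have hξ : IsPrimitiveRoot ξ k := Complex.isPrimitiveRoot_exp k (by omega)
  have hξn : ‖ξ‖ = 1 := hξ.norm'_eq_one (by omega)
  have hξ1 : ξ ≠ 1 := hξ.ne_one (by omega)
  obtain ⟨z1, ⟨hz1, hz1'⟩, e1⟩ := hb (show ((ε/2 : ℝ) : ℂ) ∈ ball (0:ℂ) ε by
    rw [mem_ball_zero_iff, Complex.norm_real, Real.norm_of_nonneg (by linarith)]; linarith)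
  obtain ⟨z2, ⟨hz2, hz2'⟩, e2⟩ := hb (show ξ * ((ε/2 : ℝ) : ℂ) ∈ ball (0:ℂ) ε by
    rw [mem_ball_zero_iff, norm_mul, hξn, one_mul, Complex.norm_real, Real.norm_of_nonneg (by linarith)]; linarith)
  have : z1 = z2 := by
    apply hinj hz1 hz2
    rw [e1] at hz1'
    rw [e2, mul_pow, hξ.pow_eq_one, one_mul, ← hz1'] at hz2'
    exact (sub_left_injective hz2').symm
  rw [← this, e1] at e2
  have h0 : ((ε/2 : ℝ) : ℂ) ≠ 0 := by exact_mod_cast (by positivity : ε/2 ≠ 0)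
  exact hξ1 (mul_right_cancel₀ h0 (by rw [one_mul]; exact e2.symm))

end P1

section P1b
open scoped Topology

universe u v

theorem const_of_dirs {E F : Type*} [NormedAddCommGroup E] [NormedSpace ℂ E] [FiniteDimensional ℂ E]
    [NormedAddCommGroup F] [NormedSpace ℂ F] [FiniteDimensional ℂ F] [Nontrivial E]
    {f : E → F} {U : Set E} (hU : IsOpen U) (hf : DifferentiableOn ℂ f U) (hinj : InjOn f U)
    {a : E} (ha : a ∈ U) (h0 : fderiv ℂ f a = 0)
    (hall : ∀ h : E → F, DifferentiableOn ℂ h U → (∀ x ∈ U, fderiv ℂ f x = 0 → h x = 0) →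
      ∀ x ∈ U, fderiv ℂ f x = 0 → fderiv ℂ h x = 0) : False := by
  have : CompleteSpace F := FiniteDimensional.complete ℂ F
  obtain ⟨v, hv⟩ := exists_ne (0 : E)
  let h : ℕ → E → F := fun k => Nat.rec (fun x => fderiv ℂ f x v) (fun _ g x => fderiv ℂ g x v) k
  have hs : ∀ k, h (k+1) = fun x => fderiv ℂ (h k) x v := fun k => rfl
  have hd : ∀ k, DifferentiableOn ℂ (h k) U := by
    intro k
    induction k with
    | zero => exact diff_fderiv_apply hU hf v
    | succ k ih => rw [hs]; exact diff_fderiv_apply hU ih v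
  have hz : ∀ k, ∀ x ∈ U, fderiv ℂ f x = 0 → h k x = 0 := by
    intro k
    induction k with
    | zero => intro x _ hx0; simp [h, hx0]
    | succ k ih => intro x hx hx0; rw [hs]; simp [hall _ (hd k) ih x hx hx0]
  let l : ℂ → E := fun ζ => a + ζ • v
  have hl : ∀ ζ, HasDerivAt l v ζ := fun ζ => by
    have := ((hasDerivAt_id ζ).smul_const v).const_add a
    rw [one_smul] at this
    exact this
  have hlc : Continuous l := by fun_prop
  have hO : IsOpen (l ⁻¹' U) := hU.preimage hlc
  have hder : ∀ (g : E → F), DifferentiableOn ℂ g U → ∀ ζ ∈ l ⁻¹' U,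
      HasDerivAt (fun ζ => g (l ζ)) (fderiv ℂ g (l ζ) v) ζ := by
    intro g hg ζ hζ
    exact ((hg.differentiableAt (hU.mem_nhds hζ)).hasFDerivAt).comp_hasDerivAt ζ (hl ζ)
  have hit : ∀ k, ∀ ζ ∈ l ⁻¹' U, iteratedDeriv (k+1) (fun ζ => f (l ζ)) ζ = h k (l ζ) := by
    intro k
    induction k with
    | zero => intro ζ hζ; rw [zero_add, iteratedDeriv_one]; exact (hder f hf ζ hζ).deriv
    | succ k ih =>
      intro ζ hζ
      rw [iteratedDeriv_succ]
      have : iteratedDeriv (k+1) (fun ζ => f (l ζ)) =ᶠ[𝓝 ζ] fun ζ => h k (l ζ) := by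
        filter_upwards [hO.mem_nhds hζ] with y hy using ih y hy
      rw [this.deriv_eq, (hder _ (hd k) ζ hζ).deriv, hs]
  have h00 : (0 : ℂ) ∈ l ⁻¹' U := by simpa [l] using ha
  obtain ⟨r, hr, hb⟩ := Metric.isOpen_iff.1 hO 0 h00
  have hball : DifferentiableOn ℂ (fun ζ => f (l ζ)) (ball 0 r) := fun ζ hζ =>
    (hder f hf ζ (hb hζ)).differentiableAt.differentiableWithinAt
  have hmem : ((r/2 : ℝ) : ℂ) ∈ ball (0:ℂ) r := by
    rw [mem_ball_zero_iff, Complex.norm_real, Real.norm_of_nonneg (by linarith)]; linarith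
  have hser := Complex.taylorSeries_eq_on_ball hball hmem
  rw [tsum_eq_single 0] at hser
  · have he : f (l 0) = f (l ((r/2 : ℝ) : ℂ)) := by simpa using hser
    have := hinj h00 (hb hmem) he
    simp [l, hv, hr.ne'] at this
  · intro k hk
    obtain ⟨k, rfl⟩ := Nat.exists_eq_succ_of_ne_zero hk
    rw [Nat.succ_eq_add_one, hit k 0 h00, hz k (l 0) h00 (by simpa [l] using h0)]
    simp

theorem osgood_step2 {E F : Type*} [NormedAddCommGroup E] [NormedSpace ℂ E] [FiniteDimensional ℂ E]
    [NormedAddCommGroup F] [NormedSpace ℂ F] [FiniteDimensional ℂ F]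
    (hn : 2 ≤ Module.finrank ℂ E) (hEF : Module.finrank ℂ E = Module.finrank ℂ F)
    {f : E → F} {U : Set E} (hU : IsOpen U) (hf : DifferentiableOn ℂ f U) (hinj : InjOn f U)
    (hdich : ∀ x ∈ U, fderiv ℂ f x ≠ 0 → Function.Injective (fderiv ℂ f x))
    {a : E} (ha : a ∈ U) : fderiv ℂ f a ≠ 0 := by
  intro h0
  have : CompleteSpace E := FiniteDimensional.complete ℂ E
  have : CompleteSpace F := FiniteDimensional.complete ℂ F
  have hnt : Nontrivial E := Module.nontrivial_of_finrank_pos (R := ℂ) (by omega)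
  by_cases hall : ∀ h : E → F, DifferentiableOn ℂ h U → (∀ x ∈ U, fderiv ℂ f x = 0 → h x = 0) →
      ∀ x ∈ U, fderiv ℂ f x = 0 → fderiv ℂ h x = 0
  · exact const_of_dirs hU hf hinj ha h0 hall
  push Not at hall
  obtain ⟨h', hh'd, hh'z, b, hb, hfb, hh'b⟩ := hall
  obtain ⟨v, hv⟩ := DFunLike.ne_iff.1 hh'b
  obtain ⟨ℓ, hℓ⟩ := SeparatingDual.exists_ne_zero (R := ℂ) hv
  let h : E → ℂ := fun x => ℓ (h' x)
  have hhd : DifferentiableOn ℂ h U := ℓ.differentiable.comp_differentiableOn hh'd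
  have hhz : ∀ x ∈ U, fderiv ℂ f x = 0 → h x = 0 := fun x hx hx0 => by simp [h, hh'z x hx hx0]
  have hhb : fderiv ℂ h b v ≠ 0 := by
    have : HasFDerivAt h (ℓ.comp (fderiv ℂ h' b)) b :=
      ℓ.hasFDerivAt.comp b (hh'd.differentiableAt (hU.mem_nhds hb)).hasFDerivAt
    rw [this.fderiv]; exact hℓ
  clear_value h
  -- equivalences at nonsingular points
  have heq : ∀ x ∈ U, fderiv ℂ f x ≠ 0 → ∃ e : E ≃L[ℂ] F, fderiv ℂ f x = e := by
    intro x hx hx0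
    let e := (LinearEquiv.ofInjectiveOfFinrankEq (fderiv ℂ f x : E →ₗ[ℂ] F) (hdich x hx hx0) hEF).toContinuousLinearEquiv
    refine ⟨e, ?_⟩
    ext y; rfl
  have hDf := diff_fderiv hU hf
  let I : E → (F →L[ℂ] E) := fun x => (fderiv ℂ f x).inverse
  have hId : ∀ x ∈ U, fderiv ℂ f x ≠ 0 → DifferentiableAt ℂ I x := by
    intro x hx hx0
    obtain ⟨e, he⟩ := heq x hx hx0
    have h1 : DifferentiableAt ℂ (ContinuousLinearMap.inverse : (E →L[ℂ] F) → _) (fderiv ℂ f x) := by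
      rw [he]; exact (contDiffAt_map_inverse (n := 1) e).differentiableAt one_ne_zero
    exact h1.comp x (hDf.differentiableAt (hU.mem_nhds hx))
  -- h near b in direction v: strict derivative
  have hst := strict_of_diff hU hhd hb
  have hnz : ∀ᶠ p : E × E in 𝓝 (b, b), ‖h p.1 - h p.2 - fderiv ℂ h b (p.1 - p.2)‖ ≤
      (‖fderiv ℂ h b v‖ / (2 * ‖v‖)) * ‖p.1 - p.2‖ := by
    have hv0 : v ≠ 0 := by rintro rfl; simp at hhb
    exact hst.isLittleO.bound (by positivity)
  obtain ⟨r, hr, hrb⟩ := Metric.mem_nhds_iff.1 (hnz.and (prod_mem_nhds (hU.mem_nhds hb) (hU.mem_nhds hb)))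
  have hv0 : v ≠ 0 := by rintro rfl; simp at hhb
  have hvp : 0 < ‖v‖ := norm_pos_iff.2 hv0
  have hkey : ∀ x ∈ ball b r, ∀ y ∈ ball b r, ∀ ζ : ℂ, ζ ≠ 0 → y = x + ζ • v → h x = 0 → h y ≠ 0 := by
    intro x hx y hy ζ hζ hyx hx0 hy0
    rw [hyx] at hy0
    have := (hrb (show (y, x) ∈ ball (b, b) r by
      rw [← ball_prod_same]; exact ⟨hy, hx⟩)).1
    simp only [hy0, hx0, hyx, add_sub_cancel_left, map_smul, norm_smul, smul_eq_mul, sub_zero, zero_sub,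
      norm_neg, norm_mul] at this
    have h2 : 0 < ‖ζ‖ * ‖fderiv ℂ h b v‖ := mul_pos (norm_pos_iff.2 hζ) (norm_pos_iff.2 hhb)
    have h3 : ‖fderiv ℂ h b v‖ / (2 * ‖v‖) * (‖ζ‖ * ‖v‖) = ‖ζ‖ * ‖fderiv ℂ h b v‖ / 2 := by
      field_simp
    linarith
  have hrU : ball b r ⊆ U := fun y hy => (hrb (show (y, b) ∈ ball (b, b) r by
      rw [← ball_prod_same]; exact ⟨hy, mem_ball_self hr⟩)).2.1
  set ε : ℝ := r / (2 * ‖v‖) with hε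
  have hεp : 0 < ε := by positivity
  have hεv : ε * ‖v‖ = r / 2 := by rw [hε]; field_simp
  have hball : ∀ x ∈ ball b (r/2), ∀ ζ ∈ closedBall (0:ℂ) ε, x + ζ • v ∈ ball b r := by
    intro x hx ζ hζ
    rw [mem_ball, dist_eq_norm] at hx ⊢
    rw [mem_closedBall_zero_iff] at hζ
    calc ‖x + ζ • v - b‖ = ‖(x - b) + ζ • v‖ := by congr 1; abel
      _ ≤ ‖x - b‖ + ‖ζ‖ * ‖v‖ := by rw [← norm_smul]; exact norm_add_le _ _
      _ < r / 2 + ε * ‖v‖ := add_lt_add_of_lt_of_le hx (by gcongr)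
      _ = r := by rw [hεv]; ring
  have hhb0 : h b = 0 := hhz b hb hfb
  have hxb : b ∈ ball b (r/2) := mem_ball_self (by linarith)
  have hns : ∀ x ∈ ball b (r/2), h x = 0 → ∀ ζ ∈ closedBall (0:ℂ) ε, ζ ≠ 0 → fderiv ℂ f (x + ζ • v) ≠ 0 := by
    intro x hx hx0 ζ hζ hζ0 hcon
    have hy := hball x hx ζ hζ
    exact hkey x (ball_subset_ball (by linarith) hx) _ hy ζ hζ0 rfl hx0 (hhz _ (hrU hy) hcon)
  have hlc : Continuous (fun p : E × ℂ => p.1 + p.2 • v) := by fun_prop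
  have hsub : ∀ ζ ∈ sphere (0:ℂ) ε, ζ ∈ closedBall (0:ℂ) ε ∧ ζ ≠ 0 := fun ζ hζ =>
    ⟨sphere_subset_closedBall hζ, by rintro rfl; simp at hζ; linarith⟩
  have hIc : ∀ ζ ∈ sphere (0:ℂ) ε, ContinuousAt I (b + ζ • v) := fun ζ hζ =>
    (hId _ (hrU (hball b hxb ζ (hsub ζ hζ).1)) (hns b hxb hhb0 ζ (hsub ζ hζ).1 (hsub ζ hζ).2)).continuousAt
  obtain ⟨C, hC⟩ := (isCompact_sphere (0:ℂ) ε).exists_bound_of_continuousOn (f := fun ζ => I (b + ζ • v))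
    (fun ζ hζ => ((hIc ζ hζ).comp_of_eq (f := fun ζ : ℂ => b + ζ • v) (by fun_prop) rfl).continuousWithinAt)
  have hev : ∀ᶠ x in 𝓝 b, ∀ ζ ∈ sphere (0:ℂ) ε, ‖I (x + ζ • v)‖ ≤ C + 1 := by
    apply (isCompact_sphere (0:ℂ) ε).eventually_forall_of_forall_eventually
    intro ζ hζ
    have hc : ContinuousAt (fun p : E × ℂ => ‖I (p.1 + p.2 • v)‖) (b, ζ) :=
      ((hIc ζ hζ).comp_of_eq hlc.continuousAt rfl).norm
    have := hc.eventually (gt_mem_nhds (show ‖I (b + ζ • v)‖ < C + 1 by linarith [hC ζ hζ]))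
    exact this.mono fun p hp => hp.le
  have hsm : ∀ᶠ x in 𝓝 b, (C + 1) * ‖fderiv ℂ f x‖ < 1 := by
    have hc : ContinuousAt (fun x => (C + 1) * ‖fderiv ℂ f x‖) b :=
      continuousAt_const.mul (hDf.differentiableAt (hU.mem_nhds hb)).continuousAt.norm
    exact hc.eventually (gt_mem_nhds (by simp [hfb]))
  have hHZ : ∀ᶠ x in 𝓝 b, h x = 0 → fderiv ℂ f x = 0 := by
    filter_upwards [hev, hsm, ball_mem_nhds b (half_pos hr)] with x hx1 hx2 hx3 hx0
    by_contra hne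
    have hall : ∀ ζ ∈ closedBall (0:ℂ) ε, fderiv ℂ f (x + ζ • v) ≠ 0 := by
      intro ζ hζ
      by_cases h : ζ = 0
      · simpa [h] using hne
      · exact hns x hx3 hx0 ζ hζ h
    have hdc : DiffContOnCl ℂ (fun ζ : ℂ => I (x + ζ • v)) (ball 0 ε) := by
      apply DifferentiableOn.diffContOnCl
      rw [closure_ball _ hεp.ne']
      intro ζ hζ
      exact ((hId _ (hrU (hball x hx3 ζ hζ)) (hall ζ hζ)).comp ζ (f := fun ζ : ℂ => x + ζ • v)
        (by fun_prop)).differentiableWithinAt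
    have hb0 := Complex.norm_le_of_forall_mem_frontier_norm_le isBounded_ball hdc (C := C + 1)
      (fun z hz => hx1 z (by rwa [frontier_ball _ hεp.ne'] at hz)) (z := 0)
      (subset_closure (mem_ball_self hεp))
    simp only [zero_smul, add_zero] at hb0
    obtain ⟨e, he⟩ := heq x (hrU (ball_subset_ball (by linarith) hx3)) hne
    have hI : I x = (e.symm : F →L[ℂ] E) := by simp [I, he]
    obtain ⟨w, hw⟩ := exists_ne (0 : E)
    have h1 : ‖w‖ ≤ (C + 1) * ‖fderiv ℂ f x‖ * ‖w‖ := by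
      calc ‖w‖ = ‖I x (fderiv ℂ f x w)‖ := by rw [hI, he]; simp
        _ ≤ ‖I x‖ * (‖fderiv ℂ f x‖ * ‖w‖) := (I x).le_opNorm_of_le ((fderiv ℂ f x).le_opNorm w)
        _ ≤ (C + 1) * (‖fderiv ℂ f x‖ * ‖w‖) := by gcongr
        _ = _ := by ring
    have hwp : 0 < ‖w‖ := norm_pos_iff.2 hw
    nlinarith
  -- curve
  have hL : fderiv ℂ h b ≠ 0 := fun hc => hhb (by simp [hc])
  obtain ⟨W, S, hWo, h0W, hSd, hSb, hSU, hSi, hhS, -⟩ := straighten hU hhd hb hhb0 hL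
  obtain ⟨u, hu, hu0⟩ : ∃ u : E, fderiv ℂ h b u = 0 ∧ u ≠ 0 := by
    have h1 := LinearMap.finrank_range_add_finrank_ker (fderiv ℂ h b : E →ₗ[ℂ] ℂ)
    have h2 : Module.finrank ℂ (LinearMap.range (fderiv ℂ h b : E →ₗ[ℂ] ℂ)) ≤ 1 := by
      simpa using Submodule.finrank_le (LinearMap.range (fderiv ℂ h b : E →ₗ[ℂ] ℂ))
    have : Nontrivial (LinearMap.ker (fderiv ℂ h b : E →ₗ[ℂ] ℂ)) :=
      Module.nontrivial_of_finrank_pos (R := ℂ) (by omega)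
    obtain ⟨u, hu⟩ := exists_ne (0 : LinearMap.ker (fderiv ℂ h b : E →ₗ[ℂ] ℂ))
    exact ⟨u, u.2, by simpa using hu⟩
  let l : ℂ → E := fun ζ => ζ • u
  have hlc : Continuous l := by fun_prop
  have hSc : ContinuousAt S 0 := hSd.continuousOn.continuousAt (hWo.mem_nhds h0W)
  have hnear : ∀ᶠ ζ in 𝓝 (0:ℂ), l ζ ∈ W ∧ fderiv ℂ f (S (l ζ)) = 0 := by
    have h1 : ∀ᶠ w in 𝓝 (0:E), h (S w) = 0 → fderiv ℂ f (S w) = 0 :=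
      hSc.eventually (by rw [hSb]; exact hHZ)
    have h2 : Tendsto l (𝓝 0) (𝓝 0) := by simpa [l] using hlc.tendsto 0
    filter_upwards [h2.eventually (h1.and (hWo.mem_nhds h0W))] with ζ hζ
    refine ⟨hζ.2, hζ.1 ?_⟩
    rw [hhS _ hζ.2]; simp [l, hu]
  obtain ⟨δ, hδ, hδb⟩ := Metric.mem_nhds_iff.1 hnear
  have hconst : ∀ ζ ∈ ball (0:ℂ) δ, f (S (l ζ)) = f (S (l 0)) := by
    intro ζ hζ
    have hder : ∀ ξ ∈ ball (0:ℂ) δ, HasDerivAt (fun ξ => f (S (l ξ))) 0 ξ := by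
      intro ξ hξ
      have h1 : HasDerivAt l u ξ := by simpa using (hasDerivAt_id ξ).smul_const u
      have h2 := (hSd.differentiableAt (hWo.mem_nhds (hδb hξ).1)).hasFDerivAt.comp_hasDerivAt ξ h1
      have h3 := (hf.differentiableAt (hU.mem_nhds (hSU (hδb hξ).1))).hasFDerivAt.comp_hasDerivAt ξ h2
      have h4 : fderiv ℂ f (S (l ξ)) = 0 := (hδb hξ).2
      rw [h4] at h3
      exact h3
    exact (convex_ball (0:ℂ) δ).is_const_of_fderivWithin_eq_zero (𝕜 := ℂ)
      (fun ξ hξ => (hder ξ hξ).differentiableAt.differentiableWithinAt)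
      (fun ξ hξ => by
        rw [fderivWithin_of_isOpen isOpen_ball hξ]
        ext; simpa using (hder ξ hξ).deriv) hζ (mem_ball_self hδ)
  have hmem : ((δ/2 : ℝ) : ℂ) ∈ ball (0:ℂ) δ := by
    rw [mem_ball_zero_iff, Complex.norm_real, Real.norm_of_nonneg (by linarith)]; linarith
  have hz0 := mem_ball_self (x := (0:ℂ)) hδ
  have := hSi (hδb hmem).1 (hδb hz0).1 (hinj (hSU (hδb hmem).1) (hSU (hδb hz0).1) (hconst _ hmem))
  simp [l, hu0, hδ.ne'] at this


theorem osgood_step1 {n : ℕ} {E : Type u} {F : Type v} [NormedAddCommGroup E] [NormedSpace ℂ E] [FiniteDimensional ℂ E]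
    [NormedAddCommGroup F] [NormedSpace ℂ F] [FiniteDimensional ℂ F]
    (hE : Module.finrank ℂ E = n + 1) (hF : Module.finrank ℂ F = n + 1)
    (ih : ∀ (E : Type u) (F : Type v) [NormedAddCommGroup E] [NormedSpace ℂ E] [FiniteDimensional ℂ E]
      [NormedAddCommGroup F] [NormedSpace ℂ F] [FiniteDimensional ℂ F],
      Module.finrank ℂ E = n → Module.finrank ℂ F = n → ∀ (U : Set E) (f : E → F), IsOpen U →
      DifferentiableOn ℂ f U → InjOn f U → ∀ a ∈ U, Function.Injective (fderiv ℂ f a))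
    {f : E → F} {U : Set E} (hU : IsOpen U) (hf : DifferentiableOn ℂ f U) (hinj : InjOn f U)
    {a : E} (ha : a ∈ U) (hne : fderiv ℂ f a ≠ 0) : Function.Injective (fderiv ℂ f a) := by
  obtain ⟨v, hv⟩ := DFunLike.ne_iff.1 hne
  obtain ⟨ℓ, hℓ⟩ := SeparatingDual.exists_eq_one (R := ℂ) hv
  set A := fderiv ℂ f a with hA
  set u := A v with hu
  have hfa : HasFDerivAt f A a := (hf.differentiableAt (hU.mem_nhds ha)).hasFDerivAt
  let h : E → ℂ := fun x => ℓ (f x - f a)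
  have hhd : DifferentiableOn ℂ h U := ℓ.differentiable.comp_differentiableOn (hf.sub_const _)
  have hh' : fderiv ℂ h a = ℓ.comp A := (ℓ.hasFDerivAt.comp a (hfa.sub_const _)).fderiv
  have hL : fderiv ℂ h a ≠ 0 := by
    intro hc
    rw [hh'] at hc
    have := DFunLike.congr_fun hc v
    simp [← hu, hℓ] at this
  obtain ⟨W, S, hWo, h0W, hSd, hSa, hSU, hSi, hhS, hS'⟩ := straighten hU hhd ha (by simp [h]) hL
  rw [hh'] at hhS
  let N := LinearMap.ker (ℓ.comp A : E →ₗ[ℂ] ℂ)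
  let M := LinearMap.ker (ℓ : F →ₗ[ℂ] ℂ)
  have hrank : ∀ (X : Type _) [NormedAddCommGroup X] [NormedSpace ℂ X] [FiniteDimensional ℂ X]
      (m : X →ₗ[ℂ] ℂ) (x : X), m x = 1 → Module.finrank ℂ X = n + 1 →
      Module.finrank ℂ (LinearMap.ker m) = n := by
    intro X _ _ _ m x hx hX
    have h1 := LinearMap.finrank_range_add_finrank_ker m
    have h2 : LinearMap.range m = ⊤ := by
      rw [LinearMap.range_eq_top]
      intro c
      exact ⟨c • x, by simp [hx]⟩
    rw [h2, finrank_top, hX] at h1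
    simp at h1; omega
  have hrank' : ∀ (X : Type _) [NormedAddCommGroup X] [NormedSpace ℂ X] [FiniteDimensional ℂ X]
      (m : X →ₗ[ℂ] ℂ) (x : X), m x = 1 → Module.finrank ℂ X = n + 1 →
      Module.finrank ℂ (LinearMap.ker m) = n := by
    intro X _ _ _ m x hx hX
    have h1 := LinearMap.finrank_range_add_finrank_ker m
    have h2 : LinearMap.range m = ⊤ := by
      rw [LinearMap.range_eq_top]
      intro c
      exact ⟨c • x, by simp [hx]⟩
    rw [h2, finrank_top, hX] at h1
    simp at h1; omega
  have hN : Module.finrank ℂ N = n := hrank E _ v hℓ hE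
  have hM : Module.finrank ℂ M = n := hrank' F _ u hℓ hF
  let P : F →L[ℂ] M := (ContinuousLinearMap.id ℂ F - ℓ.smulRight u).codRestrict M (by
    intro w
    simp [M, hℓ])
  have hP : ∀ w, (P w : F) = w - ℓ w • u := fun w => rfl
  let g : N → M := fun y => P (f (S y) - f a)
  have hgd : DifferentiableOn ℂ g (Subtype.val ⁻¹' W) := by
    refine P.differentiable.comp_differentiableOn (DifferentiableOn.sub_const ?_ _)
    refine hf.comp (hSd.comp (t := W) (f := fun y : N => (y : E)) N.subtypeL.differentiable.differentiableOn ?_) ?_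
    · exact fun y hy => hy
    · exact fun y hy => hSU hy
  have hgv : ∀ y : N, (y : E) ∈ W → (g y : F) = f (S y) - f a := by
    intro y hy
    have h1 : ℓ (f (S y) - f a) = 0 := (hhS y hy).trans y.2
    simp only [g, hP, h1]; simp
  have hgi : InjOn g (Subtype.val ⁻¹' W) := by
    intro x hx y hy hxy
    have := congrArg (Subtype.val) hxy
    rw [hgv x hx, hgv y hy] at this
    exact Subtype.ext (hSi hx hy (hinj (hSU hx) (hSU hy) (sub_left_injective this)))
  have key := ih N M hN hM (Subtype.val ⁻¹' W) g (hWo.preimage continuous_subtype_val) hgd hgi 0 h0W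
  have hg' : HasFDerivAt g (P.comp (A.comp ((ContinuousLinearMap.id ℂ E).comp N.subtypeL))) 0 := by
    have h1 : HasFDerivAt (fun y : N => (y : E)) N.subtypeL 0 := N.subtypeL.hasFDerivAt
    have h2 : HasFDerivAt (fun y : N => S y) ((ContinuousLinearMap.id ℂ E).comp N.subtypeL) 0 :=
      HasFDerivAt.comp (0 : N) (g := S) (by simpa using hS') h1
    have h3 : HasFDerivAt (fun y : N => f (S y)) (A.comp ((ContinuousLinearMap.id ℂ E).comp N.subtypeL)) 0 :=
      HasFDerivAt.comp (0 : N) (g := f) (by simpa [hSa] using hfa) h2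
    exact P.hasFDerivAt.comp (0 : N) (h3.sub_const _)
  rw [hg'.fderiv] at key
  rw [injective_iff_map_eq_zero]
  intro x hx
  have hxN : x ∈ N := by simp [N, hx]
  have : (⟨x, hxN⟩ : N) = 0 := by
    apply key
    simp [hx]
  simpa using this

theorem osgood (n : ℕ) : ∀ (E : Type u) (F : Type v) [NormedAddCommGroup E] [NormedSpace ℂ E] [FiniteDimensional ℂ E]
      [NormedAddCommGroup F] [NormedSpace ℂ F] [FiniteDimensional ℂ F],
      Module.finrank ℂ E = n → Module.finrank ℂ F = n → ∀ (U : Set E) (f : E → F), IsOpen U →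
      DifferentiableOn ℂ f U → InjOn f U → ∀ a ∈ U, Function.Injective (fderiv ℂ f a) := by
  induction n with
  | zero =>
    intro E F _ _ _ _ _ _ hE hF U f hU hf hinj a ha
    have := Module.finrank_zero_iff.1 hE
    exact Function.injective_of_subsingleton _
  | succ n ih =>
    intro E F _ _ _ _ _ _ hE hF U f hU hf hinj a ha
    have hd : ∀ x ∈ U, fderiv ℂ f x ≠ 0 → Function.Injective (fderiv ℂ f x) :=
      fun x hx => osgood_step1 hE hF ih hU hf hinj hx
    refine hd a ha ?_
    rcases Nat.eq_zero_or_pos n with rfl | hn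
    · intro h0
      have e : F ≃ₗ[ℂ] ℂ := LinearEquiv.ofFinrankEq F ℂ (by simp [hF])
      let e' := e.toContinuousLinearEquiv
      have : Nontrivial E := Module.nontrivial_of_finrank_pos (R := ℂ) (by omega)
      obtain ⟨v, hv⟩ := exists_ne (0 : E)
      let l : ℂ → E := fun ζ => a + ζ • v
      have hl : ∀ ζ, HasDerivAt l v ζ := fun ζ => by
        have := ((hasDerivAt_id ζ).smul_const v).const_add a
        rw [one_smul] at this
        exact this
      have hlc : Continuous l := by fun_prop
      have h00 : (0 : ℂ) ∈ l ⁻¹' U := by simpa [l] using ha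
      have hder : ∀ ζ ∈ l ⁻¹' U, HasDerivAt (fun ζ => e' (f (l ζ))) (e' (fderiv ℂ f (l ζ) v)) ζ := by
        intro ζ hζ
        exact e'.toContinuousLinearMap.hasFDerivAt.comp_hasDerivAt ζ
          (((hf.differentiableAt (hU.mem_nhds hζ)).hasFDerivAt).comp_hasDerivAt ζ (hl ζ))
      refine inj_deriv_ne_zero (f := fun ζ => e' (f (l ζ))) (hU.preimage hlc)
        (fun ζ hζ => (hder ζ hζ).differentiableAt.differentiableWithinAt) ?_ h00 ?_
      · intro x hx y hy hxy
        have := hinj hx hy (e'.injective hxy)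
        have h2 : x • v = y • v := add_left_cancel this
        exact smul_left_injective ℂ hv h2
      · rw [(hder 0 h00).deriv]
        simp [l, h0]
    · exact osgood_step2 (by omega) (by omega) hU hf hinj hd ha

end P1b

section P1c
open scoped Topology

theorem inv_holo {E F : Type*} [NormedAddCommGroup E] [NormedSpace ℂ E] [FiniteDimensional ℂ E]
    [NormedAddCommGroup F] [NormedSpace ℂ F] [FiniteDimensional ℂ F]
    (hEF : Module.finrank ℂ E = Module.finrank ℂ F)
    {f : E → F} {U : Set E} (hU : IsOpen U) (hf : DifferentiableOn ℂ f U) (hinj : InjOn f U) :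
    IsOpen (f '' U) ∧ (∃ g : F → E, DifferentiableOn ℂ g (f '' U) ∧ ∀ x ∈ U, g (f x) = x) ∧
      ∀ x ∈ U, ∃ A : E ≃L[ℂ] F, fderiv ℂ f x = A := by
  have : CompleteSpace E := FiniteDimensional.complete ℂ E
  have : CompleteSpace F := FiniteDimensional.complete ℂ F
  have heq : ∀ x ∈ U, ∃ e : E ≃L[ℂ] F, fderiv ℂ f x = e := by
    intro x hx
    let e := (LinearEquiv.ofInjectiveOfFinrankEq (fderiv ℂ f x : E →ₗ[ℂ] F)
      (osgood _ E F rfl hEF.symm U f hU hf hinj x hx) hEF).toContinuousLinearEquiv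
    refine ⟨e, ?_⟩
    ext y; rfl
  have key : ∀ x ∈ U, ∃ W S, IsOpen W ∧ f x ∈ W ∧ DifferentiableOn ℂ S W ∧ MapsTo S W U ∧
      ∀ w ∈ W, f (S w) = w := by
    intro x hx
    obtain ⟨e, he⟩ := heq x hx
    obtain ⟨W, S, h1, h2, h3, h4, h5, h6, h7⟩ := ift_holo hU hf hx e he
    exact ⟨W, S, h1, h2, h3, h5, h6⟩
  refine ⟨?_, ⟨Function.invFunOn f U, ?_, fun x hx => hinj.leftInvOn_invFunOn hx⟩, heq⟩
  · rw [isOpen_iff_mem_nhds]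
    rintro _ ⟨x, hx, rfl⟩
    obtain ⟨W, S, hW, hxW, -, hm, hs⟩ := key x hx
    filter_upwards [hW.mem_nhds hxW] with w hw using ⟨S w, hm hw, hs w hw⟩
  · rintro _ ⟨x, hx, rfl⟩
    obtain ⟨W, S, hW, hxW, hd, hm, hs⟩ := key x hx
    have : Function.invFunOn f U =ᶠ[𝓝 (f x)] S := by
      filter_upwards [hW.mem_nhds hxW] with w hw
      conv_lhs => rw [← hs w hw]
      exact hinj.leftInvOn_invFunOn (hm hw)
    exact ((hd.differentiableAt (hW.mem_nhds hxW)).congr_of_eventuallyEq this).differentiableWithinAt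

end P1c

section P2
open scoped Topology

variable {E : Type*} [NormedAddCommGroup E] [NormedSpace ℂ E]

/-- A bound for a continuous map on a closed ball. -/
theorem bdd_closedBall {F : Type*} [NormedAddCommGroup F] [FiniteDimensional ℂ E] {P : E → F}
    (hP : Continuous P) (M : ℝ) :
    ∃ B, 0 ≤ B ∧ ∀ x, ‖x‖ ≤ M → ‖P x‖ ≤ B := by
  have : ProperSpace E := FiniteDimensional.proper ℂ E
  obtain ⟨B, hB⟩ := (isCompact_closedBall (0:E) M).exists_bound_of_continuousOn hP.continuousOn
  exact ⟨max B 0, le_max_right _ _, fun x hx => (hB x (by simpa using hx)).trans (le_max_left _ _)⟩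

theorem lip_closedBall {F : Type*} [NormedAddCommGroup F] [NormedSpace ℂ F] [FiniteDimensional ℂ E] {P : E → F}
    (hP : Differentiable ℂ P) (M : ℝ) :
    ∃ L, 0 ≤ L ∧ ∀ x y, ‖x‖ ≤ M → ‖y‖ ≤ M → ‖P x - P y‖ ≤ L * ‖x - y‖ := by
  obtain ⟨B, hB0, hB⟩ := bdd_closedBall hP.continuous (M + 1)
  refine ⟨2 * B / 1, by positivity, fun x y hx hy => ?_⟩
  refine (convex_closedBall (0:E) M).norm_image_sub_le_of_norm_fderiv_le (𝕜 := ℂ) (fun z _ => hP z) ?_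
    (by simpa using hy) (by simpa using hx)
  intro z hz
  refine cauchy_fderiv one_pos hP.differentiableOn fun w hw => hB w ?_
  rw [mem_closedBall_zero_iff] at hz
  rw [mem_ball, dist_eq_norm] at hw
  calc ‖w‖ = ‖z + (w - z)‖ := by congr 1; abel
    _ ≤ ‖z‖ + ‖w - z‖ := norm_add_le _ _
    _ ≤ M + 1 := by linarith

/-- Entire vector fields which are infinitesimal generators, up to second order, of families of
automorphisms. -/
def Good (P : E → E) : Prop :=
  Differentiable ℂ P ∧ ∃ φ ψ : ℂ → E → E,
    (∀ h, Differentiable ℂ (φ h) ∧ Differentiable ℂ (ψ h) ∧ Function.LeftInverse (ψ h) (φ h) ∧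
      Function.RightInverse (ψ h) (φ h)) ∧
    ∀ M : ℝ, ∃ C, 0 ≤ C ∧ ∃ δ, 0 < δ ∧ ∀ h : ℂ, ‖h‖ ≤ δ → ∀ y, ‖y‖ ≤ M →
      ‖φ h y - y - h • P y‖ ≤ C * ‖h‖ ^ 2

theorem Good.zero : Good (0 : E → E) :=
  ⟨differentiable_const 0, fun _ => id, fun _ => id, fun _ => ⟨differentiable_id, differentiable_id,
    fun _ => rfl, fun _ => rfl⟩, fun M => ⟨0, le_rfl, 1, one_pos, fun h _ y _ => by simp⟩⟩

theorem Good.smul {P : E → E} (hP : Good P) (c : ℂ) : Good (c • P) := by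
  obtain ⟨hd, φ, ψ, ha, hb⟩ := hP
  refine ⟨hd.const_smul c, fun h => φ (h * c), fun h => ψ (h * c), fun h => ha _, fun M => ?_⟩
  obtain ⟨C, hC, δ, hδ, hh⟩ := hb M
  refine ⟨C * ‖c‖ ^ 2, by positivity, δ / (‖c‖ + 1), by positivity, fun h hhδ y hy => ?_⟩
  have := hh (h * c) (by
    rw [norm_mul]
    rw [le_div_iff₀ (by positivity)] at hhδ
    nlinarith [norm_nonneg h, norm_nonneg c]) y hy
  rw [norm_mul, mul_pow, mul_smul] at this
  simp only [Pi.smul_apply]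
  linarith

theorem Good.add [FiniteDimensional ℂ E] {P Q : E → E} (hP : Good P) (hQ : Good Q) : Good (P + Q) := by
  obtain ⟨hPd, φ, ψ, ha, hb⟩ := hP
  obtain ⟨hQd, φ', ψ', ha', hb'⟩ := hQ
  refine ⟨hPd.add hQd, fun h => φ h ∘ φ' h, fun h => ψ' h ∘ ψ h, fun h =>
    ⟨(ha h).1.comp (ha' h).1, (ha' h).2.1.comp (ha h).2.1, (ha h).2.2.1.comp (ha' h).2.2.1,
      (ha h).2.2.2.comp (ha' h).2.2.2⟩, fun M => ?_⟩
  obtain ⟨C', hC', δ', hδ', hh'⟩ := hb' M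
  obtain ⟨B, hB, hBQ⟩ := bdd_closedBall hQd.continuous M
  obtain ⟨C, hC, δ, hδ, hh⟩ := hb (M + B + C')
  obtain ⟨L, hL, hLip⟩ := lip_closedBall hPd (M + B + C')
  refine ⟨C + L * (B + C') + C', by positivity, min (min δ δ') 1, by positivity, fun h hhδ y hy => ?_⟩
  have h1 : ‖h‖ ≤ δ := hhδ.trans ((min_le_left _ _).trans (min_le_left _ _))
  have h2 : ‖h‖ ≤ δ' := hhδ.trans ((min_le_left _ _).trans (min_le_right _ _))
  have h3 : ‖h‖ ≤ 1 := hhδ.trans (min_le_right _ _)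
  have h0 := norm_nonneg h
  set z := φ' h y with hz
  have e1 := hh' h h2 y hy
  rw [← hz] at e1
  have e2 : ‖z - y‖ ≤ ‖h‖ * (B + C') := by
    calc ‖z - y‖ = ‖(z - y - h • Q y) + h • Q y‖ := by congr 1; abel
      _ ≤ C' * ‖h‖ ^ 2 + ‖h‖ * B := by
        refine (norm_add_le _ _).trans (add_le_add e1 ?_)
        rw [norm_smul]; gcongr; exact hBQ y hy
      _ ≤ ‖h‖ * (B + C') := by nlinarith [mul_nonneg (mul_nonneg hC' h0) (sub_nonneg.2 h3)]
  have e3 : ‖z‖ ≤ M + B + C' := by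
    calc ‖z‖ = ‖y + (z - y)‖ := by congr 1; abel
      _ ≤ M + ‖h‖ * (B + C') := (norm_add_le _ _).trans (add_le_add hy e2)
      _ ≤ M + B + C' := by nlinarith [mul_nonneg (sub_nonneg.2 h3) (add_nonneg hB hC')]
  have e4 := hh h h1 z e3
  have e5 := hLip z y e3 (by linarith)
  have : (φ h ∘ φ' h) y - y - h • (P + Q) y =
      (φ h z - z - h • P z) + h • (P z - P y) + (z - y - h • Q y) := by
    simp only [Function.comp_apply, Pi.add_apply, smul_add, smul_sub]
    rw [← hz]; abel
  rw [this]
  calc _ ≤ C * ‖h‖^2 + ‖h‖ * (L * (‖h‖ * (B + C'))) + C' * ‖h‖^2 := by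
        refine (norm_add₃_le).trans (add_le_add (add_le_add e4 ?_) e1)
        rw [norm_smul]; gcongr; exact e5.trans (by gcongr)
    _ = _ := by ring

/-- The good fields form a submodule. -/
def goodSub (E : Type*) [NormedAddCommGroup E] [NormedSpace ℂ E] [FiniteDimensional ℂ E] :
    Submodule ℂ (E → E) where
  carrier := {P | Good P}
  zero_mem' := Good.zero
  add_mem' := fun h1 h2 => h1.add h2
  smul_mem' := fun c _ h => h.smul c

theorem good_shear {q : E → ℂ} (hq : Differentiable ℂ q) (v : E) (hv : ∀ y (ζ : ℂ), q (y + ζ • v) = q y) :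
    Good (fun y => q y • v) := by
  have hd : ∀ h : ℂ, Differentiable ℂ (fun y : E => y + (h * q y) • v) := fun h => by fun_prop
  refine ⟨by fun_prop, fun h y => y + (h * q y) • v, fun h y => y + ((-h) * q y) • v, fun h =>
    ⟨hd h, hd (-h), fun y => ?_, fun y => ?_⟩, fun M => ⟨0, le_rfl, 1, one_pos, fun h _ y _ => ?_⟩⟩
  · simp [hv]
  · have := hv y (-h * q y)
    simp only at this ⊢
    rw [this]; simp
  · simp [mul_smul]

theorem good_overshear [FiniteDimensional ℂ E] {q : E → ℂ} (hq : Differentiable ℂ q) (v : E)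
    (hv : ∀ y (ζ : ℂ), q (y + ζ • v) = q y) (μ : E →L[ℂ] ℂ) (hμ : μ v = 1) :
    Good (fun y => (q y * μ y) • v) := by
  have hd : ∀ h : ℂ, Differentiable ℂ (fun y : E => y + ((Complex.exp (h * q y) - 1) * μ y) • v) :=
    fun h => by fun_prop
  have hinv : ∀ h : ℂ, ∀ y, (fun y : E => y + ((Complex.exp (-h * q y) - 1) * μ y) • v)
      ((fun y : E => y + ((Complex.exp (h * q y) - 1) * μ y) • v) y) = y := by
    intro h y
    simp only [hv, map_add, map_smul, hμ, smul_eq_mul, mul_one, add_assoc, ← add_smul]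
    have : Complex.exp (-h * q y) * Complex.exp (h * q y) = 1 := by
      rw [← Complex.exp_add]; simp
    convert add_zero y
    have h2 : (Complex.exp (h * q y) - 1) * μ y +
      (Complex.exp (-h * q y) - 1) * (μ y + (Complex.exp (h * q y) - 1) * μ y) = 0 := by
      linear_combination (μ y) * this
    rw [h2, zero_smul]
  refine ⟨by fun_prop, fun h y => y + ((Complex.exp (h * q y) - 1) * μ y) • v,
    fun h y => y + ((Complex.exp (-h * q y) - 1) * μ y) • v, fun h =>
    ⟨hd h, hd (-h), fun y => hinv h y, fun y => ?_⟩, fun M => ?_⟩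
  · have := hinv (-h) y
    rwa [neg_neg] at this
  · obtain ⟨B, hB, hBq⟩ := bdd_closedBall hq.continuous M
    obtain ⟨B', hB', hBμ⟩ := bdd_closedBall μ.continuous M
    refine ⟨B^2 * B' * ‖v‖, by positivity, 1 / (B + 1), by positivity, fun h hh y hy => ?_⟩
    have e1 : ‖h * q y‖ ≤ ‖h‖ * B := by rw [norm_mul]; gcongr; exact hBq y hy
    have e2 : ‖h * q y‖ ≤ 1 := by
      refine e1.trans ?_
      rw [le_div_iff₀ (by positivity)] at hh
      nlinarith [norm_nonneg h]
    have e3 := Complex.norm_exp_sub_one_sub_id_le e2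
    have : y + ((Complex.exp (h * q y) - 1) * μ y) • v - y - h • (q y * μ y) • v =
      ((Complex.exp (h * q y) - 1 - h * q y) * μ y) • v := by
      rw [smul_smul, add_sub_cancel_left, ← sub_smul]; congr 1; ring
    rw [this, norm_smul, norm_mul]
    calc _ ≤ (‖h‖ * B)^2 * B' * ‖v‖ := by
          gcongr
          · exact e3.trans (by gcongr)
          · exact hBμ y hy
      _ = _ := by ring

theorem coeff_mem {X : Type*} [AddCommGroup X] [Module ℂ X] (W : Submodule ℂ X) (w : ℕ → X) (k : ℕ)
    (h : ∀ c : ℂ, ∑ j ∈ Finset.range k, c ^ j • w j ∈ W) (j : ℕ) (hj : j < k) : w j ∈ W := by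
  rw [← Submodule.Quotient.mk_eq_zero, ← Module.forall_dual_apply_eq_zero_iff ℂ]
  intro ℓ
  let p : Polynomial ℂ := ∑ j ∈ Finset.range k, Polynomial.C (ℓ (Submodule.Quotient.mk (w j))) * Polynomial.X ^ j
  have hp : p = 0 := by
    apply Polynomial.funext
    intro c
    have h1 := (Submodule.Quotient.mk_eq_zero W).2 (h c)
    have h2 : ℓ (W.mkQ (∑ j ∈ Finset.range k, c ^ j • w j)) = 0 := by
      rw [Submodule.mkQ_apply, h1, map_zero]
    rw [map_sum, map_sum] at h2
    simp only [map_smul, smul_eq_mul, Submodule.mkQ_apply] at h2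
    simp only [p, Polynomial.eval_finset_sum, Polynomial.eval_mul, Polynomial.eval_C,
      Polynomial.eval_pow, Polynomial.eval_X, Polynomial.eval_zero]
    rw [← h2]
    exact Finset.sum_congr rfl fun _ _ => mul_comm _ _
  have := congrArg (fun p => p.coeff j) hp
  simpa [p, Polynomial.finset_sum_coeff, Polynomial.coeff_C_mul, Polynomial.coeff_X_pow, hj] using this

theorem good_pow [FiniteDimensional ℂ E] {q : E → ℂ} (hq : Differentiable ℂ q) {v₁ v₂ : E}
    (hv₁ : ∀ y (ζ : ℂ), q (y + ζ • v₁) = q y) (hv₂ : ∀ y (ζ : ℂ), q (y + ζ • v₂) = q y)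
    {μ₁ μ₂ : E →L[ℂ] ℂ} (h11 : μ₁ v₁ = 1) (h12 : μ₁ v₂ = 0) (h21 : μ₂ v₁ = 0) (h22 : μ₂ v₂ = 1) (d : ℕ) :
    Good (fun y => (q y * μ₁ y ^ d) • v₁) := by
  let B : ℕ → E → ℂ := fun j y => q y * ((μ₂ y) ^ j * (μ₁ y) ^ (d - j) * (d.choose j))
  let w : ℕ → E → E := fun j y => (Nat.casesOn j 0 (fun i => B i y) : ℂ) • v₁ - B j y • v₂
  have hsum : ∀ s : ℂ, ∑ j ∈ Finset.range (d+2), s ^ j • w j =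
      fun y => (q y * (μ₁ y + s * μ₂ y) ^ d) • (s • v₁ - v₂) := by
    intro s
    funext y
    have e0 : q y * (μ₁ y + s * μ₂ y) ^ d = ∑ j ∈ Finset.range (d+1), s ^ j * B j y := by
      rw [add_comm, add_pow, Finset.mul_sum]
      exact Finset.sum_congr rfl fun j _ => by simp only [B]; ring
    have e1 : ∑ j ∈ Finset.range (d+2), s ^ j * B j y = q y * (μ₁ y + s * μ₂ y) ^ d := by
      rw [Finset.sum_range_succ, e0]; simp [B]
    have e2 : ∑ j ∈ Finset.range (d+2), s ^ j * (Nat.casesOn j 0 (fun i => B i y) : ℂ) =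
        s * (q y * (μ₁ y + s * μ₂ y) ^ d) := by
      rw [Finset.sum_range_succ', e0, Finset.mul_sum]
      have : s ^ 0 * (Nat.casesOn 0 0 (fun i => B i y) : ℂ) = 0 := mul_zero _
      rw [this, add_zero]
      exact Finset.sum_congr rfl fun j _ => by rw [pow_succ', mul_assoc]
    simp only [Finset.sum_apply, Pi.smul_apply, w, smul_sub, smul_smul, Finset.sum_sub_distrib,
      ← Finset.sum_smul]
    rw [e1, e2, mul_comm s]
  have h1 : w 1 ∈ goodSub E := by
    refine coeff_mem (goodSub E) w (d+2) (fun s => ?_) 1 (by omega)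
    rw [hsum]
    refine good_shear (q := fun y => q y * (μ₁ y + s * μ₂ y) ^ d) (by fun_prop) _ fun y ζ => ?_
    have : y + ζ • (s • v₁ - v₂) = (y + (ζ * s) • v₁) + (-ζ) • v₂ := by
      rw [smul_sub, smul_smul]; simp; abel
    congr 1
    · rw [this, hv₂, hv₁]
    · congr 1
      simp [h11, h12, h21, h22]; ring
  have h2 : (fun y => (q y * μ₁ y ^ (d-1) * μ₂ y) • v₂) ∈ goodSub E := by
    refine good_overshear (q := fun y => q y * μ₁ y ^ (d-1)) (by fun_prop) v₂ (fun y ζ => ?_) μ₂ h22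
    simp [hv₂, h12]
  have h3 := (goodSub E).add_mem h1 ((goodSub E).smul_mem (d : ℂ) h2)
  refine (congrArg (· ∈ goodSub E) ?_).mpr h3
  funext y
  simp only [w, B, Pi.add_apply, Pi.smul_apply, smul_smul]
  simp only [pow_zero, one_mul, Nat.sub_zero, Nat.choose_zero_right, Nat.cast_one, mul_one, pow_one,
    Nat.choose_one_right]
  rw [sub_add, ← sub_smul]
  have : q y * (μ₂ y * μ₁ y ^ (d - 1) * ↑d) - ↑d * (q y * μ₁ y ^ (d - 1) * μ₂ y) = 0 := by ring
  rw [this]; simp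

theorem good_monomial [FiniteDimensional ℂ E] {q : E → ℂ} (hq : Differentiable ℂ q) {v₁ v₂ : E}
    (hv₁ : ∀ y (ζ : ℂ), q (y + ζ • v₁) = q y) (hv₂ : ∀ y (ζ : ℂ), q (y + ζ • v₂) = q y)
    {μ₁ μ₂ : E →L[ℂ] ℂ} (h11 : μ₁ v₁ = 1) (h12 : μ₁ v₂ = 0) (h21 : μ₂ v₁ = 0) (h22 : μ₂ v₂ = 1) (a b : ℕ) :
    Good (fun y => (q y * (μ₁ y ^ a * μ₂ y ^ b)) • v₁) := by
  have h1 : ∀ c : ℂ, Good (fun y => (q y * (μ₁ + c • μ₂) y ^ (a+b)) • v₁) := by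
    intro c
    refine good_pow hq (v₁ := v₁) (v₂ := v₂ - c • v₁) (μ₂ := μ₂) hv₁ (fun y ζ => ?_) ?_ ?_ ?_ ?_ _
    · have : y + ζ • (v₂ - c • v₁) = (y + ζ • v₂) + (-(ζ * c)) • v₁ := by
        rw [smul_sub, smul_smul]; simp; abel
      rw [this, hv₁, hv₂]
    all_goals simp [h11, h12, h21, h22]
  let w : ℕ → E → E := fun j y => (q y * ((μ₂ y) ^ j * (μ₁ y) ^ (a + b - j) * ((a+b).choose j))) • v₁
  have h2 : w b ∈ goodSub E := by
    refine coeff_mem (goodSub E) w (a+b+1) (fun c => ?_) b (by omega)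
    refine (congrArg (· ∈ goodSub E) ?_).mpr (h1 c)
    funext y
    simp only [Finset.sum_apply, Pi.smul_apply, w, smul_smul, ← Finset.sum_smul]
    congr 1
    simp only [ContinuousLinearMap.add_apply, ContinuousLinearMap.smul_apply, smul_eq_mul]
    rw [add_comm (μ₁ y), add_pow, Finset.mul_sum]
    exact Finset.sum_congr rfl fun j _ => by ring
  have hne : ((a+b).choose b : ℂ) ≠ 0 := by
    exact_mod_cast (Nat.choose_pos (by omega)).ne'
  have h3 := (goodSub E).smul_mem (((a+b).choose b : ℂ)⁻¹) h2
  refine (congrArg (· ∈ goodSub E) ?_).mpr h3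
  funext y
  simp only [w, Pi.smul_apply, smul_smul]
  congr 1
  rw [Nat.add_sub_cancel]
  field_simp

end P2

section P2b
open scoped Topology

theorem good_mono_En {n : ℕ} (m : Fin n → ℕ) {i j : Fin n} (hij : j ≠ i) :
    Good (fun z : En n => (∏ k, z k ^ m k) • (EuclideanSpace.single i (1:ℂ) : En n)) := by
  let q : En n → ℂ := fun z => ∏ k ∈ (Finset.univ.erase i).erase j, z k ^ m k
  have hc : ∀ k, Differentiable ℂ (fun z : En n => z k) := fun k =>
    (EuclideanSpace.proj k : En n →L[ℂ] ℂ).differentiable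
  have hq : Differentiable ℂ q := by
    intro z
    have h1 : ∀ k ∈ (Finset.univ.erase i).erase j, DifferentiableAt ℂ (fun z : En n => z k ^ m k) z :=
      fun k _ => ((hc k) z).fun_pow _
    exact (HasFDerivAt.finsetProd fun k hk => (h1 k hk).hasFDerivAt).differentiableAt
  have hinv : ∀ l, (l = i ∨ l = j) → ∀ y (ζ : ℂ), q (y + ζ • (EuclideanSpace.single l (1:ℂ) : En n)) = q y := by
    intro l hl y ζ
    refine Finset.prod_congr rfl fun k hk => ?_
    have : k ≠ l := by
      simp only [Finset.mem_erase] at hk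
      rcases hl with rfl | rfl
      · exact hk.2.1
      · exact hk.1
    simp [this]
  have := good_monomial hq (v₁ := EuclideanSpace.single i (1:ℂ)) (v₂ := EuclideanSpace.single j (1:ℂ))
    (hinv i (Or.inl rfl)) (hinv j (Or.inr rfl))
    (μ₁ := (EuclideanSpace.proj i : En n →L[ℂ] ℂ))
    (μ₂ := (EuclideanSpace.proj j : En n →L[ℂ] ℂ))
    (by simp) (by simp [hij.symm]) (by simp [hij]) (by simp) (m i) (m j)
  refine (congrArg Good ?_).mpr this
  funext z
  congr 1
  rw [← Finset.mul_prod_erase Finset.univ _ (Finset.mem_univ i),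
    ← Finset.mul_prod_erase (Finset.univ.erase i) _ (Finset.mem_erase.2 ⟨hij, Finset.mem_univ j⟩)]
  simp only [q, PiLp.proj_apply]
  ring

theorem good_poly {n : ℕ} (hn : n ≠ 1) {p : En n → En n} (hp : IsPolyMap n p) : Good p := by
  obtain ⟨q, hq⟩ := hp
  have : p = ∑ i, ∑ m ∈ (q i).support, (q i).coeff m •
      (fun z : En n => (∏ k, z k ^ m k) • (EuclideanSpace.single i (1:ℂ) : En n)) := by
    funext z
    ext i
    rw [hq, MvPolynomial.eval_eq']
    simp only [Finset.sum_apply, Pi.smul_apply]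
    simp only [PiLp.smul_apply, WithLp.ofLp_sum, WithLp.ofLp_smul, Finset.sum_apply, Pi.smul_apply, smul_eq_mul]
    rw [Finset.sum_eq_single i]
    · simp
    · intro b _ hb
      simp [hb.symm]
    · simp
  rw [this]
  refine Submodule.sum_mem (goodSub (En n)) fun i _ => Submodule.sum_mem _ fun m _ =>
    Submodule.smul_mem _ _ ?_
  have : ∃ j : Fin n, j ≠ i := by
    have : Nontrivial (Fin n) := Fin.nontrivial_iff_two_le.2 (by have := i.pos; omega)
    exact exists_ne i
  obtain ⟨j, hj⟩ := this
  exact good_mono_En _ hj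

end P2b

section P3
open scoped Topology

variable {E : Type*} [NormedAddCommGroup E] [NormedSpace ℂ E] [FiniteDimensional ℂ E]

/-- One Euler step: comparison with the radial contraction in the coordinates given by `f`. -/
theorem euler_one {f g : E → E} {U : Set E} (hf : DifferentiableOn ℂ f U)
    (hΩ : IsOpen (f '' U)) (hg : DifferentiableOn ℂ g (f '' U)) (hgf : ∀ x ∈ U, g (f x) = x)
    {R₀ R₁ : ℝ} (hR₁ : 0 < R₁) (hR : R₁ < R₀) (hRU : closedBall 0 R₀ ⊆ U) :
    ∃ L, 0 ≤ L ∧ ∃ ε, 0 < ε ∧ ∃ C, 0 ≤ C ∧ ∃ h₀, 0 < h₀ ∧ ∀ h : ℝ, 0 ≤ h → h ≤ h₀ → ∀ w : E, ‖w‖ ≤ R₁ →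
      ∀ (y : E) (e : ℝ), ‖y - (f w - (h:ℂ) • fderiv ℂ f w w)‖ ≤ e → e + C * h ^ 2 < ε →
        y ∈ f '' U ∧ ‖g y - ((1 - h : ℝ) : ℂ) • w‖ ≤ L * (e + C * h ^ 2) := by
  have : ProperSpace E := FiniteDimensional.proper ℂ E
  have hR₁U : closedBall 0 R₁ ⊆ U := (closedBall_subset_closedBall hR.le).trans hRU
  obtain ⟨M, hM⟩ := (isCompact_closedBall (0:E) R₀).exists_bound_of_continuousOn (hf.continuousOn.mono hRU)
  have hK : IsCompact (f '' closedBall 0 R₁) :=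
    (isCompact_closedBall (0:E) R₁).image_of_continuousOn (hf.continuousOn.mono hR₁U)
  obtain ⟨ε, hε, hεK⟩ := hK.exists_cthickening_subset_open hΩ (image_mono hR₁U)
  obtain ⟨B, hB⟩ := (hK.cthickening (r := ε)).exists_bound_of_continuousOn (hg.continuousOn.mono hεK)
  have hball : ∀ y ∈ f '' closedBall 0 R₁, ball y ε ⊆ cthickening ε (f '' closedBall 0 R₁) := fun y hy =>
    ball_subset_closedBall.trans (closedBall_subset_cthickening hy _)
  have hM0 : 0 ≤ M := (norm_nonneg _).trans (hM 0 (by simp; linarith))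
  have hB0 : 0 ≤ B := by
    have h0 : f 0 ∈ f '' closedBall 0 R₁ := mem_image_of_mem _ (by simp; linarith)
    exact (norm_nonneg _).trans (hB (f 0) (hball _ h0 (mem_ball_self hε)))
  set r := R₀ - R₁ with hr
  have hrp : 0 < r := sub_pos.2 hR
  refine ⟨2 * B / (ε/2), by positivity, ε/2, by positivity, 4 * M * (R₁ / r) ^ 2, by positivity,
    min 1 (r / (2 * R₁)), by positivity, fun h hh0 hh w hw y e hy he => ?_⟩
  have hh1 : h ≤ 1 := hh.trans (min_le_left _ _)
  have hhr : h * R₁ < r := by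
    have := hh.trans (min_le_right _ _)
    rw [le_div_iff₀ (by positivity)] at this
    nlinarith
  have hwU : w ∈ U := hR₁U (by simpa using hw)
  have hnorm : ‖((1 - h : ℝ) : ℂ) • w - w‖ ≤ h * R₁ := by
    have : ((1 - h : ℝ) : ℂ) • w - w = (-(h:ℂ)) • w := by push_cast; module
    rw [this, norm_smul, norm_neg, Complex.norm_real, Real.norm_of_nonneg hh0]; gcongr
  have hbw : ball w r ⊆ closedBall 0 R₀ := by
    intro z hz
    rw [mem_ball, dist_eq_norm] at hz
    rw [mem_closedBall_zero_iff]
    calc ‖z‖ = ‖w + (z - w)‖ := by congr 1; abel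
      _ ≤ ‖w‖ + ‖z - w‖ := norm_add_le _ _
      _ ≤ R₀ := by linarith
  have ht := taylor_two (f := f) (c := w) (z := ((1 - h : ℝ) : ℂ) • w) (r := r) (M := M)
    (hf.mono (hbw.trans hRU)) (fun z hz => hM z (hbw hz)) (by
      rw [mem_ball, dist_eq_norm]; linarith)
  have hsub : ((1 - h : ℝ) : ℂ) • w - w = (-(h:ℂ)) • w := by push_cast; module
  have ht' : ‖f (((1 - h : ℝ) : ℂ) • w) - (f w - (h:ℂ) • fderiv ℂ f w w)‖ ≤ 4 * M * (R₁ / r) ^ 2 * h^2 := by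
    calc _ = ‖f (((1 - h : ℝ) : ℂ) • w) - f w - fderiv ℂ f w (((1 - h : ℝ) : ℂ) • w - w)‖ := by
          rw [hsub, map_smul]; congr 1; module
      _ ≤ _ := ht
      _ ≤ 4 * M * (h * R₁ / r)^2 := by gcongr
      _ = _ := by ring
  set w' := ((1 - h : ℝ) : ℂ) • w with hw'
  have hw'1 : ‖w'‖ ≤ R₁ := by
    rw [hw', norm_smul, Complex.norm_real, Real.norm_of_nonneg (by linarith)]
    nlinarith [norm_nonneg w]
  have hw'm : f w' ∈ f '' closedBall 0 R₁ := mem_image_of_mem _ (by simpa using hw'1)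
  have hd : ‖y - f w'‖ ≤ e + 4 * M * (R₁ / r) ^ 2 * h^2 := by
    calc _ = ‖(y - (f w - (h:ℂ) • fderiv ℂ f w w)) - (f w' - (f w - (h:ℂ) • fderiv ℂ f w w))‖ := by
          congr 1; abel
      _ ≤ _ := (norm_sub_le _ _).trans (add_le_add hy ht')
  have hyb : y ∈ ball (f w') (ε/2) := by rw [mem_ball, dist_eq_norm]; linarith
  have hsubb : ball (f w') ε ⊆ f '' U := (hball _ hw'm).trans hεK
  refine ⟨hsubb (ball_subset_ball (by linarith) hyb), ?_⟩
  have hb2 : ∀ z ∈ ball (f w') (ε/2), ball z (ε/2) ⊆ ball (f w') ε := fun z hz =>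
    ball_subset_ball' (by rw [mem_ball] at hz; linarith)
  have hl := (convex_ball (f w') (ε/2)).norm_image_sub_le_of_norm_fderiv_le (𝕜 := ℂ) (f := g)
    (C := 2 * B / (ε/2))
    (fun z hz => hg.differentiableAt (hΩ.mem_nhds (hsubb (ball_subset_ball (by linarith) hz))))
    (fun z hz => cauchy_fderiv (by linarith) (hg.mono ((hb2 z hz).trans hsubb)) fun x hx =>
      hB x (hball _ hw'm (hb2 z hz hx))) (mem_ball_self (by linarith)) hyb
  rw [hgf w' (hR₁U (by simpa using hw'1))] at hl
  exact hl.trans (by gcongr)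

/-- Andersén–Lempert type statement. -/
theorem euler_approx {f g : E → E} {U : Set E} (hf : DifferentiableOn ℂ f U)
    (hΩ : IsOpen (f '' U)) (hg : DifferentiableOn ℂ g (f '' U)) (hgf : ∀ x ∈ U, g (f x) = x)
    {R₀ R₁ : ℝ} (hR₁ : 0 < R₁) (hR : R₁ < R₀) (hRU : closedBall 0 R₀ ⊆ U)
    (hgood : ∀ η > 0, ∃ P, Good P ∧ ∀ w : E, ‖w‖ ≤ R₁ → ‖P (f w) - fderiv ℂ f w w‖ ≤ η)
    {θ : ℝ} (hθ : 0 < θ) :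
    ∃ Φ Ψ : E → E, Differentiable ℂ Φ ∧ Differentiable ℂ Ψ ∧ Function.LeftInverse Ψ Φ ∧
      Function.RightInverse Ψ Φ ∧ ∃ c : ℝ, 0 < c ∧ c ≤ θ ∧ ∀ w : E, ‖w‖ ≤ R₁ → ∃ w' : E, ‖w'‖ ≤ R₁ ∧
        Φ (f w) = f w' ∧ ‖w' - (c:ℂ) • w‖ ≤ θ * c := by
  have : ProperSpace E := FiniteDimensional.proper ℂ E
  have hR₁U : closedBall 0 R₁ ⊆ U := (closedBall_subset_closedBall hR.le).trans hRU
  obtain ⟨L, hL, ε, hε, C, hC, h₀, hh₀, hstep⟩ := euler_one hf hΩ hg hgf hR₁ hR hRU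
  obtain ⟨M, hM⟩ := (isCompact_closedBall (0:E) R₁).exists_bound_of_continuousOn (hf.continuousOn.mono hR₁U)
  obtain ⟨T, hT0, hTθ⟩ : ∃ T : ℝ, 0 < T ∧ Real.exp (-T) ≤ θ := by
    have h1 := (Real.tendsto_exp_neg_atTop_nhds_zero.eventually (gt_mem_nhds hθ)).and (eventually_gt_atTop 0)
    obtain ⟨T, h1, h2⟩ := h1.exists
    exact ⟨T, h2, h1.le⟩
  set s : ℝ := min (θ * Real.exp (-(2*T)) / T) R₁ with hs
  have hsp : 0 < s := by positivity
  -- choice of η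
  obtain ⟨η, hη, hηs⟩ : ∃ η > 0, L * η ≤ s / 2 := by
    refine ⟨s / 2 / (L + 1), by positivity, ?_⟩
    rw [mul_div_assoc', div_le_iff₀ (by positivity)]
    nlinarith
  obtain ⟨P, ⟨hPd, φ, ψ, ha, hb⟩, hPη⟩ := hgood η hη
  obtain ⟨C', hC', δ, hδ, hφ⟩ := hb M
  -- choice of N
  have hlim : Tendsto (fun N : ℕ => T / (N:ℝ)) atTop (𝓝 0) := tendsto_const_div_atTop_nhds_zero_nat T
  have hev : ∀ᶠ h : ℝ in 𝓝 0, h ≤ h₀ ∧ h ≤ δ ∧ h ≤ 1/2 ∧ L * (C' + C) * h ≤ s / 2 ∧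
      (h * η + C' * h^2) + C * h^2 < ε := by
    refine (eventually_le_nhds hh₀).and ((eventually_le_nhds hδ).and ((eventually_le_nhds (by norm_num)).and
      (Eventually.and ?_ ?_)))
    · have : Tendsto (fun h : ℝ => L * (C' + C) * h) (𝓝 0) (𝓝 (L * (C' + C) * 0)) :=
        (continuous_const.mul continuous_id).tendsto 0
      exact this.eventually (eventually_le_nhds (by simpa using by linarith))
    · have : Tendsto (fun h : ℝ => (h * η + C' * h^2) + C * h^2) (𝓝 0) (𝓝 ((0 * η + C' * 0^2) + C * 0^2)) :=
        (by fun_prop : Continuous (fun h : ℝ => (h * η + C' * h^2) + C * h^2)).tendsto 0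
      exact this.eventually (gt_mem_nhds (by simpa using hε))
  obtain ⟨N, ⟨hN1, hN2, hN3, hN4, hN5⟩, hN0⟩ := ((hlim.eventually hev).and (eventually_gt_atTop 0)).exists
  set h : ℝ := T / N with hh
  have hNp : (0:ℝ) < N := by exact_mod_cast hN0
  have hhp : 0 < h := by positivity
  have hNh : N * h = T := by rw [hh]; field_simp
  set α : E → E := φ (-(h:ℂ)) with hα
  set β : E → E := ψ (-(h:ℂ)) with hβ
  obtain ⟨hαd, hβd, hli, hri⟩ := ha (-(h:ℂ))
  have hone : ∀ w : E, ‖w‖ ≤ R₁ → ∃ w' : E, ‖w'‖ ≤ R₁ ∧ α (f w) = f w' ∧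
      ‖w' - ((1 - h : ℝ) : ℂ) • w‖ ≤ h * s := by
    intro w hw
    have h1 := hφ (-(h:ℂ)) (by rw [norm_neg, Complex.norm_real, Real.norm_of_nonneg hhp.le]; exact hN2)
      (f w) (hM w (by simpa using hw))
    rw [norm_neg, Complex.norm_real, Real.norm_of_nonneg hhp.le, ← hα] at h1
    have h2 : ‖α (f w) - (f w - (h:ℂ) • fderiv ℂ f w w)‖ ≤ h * η + C' * h^2 := by
      have : α (f w) - (f w - (h:ℂ) • fderiv ℂ f w w) =
        (α (f w) - f w - (-(h:ℂ)) • P (f w)) - (h:ℂ) • (P (f w) - fderiv ℂ f w w) := by module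
      rw [this]
      refine (norm_sub_le _ _).trans ?_
      rw [norm_smul, Complex.norm_real, Real.norm_of_nonneg hhp.le, add_comm]
      gcongr
      exact hPη w hw
    obtain ⟨⟨w', hw'U, hw'⟩, h4⟩ := hstep h hhp.le hN1 w hw (α (f w)) _ h2 hN5
    rw [← hw', hgf w' hw'U] at h4
    have h5 : ‖w' - ((1 - h : ℝ) : ℂ) • w‖ ≤ h * s := by
      refine h4.trans ?_
      have : L * (h * η + C' * h ^ 2 + C * h ^ 2) = h * (L * η + L * (C' + C) * h) := by ring
      rw [this]; gcongr; linarith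
    refine ⟨w', ?_, hw'.symm, h5⟩
    calc ‖w'‖ = ‖(w' - ((1 - h : ℝ) : ℂ) • w) + ((1 - h : ℝ) : ℂ) • w‖ := by congr 1; abel
      _ ≤ h * s + (1 - h) * R₁ := by
        refine (norm_add_le _ _).trans (add_le_add h5 ?_)
        rw [norm_smul, Complex.norm_real, Real.norm_of_nonneg (by linarith)]
        exact mul_le_mul_of_nonneg_left hw (by linarith)
      _ ≤ h * R₁ + (1 - h) * R₁ := by gcongr; exact min_le_right _ _
      _ = R₁ := by ring
  have hit : ∀ k : ℕ, ∀ w : E, ‖w‖ ≤ R₁ → ∃ w' : E, ‖w'‖ ≤ R₁ ∧ α^[k] (f w) = f w' ∧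
      ‖w' - (((1 - h) ^ k : ℝ) : ℂ) • w‖ ≤ k * (h * s) := by
    intro k
    induction k with
    | zero => intro w hw; exact ⟨w, hw, rfl, by simp⟩
    | succ k ih =>
      intro w hw
      obtain ⟨w', h1, h2, h3⟩ := ih w hw
      obtain ⟨w'', h4, h5, h6⟩ := hone w' h1
      refine ⟨w'', h4, by rw [Function.iterate_succ_apply', h2, h5], ?_⟩
      have : w'' - (((1 - h) ^ (k+1) : ℝ) : ℂ) • w = (w'' - ((1 - h : ℝ) : ℂ) • w') +
          ((1 - h : ℝ) : ℂ) • (w' - (((1 - h) ^ k : ℝ) : ℂ) • w) := by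
        rw [pow_succ']; push_cast; module
      rw [this]
      refine (norm_add_le _ _).trans ?_
      rw [norm_smul, Complex.norm_real, Real.norm_of_nonneg (by linarith)]
      rw [Nat.cast_succ]
      have h7 : (1 - h) * ‖w' - (((1 - h) ^ k : ℝ) : ℂ) • w‖ ≤ 1 * (k * (h * s)) := by
        gcongr; linarith
      linarith
  have hitd : ∀ (γ : E → E), Differentiable ℂ γ → Differentiable ℂ (γ^[N]) := fun γ hγ => hγ.iterate N
  refine ⟨α^[N], β^[N], hitd _ hαd, hitd _ hβd, hli.iterate N, hri.iterate N, (1 - h)^N, ?_, ?_, ?_⟩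
  · exact pow_pos (by linarith) _
  · calc (1 - h)^N ≤ (Real.exp (-h))^N := by
          refine pow_le_pow_left₀ (by linarith) ?_ _
          have := Real.add_one_le_exp (-h); linarith
      _ = Real.exp (-T) := by rw [← Real.exp_nat_mul, ← hNh]; congr 1; ring
      _ ≤ θ := hTθ
  · intro w hw
    obtain ⟨w', h1, h2, h3⟩ := hit N w hw
    refine ⟨w', h1, h2, h3.trans ?_⟩
    rw [← mul_assoc, hNh]
    have h4 : Real.exp (-(2*T)) ≤ (1 - h)^N := by
      calc Real.exp (-(2*T)) = (Real.exp (-(2*h)))^N := by rw [← Real.exp_nat_mul, ← hNh]; congr 1; ring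
        _ ≤ (1-h)^N := by
          refine pow_le_pow_left₀ (Real.exp_pos _).le ?_ _
          rw [Real.exp_neg, inv_le_comm₀ (Real.exp_pos _) (by linarith)]
          have := Real.add_one_le_exp (2*h)
          refine le_trans ?_ this
          rw [inv_le_iff_one_le_mul₀ (by linarith)]
          nlinarith
    calc T * s ≤ T * (θ * Real.exp (-(2*T)) / T) := by gcongr; exact min_le_left _ _
      _ = θ * Real.exp (-(2*T)) := by field_simp
      _ ≤ _ := by gcongr

end P3

section P3b
open scoped Topology

section
variable {E : Type*} [NormedAddCommGroup E] [NormedSpace ℂ E] [FiniteDimensional ℂ E]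

theorem euler_approx_id {f g : E → E} {U : Set E} (hf : DifferentiableOn ℂ f U)
    (hΩ : IsOpen (f '' U)) (hg : DifferentiableOn ℂ g (f '' U)) (hgf : ∀ x ∈ U, g (f x) = x)
    {R₀ R₁ : ℝ} (hR₁ : 0 < R₁) (hR : R₁ < R₀) (hRU : closedBall 0 R₀ ⊆ U)
    (A : E ≃L[ℂ] E) (hA : fderiv ℂ f 0 = A)
    (hgood : ∀ η > 0, ∃ P, Good P ∧ ∀ w : E, ‖w‖ ≤ R₁ → ‖P (f w) - fderiv ℂ f w w‖ ≤ η)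
    {κ : ℝ} (hκ : 0 < κ) :
    ∃ Φ Ψ : E → E, Differentiable ℂ Φ ∧ Differentiable ℂ Ψ ∧ Function.LeftInverse Ψ Φ ∧
      Function.RightInverse Ψ Φ ∧ ∀ w : E, ‖w‖ ≤ R₁ → ‖Φ (f w) - w‖ ≤ κ := by
  have : ProperSpace E := FiniteDimensional.proper ℂ E
  obtain ⟨M, hM⟩ := (isCompact_closedBall (0:E) R₀).exists_bound_of_continuousOn (hf.continuousOn.mono hRU)
  have hM0 : 0 ≤ M := (norm_nonneg _).trans (hM 0 (by simp; linarith))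
  have hR₀ : 0 < R₀ := hR₁.trans hR
  set Q : ℝ := ‖(A.symm : E →L[ℂ] E)‖ * (4 * M * ((R₁ + 1) / R₀)^2) with hQ
  have hQ0 : 0 ≤ Q := by positivity
  set θ : ℝ := min 1 (κ / (Q + 1)) with hθ
  have hθp : 0 < θ := by positivity
  have hθ1 : θ ≤ 1 := min_le_left _ _
  have hθQ : θ * (Q + 1) ≤ κ := by
    rw [← le_div_iff₀ (by positivity)]; exact min_le_right _ _
  obtain ⟨Φ, Ψ, hΦ, hΨ, hl, hr, c, hc0, hcθ, hw⟩ := euler_approx hf hΩ hg hgf hR₁ hR hRU hgood hθp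
  have hcne : (c:ℂ) ≠ 0 := by exact_mod_cast hc0.ne'
  refine ⟨fun y => (c:ℂ)⁻¹ • A.symm (Φ y - f 0), fun x => Ψ (f 0 + (c:ℂ) • A x), ?_, ?_, ?_, ?_, ?_⟩
  · exact (A.symm.differentiable.comp (hΦ.sub_const _)).const_smul _
  · exact hΨ.comp ((A.differentiable.const_smul _).const_add _)
  · intro y
    simp only [map_smul, smul_smul, mul_inv_cancel₀ hcne, one_smul, A.apply_symm_apply]
    rw [add_sub_cancel, hl]
  · intro x
    simp only [hr (f 0 + (c:ℂ) • A x), add_sub_cancel_left, map_smul, smul_smul, inv_mul_cancel₀ hcne,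
      one_smul, A.symm_apply_apply]
  · intro w hwR
    obtain ⟨w', h1, h2, h3⟩ := hw w hwR
    simp only [h2]
    have e1 : (c:ℂ)⁻¹ • A.symm (f w' - f 0) - w = (c:ℂ)⁻¹ • A.symm (f w' - f 0 - A w') +
        (c:ℂ)⁻¹ • (w' - (c:ℂ) • w) := by
      simp only [map_sub, A.symm_apply_apply, smul_sub, smul_smul, inv_mul_cancel₀ hcne, one_smul]
      abel
    have e2 : ‖w'‖ ≤ c * (R₁ + 1) := by
      calc ‖w'‖ = ‖(w' - (c:ℂ) • w) + (c:ℂ) • w‖ := by congr 1; abel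
        _ ≤ θ * c + c * R₁ := by
          refine (norm_add_le _ _).trans (add_le_add h3 ?_)
          rw [norm_smul, Complex.norm_real, Real.norm_of_nonneg hc0.le]; gcongr
        _ ≤ _ := by nlinarith
    have e3 := taylor_two (f := f) (c := 0) (z := w') (r := R₀) (M := M)
      (hf.mono (ball_subset_closedBall.trans hRU)) (fun z hz => hM z (ball_subset_closedBall hz))
      (by simpa using h1.trans_lt hR)
    rw [sub_zero, hA] at e3
    have hci : ‖(c:ℂ)⁻¹‖ = c⁻¹ := by rw [norm_inv, Complex.norm_real, Real.norm_of_nonneg hc0.le]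
    rw [e1]
    calc _ ≤ c⁻¹ * (‖(A.symm : E →L[ℂ] E)‖ * (4 * M * (c * (R₁ + 1) / R₀)^2)) + c⁻¹ * (θ * c) := by
          refine (norm_add_le _ _).trans (add_le_add ?_ ?_)
          · rw [norm_smul, hci]
            gcongr
            refine ((A.symm : E →L[ℂ] E).le_opNorm _).trans ?_
            gcongr
            refine e3.trans ?_
            gcongr
          · rw [norm_smul, hci]; gcongr
      _ = c * Q + θ := by rw [hQ]; field_simp
      _ ≤ θ * (Q + 1) := by nlinarith
      _ ≤ κ := hθQ

theorem fix_solve {e : E → E} (he : ∀ x ∈ ball (0:E) 1, ∀ y ∈ ball (0:E) 1, ‖e x - e y‖ ≤ 1/4 * ‖x - y‖)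
    {a b : E} {r : ℝ} (hr : 0 ≤ r) (hsub : closedBall a r ⊆ ball 0 1)
    (hm : ∀ w ∈ closedBall a r, b - e w ∈ closedBall a r) :
    ∃ w ∈ closedBall a r, w + e w = b := by
  have : CompleteSpace E := FiniteDimensional.complete ℂ E
  let T : E → E := fun w => b - e w
  have hmt : MapsTo T (closedBall a r) (closedBall a r) := hm
  have hc : ContractingWith (1/4) (hmt.restrict T (closedBall a r) (closedBall a r)) := by
    refine ⟨by rw [← NNReal.coe_lt_coe]; norm_num, LipschitzWith.of_dist_le_mul fun x y => ?_⟩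
    rw [Subtype.dist_eq, dist_eq_norm, Subtype.dist_eq, dist_eq_norm]
    have := he y (hsub y.2) x (hsub x.2)
    rw [norm_sub_rev (y:E)] at this
    have e2 : T x - T y = e y - e x := by simp [T]
    simpa [e2] using this
  obtain ⟨w, hw, hfix, -⟩ := hc.exists_fixedPoint' isClosed_closedBall.isComplete hmt (mem_closedBall_self hr)
    (edist_ne_top _ _)
  exact ⟨w, hw, eq_sub_iff_add_eq.1 (show w = b - e w from hfix.symm)⟩

end

set_option maxHeartbeats 1000000 in
theorem starlike_chain {n : ℕ} {f Φ Ψ : En n → En n} (hf : UnivalentOn n f) (hΦ : Differentiable ℂ Φ)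
    (hΨ : Differentiable ℂ Ψ) (hl : Function.LeftInverse Ψ Φ) (hr : Function.RightInverse Ψ Φ)
    (he : ∀ x ∈ ball (0:En n) 1, ∀ y ∈ ball (0:En n) 1,
      ‖(Φ (f x) - x) - (Φ (f y) - y)‖ ≤ 1/4 * ‖x - y‖) : MemE n f := by
  set q : En n → En n := fun z => Φ (f z) with hq
  set e : En n → En n := fun w => (q w - w) - q 0 with he'
  have hqe : ∀ w, q w - q 0 = w + e w := fun w => by simp only [he']; abel
  have h0 : (0 : En n) ∈ ball (0 : En n) 1 := mem_ball_self one_pos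
  have hlip : ∀ x ∈ ball (0:En n) 1, ∀ y ∈ ball (0:En n) 1, ‖e x - e y‖ ≤ 1/4 * ‖x - y‖ := by
    intro x hx y hy
    have := he x hx y hy
    simpa [he'] using this
  have hez : ∀ x ∈ ball (0:En n) 1, ‖e x‖ ≤ 1/4 * ‖x‖ := by
    intro x hx
    have := hlip x hx 0 h0
    simpa [he'] using this
  have hstar : ∀ z ∈ ball (0:En n) 1, ∀ c : ℝ, 0 ≤ c → c ≤ 1 → ∃ w ∈ ball (0:En n) 1,
      q w - q 0 = (c:ℂ) • (q z - q 0) := by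
    intro z hz c hc0 hc1
    have hz1 : ‖z‖ < 1 := by simpa using hz
    have hz0 := norm_nonneg z
    have hcz : ‖(c:ℂ) • z‖ = c * ‖z‖ := by rw [norm_smul, Complex.norm_real, Real.norm_of_nonneg hc0]
    have hwz : ∀ w ∈ closedBall ((c:ℂ) • z) ((1 - c) * ‖z‖), ‖w‖ ≤ ‖z‖ := by
      intro w hw
      rw [mem_closedBall, dist_eq_norm] at hw
      calc ‖w‖ = ‖(w - (c:ℂ) • z) + (c:ℂ) • z‖ := by congr 1; abel
        _ ≤ (1 - c) * ‖z‖ + c * ‖z‖ := (norm_add_le _ _).trans (add_le_add hw hcz.le)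
        _ = ‖z‖ := by ring
    have hsub : closedBall ((c:ℂ) • z) ((1 - c) * ‖z‖) ⊆ ball 0 1 := fun w hw => by
      rw [mem_ball_zero_iff]; exact (hwz w hw).trans_lt hz1
    obtain ⟨w, hw, hw2⟩ := fix_solve hlip (a := (c:ℂ) • z) (b := (c:ℂ) • (z + e z)) (r := (1 - c) * ‖z‖)
      (mul_nonneg (by linarith) hz0) hsub (by
        intro w hw
        have h1 := hlip z hz w (hsub hw)
        have h2 := hez w (hsub hw)
        have h3 := hwz w hw
        have h4 : ‖z - w‖ ≤ 2 * ((1 - c) * ‖z‖) := by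
          rw [mem_closedBall, dist_eq_norm] at hw
          calc ‖z - w‖ = ‖(((1 - c : ℝ) : ℂ)) • z - (w - (c:ℂ) • z)‖ := by
                congr 1; push_cast; module
            _ ≤ (1 - c) * ‖z‖ + (1 - c) * ‖z‖ := by
                refine (norm_sub_le _ _).trans (add_le_add ?_ hw)
                rw [norm_smul, Complex.norm_real, Real.norm_of_nonneg (by linarith)]
            _ = _ := by ring
        rw [mem_closedBall, dist_eq_norm]
        have h5 : (c:ℂ) • (z + e z) - e w - (c:ℂ) • z = (c:ℂ) • (e z - e w) - ((1 - c : ℝ) : ℂ) • e w := by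
          push_cast; module
        rw [h5]
        refine (norm_sub_le _ _).trans ?_
        rw [norm_smul, norm_smul, Complex.norm_real, Complex.norm_real, Real.norm_of_nonneg hc0,
          Real.norm_of_nonneg (by linarith : 0 ≤ 1 - c)]
        have hX : 0 ≤ (1 - c) * ‖z‖ := mul_nonneg (by linarith) hz0
        have h6 : c * ‖e z - e w‖ ≤ 1/2 * ((1 - c) * ‖z‖) := by
          calc c * ‖e z - e w‖ ≤ 1 * (1/4 * (2 * ((1 - c) * ‖z‖))) := by
                gcongr
                exact h1.trans (by gcongr)
            _ = _ := by ring
        have h7 : (1 - c) * ‖e w‖ ≤ 1/4 * ((1 - c) * ‖z‖) := by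
          calc (1 - c) * ‖e w‖ ≤ (1 - c) * (1/4 * ‖z‖) :=
                mul_le_mul_of_nonneg_left (h2.trans (by gcongr)) (by linarith)
            _ = _ := by ring
        linarith)
    exact ⟨w, hsub hw, by rw [hqe, hqe, hw2]⟩
  have hcov : ∀ y : En n, ‖y‖ < 1/2 → ∃ w ∈ ball (0:En n) 1, q w - q 0 = y := by
    intro y hy
    have hsub : closedBall (0:En n) (2 * ‖y‖) ⊆ ball 0 1 := closedBall_subset_ball (by linarith)
    obtain ⟨w, hw, hw2⟩ := fix_solve hlip (a := 0) (b := y) (r := 2 * ‖y‖) (by positivity) hsub (by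
      intro w hw
      have h2 := hez w (hsub hw)
      rw [mem_closedBall_zero_iff] at hw ⊢
      have := norm_sub_le y (e w)
      linarith [norm_nonneg y])
    exact ⟨w, hsub hw, by rw [hqe, hw2]⟩
  let F : ℝ → En n → En n := fun t z => Ψ (q 0 + ((Real.exp t : ℝ) : ℂ) • (q z - q 0))
  have hexp : ∀ t : ℝ, ((Real.exp t : ℝ) : ℂ) ≠ 0 := fun t => by exact_mod_cast (Real.exp_pos t).ne'
  refine ⟨hf, F, ⟨?_, ?_, ?_⟩, ?_, ?_⟩
  · intro t ht
    constructor
    · have h1 : DifferentiableOn ℂ q (Ball n) := hΦ.comp_differentiableOn hf.1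
      have h2 : DifferentiableOn ℂ (fun z => q 0 + ((Real.exp t : ℝ) : ℂ) • (q z - q 0)) (Ball n) :=
        ((h1.sub_const _).fun_const_smul _).const_add _
      exact hΨ.comp_differentiableOn h2
    · intro x hx y hy hxy
      have h1 := hr.injective hxy
      have h2 := smul_right_injective (En n) (hexp t) (add_left_cancel h1)
      exact hf.2 hx hy (hl.injective (sub_left_injective h2))
  · rintro s t hs hst _ ⟨z, hz, rfl⟩
    obtain ⟨w, hw, hw2⟩ := hstar z hz (Real.exp (s - t)) (Real.exp_pos _).le
      (Real.exp_le_one_iff.2 (by linarith))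
    refine ⟨w, hw, ?_⟩
    simp only [F]
    rw [hw2, smul_smul, ← Complex.ofReal_mul, ← Real.exp_add, add_sub_cancel]
  · intro K hK _ T hT
    obtain ⟨L, hL, hLip⟩ := lip_closedBall hΨ (‖q 0‖ + Real.exp T * 2)
    refine ⟨fun _ => L * (Real.exp T * 2), fun _ => by positivity, integrableOn_const (by simp), ?_⟩
    intro z hz s t hs hst htT
    have hqz : ‖q z - q 0‖ ≤ 2 := by
      rw [hqe]
      have h1 := hez z (hK hz)
      have h2 : ‖z‖ < 1 := by simpa [Ball] using hK hz
      have := norm_add_le z (e z)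
      linarith
    have hbd : ∀ t ≤ T, ‖q 0 + ((Real.exp t : ℝ) : ℂ) • (q z - q 0)‖ ≤ ‖q 0‖ + Real.exp T * 2 := by
      intro t ht
      refine (norm_add_le _ _).trans ?_
      rw [norm_smul, Complex.norm_real, Real.norm_of_nonneg (Real.exp_pos _).le]
      gcongr
    have h1 := hLip _ _ (hbd s (hst.trans htT)) (hbd t htT)
    have h2 : ‖(q 0 + ((Real.exp s : ℝ) : ℂ) • (q z - q 0)) - (q 0 + ((Real.exp t : ℝ) : ℂ) • (q z - q 0))‖
        ≤ (Real.exp T * (t - s)) * 2 := by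
      rw [add_sub_add_left_eq_sub, ← sub_smul, norm_smul, ← Complex.ofReal_sub, Complex.norm_real]
      gcongr
      rw [Real.norm_eq_abs, abs_sub_comm, abs_of_nonneg (sub_nonneg.2 (Real.exp_le_exp.2 hst))]
      have h3 : Real.exp s = Real.exp t * Real.exp (s - t) := by rw [← Real.exp_add]; congr 1; ring
      have h4 := Real.add_one_le_exp (s - t)
      calc Real.exp t - Real.exp s = Real.exp t * (1 - Real.exp (s - t)) := by rw [h3]; ring
        _ ≤ Real.exp t * (t - s) := mul_le_mul_of_nonneg_left (by linarith) (Real.exp_pos t).le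
        _ ≤ _ := mul_le_mul_of_nonneg_right (Real.exp_le_exp.2 htT) (by linarith)
    have h3 : ∫ τ in Set.Icc s t, L * (Real.exp T * 2) = (t - s) * (L * (Real.exp T * 2)) := by
      rw [setIntegral_const, measureReal_def, Real.volume_Icc, ENNReal.toReal_ofReal (by linarith), smul_eq_mul]
    rw [h3]
    refine h1.trans ?_
    calc _ ≤ L * ((Real.exp T * (t - s)) * 2) := by gcongr
      _ = _ := by ring
  · funext z
    simp only [F, Real.exp_zero, Complex.ofReal_one, one_smul, add_sub_cancel]
    exact hl (f z)
  · rw [eq_univ_iff_forall]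
    intro y
    have hlim : Tendsto (fun t : ℝ => Real.exp (-t) * ‖Φ y - q 0‖) atTop (𝓝 (0 * ‖Φ y - q 0‖)) :=
      Real.tendsto_exp_neg_atTop_nhds_zero.mul_const _
    rw [zero_mul] at hlim
    obtain ⟨t, ht, ht0⟩ := ((hlim.eventually (gt_mem_nhds (show (0:ℝ) < 1/2 by norm_num))).and
      (eventually_ge_atTop 0)).exists
    obtain ⟨w, hw, hw2⟩ := hcov (((Real.exp (-t) : ℝ) : ℂ) • (Φ y - q 0)) (by
      rwa [norm_smul, Complex.norm_real, Real.norm_of_nonneg (Real.exp_pos _).le])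
    simp only [ChainRange, mem_iUnion]
    refine ⟨t, ht0, w, hw, ?_⟩
    simp only [F]
    rw [hw2, smul_smul, ← Complex.ofReal_mul, ← Real.exp_add, add_neg_cancel, Real.exp_zero,
      Complex.ofReal_one, one_smul, add_sub_cancel]
    exact hl y

theorem memE_ne_one (n : ℕ) (hn : n ≠ 1) (U : Set (En n)) (hU : IsOpen U)
    (hcl : closure (Ball n) ⊆ U) (f : En n → En n)
    (hf : DifferentiableOn ℂ f U) (hinj : Set.InjOn f U)
    (hRunge : RungeOn n (f '' U)) : MemE n f := by
  rw [Ball, closure_ball _ one_ne_zero] at hcl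
  obtain ⟨δ, hδ, hδU⟩ := (isCompact_closedBall (0:En n) 1).exists_cthickening_subset_open hU hcl
  rw [cthickening_closedBall hδ.le zero_le_one] at hδU
  obtain ⟨hΩ, ⟨g, hg, hgf⟩, hA⟩ := inv_holo rfl hU hf hinj
  have h0U : (0 : En n) ∈ U := hcl (by simp)
  obtain ⟨A, hA⟩ := hA 0 h0U
  have hR₁U : closedBall (0 : En n) (1 + δ/2) ⊆ U := (closedBall_subset_closedBall (by linarith)).trans hδU
  have hmg : MapsTo g (f '' U) U := by rintro _ ⟨x, hx, rfl⟩; rw [hgf x hx]; exact hx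
  have hV : DifferentiableOn ℂ (fun y => fderiv ℂ f (g y) (g y)) (f '' U) :=
    ((diff_fderiv hU hf).comp hg hmg).clm_apply hg
  obtain ⟨p, hp, hpl⟩ := hRunge _ hV
  have hK : IsCompact (f '' closedBall 0 (1 + δ/2)) :=
    (isCompact_closedBall (0:En n) (1 + δ/2)).image_of_continuousOn (hf.continuousOn.mono hR₁U)
  have hpu := (tendstoLocallyUniformlyOn_iff_tendstoUniformlyOn_of_compact hK).1 (hpl.mono (image_mono hR₁U))
  obtain ⟨Φ, Ψ, hΦ, hΨ, hl, hr, hb⟩ := euler_approx_id hf hΩ hg hgf (R₀ := 1 + δ) (R₁ := 1 + δ/2)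
    (by linarith) (by linarith) (by rwa [add_comm]  at hδU) A hA (by
      intro η hη
      obtain ⟨k, hk⟩ := (Metric.tendstoUniformlyOn_iff.1 hpu η hη).exists
      refine ⟨p k, good_poly hn (hp k), fun w hw => ?_⟩
      have hwm : w ∈ closedBall (0:En n) (1 + δ/2) := by simpa using hw
      have := hk (f w) (mem_image_of_mem _ hwm)
      simp only [hgf w (hR₁U hwm)] at this
      rw [dist_comm, dist_eq_norm] at this
      exact this.le) (κ := δ/16) (by positivity)
  refine starlike_chain ⟨hf.mono ((ball_subset_closedBall).trans hcl),
    hinj.mono ((ball_subset_closedBall).trans hcl)⟩ hΦ hΨ hl hr ?_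
  intro x hx y hy
  have hd : DifferentiableOn ℂ (fun z => Φ (f z) - z) U := (hΦ.comp_differentiableOn hf).sub differentiableOn_id
  have hbs : ∀ z ∈ ball (0:En n) 1, ball z (δ/2) ⊆ closedBall 0 (1 + δ/2) := fun z hz =>
    (ball_subset_ball' (by rw [mem_ball] at hz; linarith)).trans ball_subset_closedBall
  have := (convex_ball (0:En n) 1).norm_image_sub_le_of_norm_fderiv_le (𝕜 := ℂ) (f := fun z => Φ (f z) - z)
    (C := 2 * (δ/16) / (δ/2))
    (fun z hz => hd.differentiableAt (hU.mem_nhds (hcl (ball_subset_closedBall hz))))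
    (fun z hz => cauchy_fderiv (by linarith) (hd.mono ((hbs z hz).trans hR₁U)) fun w hw =>
      hb w (by simpa using hbs z hz hw)) hy hx
  refine this.trans (le_of_eq ?_)
  congr 1
  field_simp; norm_num

end P3b

section P4
open scoped Topology

/-- Montel along an ultrafilter. -/
theorem montel {ι : Type*} (u : Ultrafilter ι) {f : ι → ℂ → ℂ} {G : Set ℂ}
    (hd : ∀ᶠ i in (u : Filter ι), DifferentiableOn ℂ (f i) G)
    (hb : ∀ x ∈ G, ∃ r M, 0 < r ∧ ball x r ⊆ G ∧ ∀ᶠ i in (u : Filter ι), ∀ z ∈ ball x r, ‖f i z‖ ≤ M) :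
    ∃ F : ℂ → ℂ, TendstoLocallyUniformlyOn f F u G := by
  have hlim : ∀ x ∈ G, ∃ y, Tendsto (fun i => f i x) u (𝓝 y) := by
    intro x hx
    obtain ⟨r, M, hr, -, hM⟩ := hb x hx
    have : (closedBall (0:ℂ) M) ∈ (u.map (fun i => f i x) : Filter ℂ) := by
      rw [Ultrafilter.coe_map, mem_map]
      filter_upwards [hM] with i hi
      simpa using hi x (mem_ball_self hr)
    obtain ⟨y, -, hy⟩ := (isCompact_closedBall (0:ℂ) M).ultrafilter_le_nhds' (u.map (fun i => f i x)) this
    exact ⟨y, hy⟩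
  choose! F hF using hlim
  refine ⟨F, ?_⟩
  rw [Metric.tendstoLocallyUniformlyOn_iff]
  intro ε hε x hx
  obtain ⟨r, M, hr, hrG, hM⟩ := hb x hx
  have hM' : ∃ M, 0 < M ∧ ∀ᶠ i in (u : Filter ι), ∀ z ∈ ball x r, ‖f i z‖ ≤ M :=
    ⟨max M 1, by positivity, hM.mono fun i hi z hz => (hi z hz).trans (le_max_left _ _)⟩
  obtain ⟨M, hM0, hM⟩ := hM'
  -- equicontinuity
  have hlip : ∀ᶠ i in (u : Filter ι), ∀ z ∈ ball x (r/2), ‖f i z - f i x‖ ≤ 2 * M / (r/2) * ‖z - x‖ := by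
    filter_upwards [hM, hd] with i hi hdi z hz
    have hsub : ∀ y ∈ ball x (r/2), ball y (r/2) ⊆ ball x r := fun y hy =>
      ball_subset_ball' (by rw [mem_ball] at hy; linarith)
    exact (convex_ball x (r/2)).norm_image_sub_le_of_norm_fderiv_le (𝕜 := ℂ)
      (fun y hy => (hdi.mono hrG).differentiableAt (isOpen_ball.mem_nhds (ball_subset_ball (by linarith) hy)))
      (fun y hy => cauchy_fderiv (by linarith) (hdi.mono ((hsub y hy).trans hrG)) fun w hw =>
        hi w (hsub y hy hw)) (mem_ball_self (by linarith)) hz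
  set δ : ℝ := min (r/2) (ε / 4 / (2 * M / (r/2))) with hδ
  have hδp : 0 < δ := by positivity
  have hL : 2 * M / (r/2) * δ ≤ ε / 4 := by
    rw [mul_comm, ← le_div_iff₀ (by positivity)]; exact min_le_right _ _
  have hlip2 : ∀ᶠ i in (u : Filter ι), ∀ z ∈ ball x δ, ‖f i z - f i x‖ ≤ ε / 4 := by
    filter_upwards [hlip] with i hi z hz
    refine (hi z (ball_subset_ball (min_le_left _ _) hz)).trans (le_trans ?_ hL)
    rw [mem_ball, dist_eq_norm] at hz
    gcongr
  refine ⟨ball x δ, mem_nhdsWithin_of_mem_nhds (ball_mem_nhds x hδp), ?_⟩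
  have hFx : ∀ z ∈ ball x δ, ‖F z - F x‖ ≤ ε / 4 := by
    intro z hz
    have hzG : z ∈ G := hrG (ball_subset_ball ((min_le_left _ _).trans (by linarith)) hz)
    exact le_of_tendsto ((hF z hzG).sub (hF x hx)).norm (hlip2.mono fun i hi => hi z hz)
  have hx' : ∀ᶠ i in (u : Filter ι), dist (f i x) (F x) < ε / 4 := Metric.tendsto_nhds.1 (hF x hx) _ (by positivity)
  filter_upwards [hlip2, hx'] with i h1 h2 z hz
  have h3 := hFx z hz
  have h4 := h1 z hz
  rw [dist_eq_norm] at h2 ⊢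
  calc ‖F z - f i z‖ = ‖(F z - F x) - (f i x - F x) - (f i z - f i x)‖ := by congr 1; ring
    _ ≤ ‖F z - F x‖ + ‖f i x - F x‖ + ‖f i z - f i x‖ :=
      (norm_sub_le _ _).trans (add_le_add (norm_sub_le _ _) le_rfl)
    _ < ε := by linarith

theorem hurwitz {ι : Type*} {l : Filter ι} [NeBot l] {f : ι → ℂ → ℂ} {F : ℂ → ℂ} {G : Set ℂ} (hG : IsOpen G)
    (hGc : IsPreconnected G) (hd : ∀ᶠ i in l, DifferentiableOn ℂ (f i) G)
    (hi : ∀ᶠ i in l, InjOn (f i) G)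
    (hF : TendstoLocallyUniformlyOn f F l G) {x₀ : ℂ} (hx₀ : x₀ ∈ G) (hne : deriv F x₀ ≠ 0) : InjOn F G := by
  have hFd : DifferentiableOn ℂ F G := hF.differentiableOn hd hG
  have hFa : AnalyticOnNhd ℂ F G := hFd.analyticOnNhd hG
  intro a ha b hb hab
  by_contra hne'
  have hnc : ¬ ∀ᶠ z in 𝓝 b, F z = F a := by
    intro hc
    have h1 : EqOn F (fun _ => F a) G :=
      hFa.eqOn_of_preconnected_of_eventuallyEq analyticOnNhd_const hGc hb hc
    have h2 : F =ᶠ[𝓝 x₀] fun _ => F a := by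
      filter_upwards [hG.mem_nhds hx₀] with z hz using h1 hz
    exact hne (by rw [h2.deriv_eq]; simp)
  have hiso : ∀ᶠ z in 𝓝[≠] b, F z ≠ F a := by
    rcases ((hFa b hb).sub (analyticAt_const (v := F a))).eventually_eq_zero_or_eventually_ne_zero with h | h
    · exact absurd (h.mono fun z hz => sub_eq_zero.1 hz) hnc
    · exact h.mono fun z hz h' => hz (by simp [h'])
  rw [eventually_nhdsWithin_iff] at hiso
  have hbG : ∀ᶠ z in 𝓝 b, z ∈ G := hG.mem_nhds hb
  have hba : ∀ᶠ z in 𝓝 b, z ≠ a := isOpen_ne.mem_nhds (Ne.symm hne')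
  have hnear : ∀ᶠ z in 𝓝 b, (z ≠ b → F z ≠ F a) ∧ z ∈ G ∧ z ≠ a :=
    hiso.and (hbG.and hba)
  obtain ⟨r, hr, hrb⟩ := Metric.nhds_basis_closedBall.mem_iff.1 hnear
  have hcb : closedBall b r ⊆ G := fun z hz => (hrb hz).2.1
  have hsne : (sphere b r).Nonempty := (NormedSpace.sphere_nonempty (x := b)).2 hr.le
  obtain ⟨z₀, hz₀, hmin⟩ := (isCompact_sphere b r).exists_isMinOn hsne (f := fun z => ‖F z - F a‖)
    (((hFd.continuousOn.mono (sphere_subset_closedBall.trans hcb)).sub continuousOn_const).norm)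
  set m := ‖F z₀ - F a‖ with hm
  have hmp : 0 < m := norm_pos_iff.2 (sub_ne_zero.2 ((hrb (sphere_subset_closedBall hz₀)).1
    (by rintro rfl; simp at hz₀; linarith)))
  have hK : IsCompact (insert a (closedBall b r)) := (isCompact_closedBall b r).insert a
  have hKG : insert a (closedBall b r) ⊆ G := insert_subset ha hcb
  have hu := (tendstoLocallyUniformlyOn_iff_tendstoUniformlyOn_of_compact hK).1 (hF.mono hKG)
  have hev := Metric.tendstoUniformlyOn_iff.1 hu (m/6) (by positivity)
  obtain ⟨i, hi1, hi2, hi3⟩ := (hev.and (hd.and hi)).exists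
  have hcl : ∀ z ∈ closedBall b r, ‖(F z - F a) - (f i z - f i a)‖ ≤ m/3 := by
    intro z hz
    have h1 := hi1 z (mem_insert_of_mem _ hz)
    have h2 := hi1 a (mem_insert _ _)
    rw [dist_eq_norm] at h1 h2
    calc _ = ‖(F z - f i z) - (F a - f i a)‖ := by congr 1; ring
      _ ≤ _ := norm_sub_le _ _
      _ ≤ m/3 := by linarith
  have hnz : ∀ z ∈ closedBall b r, f i z - f i a ≠ 0 := fun z hz h0 =>
    (hrb hz).2.2 (hi3 (hcb hz) ha (sub_eq_zero.1 h0))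
  have hdc : DiffContOnCl ℂ (fun z => (f i z - f i a)⁻¹) (ball b r) := by
    apply DifferentiableOn.diffContOnCl
    rw [closure_ball _ hr.ne']
    exact ((hi2.mono hcb).sub_const _).inv hnz
  have hmax := Complex.norm_le_of_forall_mem_frontier_norm_le isBounded_ball hdc (C := (2*m/3)⁻¹)
    (fun z hz => by
      rw [frontier_ball _ hr.ne'] at hz
      rw [norm_inv]
      gcongr
      have h1 := hcl z (sphere_subset_closedBall hz)
      have h2 : m ≤ ‖F z - F a‖ := hmin hz
      have h3 := norm_sub_norm_le (F z - F a) (f i z - f i a)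
      linarith) (z := b) (subset_closure (mem_ball_self hr))
  have h1 := hcl b (mem_closedBall_self hr.le)
  rw [← hab, sub_self, zero_sub, norm_neg] at h1
  rw [norm_inv] at hmax
  have h2 : 0 < ‖f i b - f i a‖ := norm_pos_iff.2 (hnz b (mem_closedBall_self hr.le))
  rw [inv_le_inv₀ h2 (by positivity)] at hmax
  linarith

/-- Holomorphy of continuous square roots. -/
theorem sqrt_holo {G : Set ℂ} (hG : IsOpen G) {k v : ℂ → ℂ} (hk : ContinuousOn k G)
    (hv : DifferentiableOn ℂ v G) (hkv : ∀ z ∈ G, k z ^ 2 = v z) (hv0 : ∀ z ∈ G, v z ≠ 0) {z : ℂ} (hz : z ∈ G) :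
    HasDerivAt k (deriv v z / (2 * k z)) z := by
  have hk0 : ∀ z ∈ G, k z ≠ 0 := fun z hz h => hv0 z hz (by rw [← hkv z hz, h]; simp)
  have hvd := (hv.differentiableAt (hG.mem_nhds hz)).hasDerivAt
  rw [hasDerivAt_iff_tendsto_slope] at hvd ⊢
  have hkc : ContinuousAt k z := hk.continuousAt (hG.mem_nhds hz)
  have h1 : Tendsto (fun w => k w + k z) (𝓝[≠] z) (𝓝 (2 * k z)) := by
    have := (hkc.tendsto.mono_left (nhdsWithin_le_nhds (s := {z}ᶜ))).add_const (k z)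
    rwa [← two_mul] at this
  have h2 := hvd.div h1 (mul_ne_zero two_ne_zero (hk0 z hz))
  refine h2.congr' ?_
  have hsne : ∀ᶠ w in 𝓝[≠] z, k w + k z ≠ 0 := h1.eventually_ne (mul_ne_zero two_ne_zero (hk0 z hz))
  filter_upwards [hsne, mem_nhdsWithin_of_mem_nhds (hG.mem_nhds hz)] with w hw hwG
  simp only [Pi.div_apply, slope_def_field]
  rw [← hkv w hwG, ← hkv z hz]
  field_simp
  ring

end P4

section P4b
open scoped Topology ComplexConjugate

noncomputable def blas (a w : ℂ) : ℂ := (w - a) / (1 - conj a * w)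

theorem blas_den {a w : ℂ} (ha : ‖a‖ < 1) (hw : ‖w‖ < 1) : 1 - conj a * w ≠ 0 := by
  intro h
  have h1 : ‖conj a * w‖ = 1 := by rw [← sub_eq_zero.1 h]; simp
  rw [norm_mul, RCLike.norm_conj] at h1
  nlinarith [norm_nonneg a, norm_nonneg w]

theorem blas_lt {a w : ℂ} (ha : ‖a‖ < 1) (hw : ‖w‖ < 1) : ‖blas a w‖ < 1 := by
  have hd := blas_den ha hw
  rw [blas, norm_div, div_lt_one (norm_pos_iff.2 hd)]
  have h1 : ‖w - a‖^2 < ‖1 - conj a * w‖^2 := by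
    have ha2 : ‖a‖^2 < 1 := by nlinarith [norm_nonneg a]
    have hw2 : ‖w‖^2 < 1 := by nlinarith [norm_nonneg w]
    simp only [← Complex.normSq_eq_norm_sq] at *
    simp only [Complex.normSq_apply] at *
    simp
    nlinarith [mul_pos (sub_pos.2 ha2) (sub_pos.2 hw2)]
  exact lt_of_pow_lt_pow_left₀ 2 (norm_nonneg _) h1

theorem blas_inj {a w w' : ℂ} (ha : ‖a‖ < 1) (hw : ‖w‖ < 1) (hw' : ‖w'‖ < 1) (h : blas a w = blas a w') :
    w = w' := by
  have hd := blas_den ha hw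
  have hd' := blas_den ha hw'
  have h3 := blas_den ha ha
  rw [blas, blas, div_eq_div_iff hd hd'] at h
  have : (w - w') * (1 - conj a * a) = 0 := by linear_combination h
  rcases mul_eq_zero.1 this with h | h
  · exact sub_eq_zero.1 h
  · exact absurd h h3

theorem blas_deriv {a w : ℂ} (ha : ‖a‖ < 1) (hw : ‖w‖ < 1) :
    HasDerivAt (blas a) ((1 - conj a * a) / (1 - conj a * w)^2) w := by
  have hd := blas_den ha hw
  have h1 : HasDerivAt (fun w => w - a) 1 w := (hasDerivAt_id w).sub_const a
  have h2 : HasDerivAt (fun w => 1 - conj a * w) (-(conj a)) w := by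
    simpa using ((hasDerivAt_id w).const_mul (conj a)).const_sub 1
  have := h1.fun_div h2 hd
  refine this.congr_deriv ?_
  congr 1
  ring

theorem rmt {G : Set ℂ} (hG : IsOpen G) (hGc : IsPreconnected G) (hGb : Bornology.IsBounded G) (h0 : (0:ℂ) ∈ G)
    (hsq : ∀ u : ℂ → ℂ, ContinuousOn u G → (∀ z ∈ G, u z ≠ 0) →
      ∃ v : ℂ → ℂ, ContinuousOn v G ∧ ∀ z ∈ G, v z ^ 2 = u z) :
    ∃ g : ℂ → ℂ, DifferentiableOn ℂ g (ball 0 1) ∧ InjOn g (ball 0 1) ∧ g '' ball 0 1 = G ∧ g 0 = 0 := by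
  obtain ⟨r, hr, hrG⟩ := Metric.isOpen_iff.1 hG 0 h0
  let Fam : Set (ℂ → ℂ) := {h | DifferentiableOn ℂ h G ∧ InjOn h G ∧ MapsTo h G (ball 0 1) ∧ h 0 = 0}
  have hbd : ∀ h ∈ Fam, ‖deriv h 0‖ ≤ 1 / r := by
    rintro h ⟨h1, h2, h3, h4⟩
    refine Complex.norm_deriv_le_div_of_mapsTo_ball (h1.mono hrG) ?_ hr
    rw [h4]
    exact (h3.mono_left hrG).mono_right ball_subset_closedBall
  let S : Set ℝ := (fun h => ‖deriv h 0‖) '' Fam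
  have hSb : BddAbove S := ⟨1/r, by rintro _ ⟨h, hh, rfl⟩; exact hbd h hh⟩
  have hS0 : ∃ s ∈ S, 0 < s := by
    obtain ⟨M, hM⟩ := hGb.subset_ball 0
    have hMp : 0 < M := by simpa using hM h0
    refine ⟨_, ⟨fun z => (M:ℂ)⁻¹ * z, ⟨?_, ?_, ?_, by simp⟩, rfl⟩, ?_⟩
    · exact (differentiable_id.const_mul _).differentiableOn
    · intro a _ b _ hab
      exact mul_left_cancel₀ (inv_ne_zero (by exact_mod_cast hMp.ne')) hab
    · intro z hz
      have := hM hz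
      rw [mem_ball_zero_iff] at this ⊢
      rw [norm_mul, norm_inv, Complex.norm_of_nonneg hMp.le, inv_mul_lt_iff₀ hMp]
      linarith
    · have : HasDerivAt (fun z : ℂ => (M:ℂ)⁻¹ * z) ((M:ℂ)⁻¹ * 1) 0 := (hasDerivAt_id _).const_mul _
      simp only
      rw [this.deriv]
      simp [hMp.ne']
  obtain ⟨s₀, hs₀, hs₀p⟩ := hS0
  have hseq : ∀ n : ℕ, ∃ h ∈ Fam, sSup S - 1/((n:ℝ)+1) < ‖deriv h 0‖ := by
    intro n
    obtain ⟨_, ⟨h, hh, rfl⟩, hlt⟩ := exists_lt_of_lt_csSup ⟨_, hs₀⟩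
      (sub_lt_self (sSup S) (show 0 < 1/((n:ℝ)+1) by positivity))
    exact ⟨h, hh, hlt⟩
  choose f hfF hflt using hseq
  let u : Ultrafilter ℕ := hyperfilter ℕ
  have hu : (u : Filter ℕ) ≤ atTop := Nat.hyperfilter_le_atTop
  obtain ⟨h, hh⟩ := montel u (f := f) (G := G) (Eventually.of_forall fun i => (hfF i).1) (by
    intro x hx
    obtain ⟨ρ, hρ, hρG⟩ := Metric.isOpen_iff.1 hG x hx
    refine ⟨ρ, 1, hρ, hρG, Eventually.of_forall fun i z hz => ?_⟩
    exact (mem_ball_zero_iff.1 ((hfF i).2.2.1 (hρG hz))).le)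
  have hd : ∀ᶠ i in (u : Filter ℕ), DifferentiableOn ℂ (f i) G := Eventually.of_forall fun i => (hfF i).1
  have hhd : DifferentiableOn ℂ h G := hh.differentiableOn hd hG
  have hder : Tendsto (fun i => ‖deriv (f i) 0‖) u (𝓝 ‖deriv h 0‖) :=
    ((hh.deriv hd hG).tendsto_at h0).norm
  have hge : sSup S ≤ ‖deriv h 0‖ := by
    have h1 : Tendsto (fun n : ℕ => sSup S - 1/((n:ℝ)+1)) u (𝓝 (sSup S - 0)) :=
      (tendsto_const_nhds.sub tendsto_one_div_add_atTop_nhds_zero_nat).mono_left hu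
    rw [sub_zero] at h1
    exact le_of_tendsto_of_tendsto' h1 hder fun n => (hflt n).le
  have hpos : 0 < ‖deriv h 0‖ := lt_of_lt_of_le (lt_of_lt_of_le hs₀p (le_csSup hSb hs₀)) hge
  have hinj : InjOn h G := hurwitz hG hGc hd (Eventually.of_forall fun i => (hfF i).2.1) hh h0 (norm_pos_iff.1 hpos)
  have hh0 : h 0 = 0 := by
    have := hh.tendsto_at h0
    simp only [(hfF _).2.2.2] at this
    exact tendsto_nhds_unique this tendsto_const_nhds |>.trans rfl
  obtain ⟨hopen, ⟨g, hg, hgh⟩, -⟩ := inv_holo rfl hG hhd hinj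
  have hsub : h '' G ⊆ ball 0 1 := by
    have h1 : h '' G ⊆ closedBall 0 1 := by
      rintro _ ⟨z, hz, rfl⟩
      rw [mem_closedBall_zero_iff]
      exact le_of_tendsto (hh.tendsto_at hz).norm (Eventually.of_forall fun i =>
        (mem_ball_zero_iff.1 ((hfF i).2.2.1 hz)).le)
    have := interior_mono h1
    rwa [hopen.interior_eq, interior_closedBall _ one_ne_zero] at this
  have hlt : ∀ z ∈ G, ‖h z‖ < 1 := fun z hz => mem_ball_zero_iff.1 (hsub ⟨z, hz, rfl⟩)
  have hsurj : h '' G = ball 0 1 := by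
    refine hsub.antisymm ?_
    intro a ha
    by_contra hna
    rw [mem_ball_zero_iff] at ha
    have hv : DifferentiableOn ℂ (fun z => blas a (h z)) G := fun z hz =>
      ((blas_deriv ha (hlt z hz)).differentiableAt.comp z (hhd.differentiableAt (hG.mem_nhds hz))).differentiableWithinAt
    have hv0 : ∀ z ∈ G, blas a (h z) ≠ 0 := by
      intro z hz hz0
      rw [blas, div_eq_zero_iff] at hz0
      rcases hz0 with h1 | h1
      · exact hna ⟨z, hz, sub_eq_zero.1 h1⟩
      · exact blas_den ha (hlt z hz) h1
    obtain ⟨k, hk, hkv⟩ := hsq _ hv.continuousOn hv0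
    have hkd := fun z hz => sqrt_holo hG hk hv hkv hv0 (z := z) hz
    have hk1 : ∀ z ∈ G, ‖k z‖ < 1 := by
      intro z hz
      have h1 := blas_lt ha (hlt z hz)
      rw [← hkv z hz, norm_pow] at h1
      nlinarith [norm_nonneg (k z)]
    set b := k 0 with hb
    have hb2 : b^2 = -a := by rw [hb, hkv 0 h0, hh0]; simp [blas]
    have hb1 : ‖b‖ < 1 := hk1 0 h0
    have hb0 : b ≠ 0 := by
      intro hb0
      have := hv0 0 h0
      rw [← hkv 0 h0, ← hb, hb0] at this
      simp at this
    have hmem : (fun z => blas b (k z)) ∈ Fam := by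
      refine ⟨?_, ?_, ?_, ?_⟩
      · intro z hz
        exact ((blas_deriv hb1 (hk1 z hz)).differentiableAt.comp z (hkd z hz).differentiableAt).differentiableWithinAt
      · intro z hz z' hz' heq
        have h1 := blas_inj hb1 (hk1 z hz) (hk1 z' hz') heq
        have h2 : blas a (h z) = blas a (h z') := by rw [← hkv z hz, ← hkv z' hz', h1]
        exact hinj hz hz' (blas_inj ha (hlt z hz) (hlt z' hz') h2)
      · intro z hz
        exact mem_ball_zero_iff.2 (blas_lt hb1 (hk1 z hz))
      · simp [blas, hb]
    have hle := (le_csSup hSb ⟨_, hmem, rfl⟩).trans hge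
    have hvd : HasDerivAt (fun z => blas a (h z)) ((1 - conj a * a) * deriv h 0) 0 := by
      have h1 := blas_deriv ha (hlt 0 h0)
      have h2 := h1.comp 0 (hhd.differentiableAt (hG.mem_nhds h0)).hasDerivAt
      refine h2.congr_deriv ?_
      rw [hh0]; simp
    have h2d : HasDerivAt (fun z => blas b (k z))
        ((1 - conj b * b) / (1 - conj b * b)^2 * (((1 - conj a * a) * deriv h 0) / (2 * b))) 0 := by
      have h1 := (blas_deriv hb1 (hk1 0 h0)).comp 0 (hkd 0 h0)
      rw [hvd.deriv] at h1
      exact h1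
    simp only at hle
    rw [h2d.deriv] at hle
    have hbb := blas_den hb1 hb1
    have hna' : ‖a‖ = ‖b‖^2 := by rw [← norm_pow, hb2, norm_neg]
    have e1 : conj a * a = ((‖b‖^4 : ℝ) : ℂ) := by
      rw [mul_comm, Complex.mul_conj, Complex.normSq_eq_norm_sq, hna']; ring_nf
    have e2 : conj b * b = ((‖b‖^2 : ℝ) : ℂ) := by
      rw [mul_comm, Complex.mul_conj, Complex.normSq_eq_norm_sq]
    have e3 : (1 - conj b * b) / (1 - conj b * b)^2 * (((1 - conj a * a) * deriv h 0) / (2 * b))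
        = (((1 + ‖b‖^2 : ℝ)) : ℂ) * deriv h 0 / (2 * b) := by
      have : (1 - conj a * a) = (1 - conj b * b) * (((1 + ‖b‖^2 : ℝ)) : ℂ) := by
        rw [e1, e2]; push_cast; ring
      rw [this]
      field_simp
    have hn2 : ‖(2:ℂ) * b‖ = 2 * ‖b‖ := by rw [norm_mul]; simp
    rw [e3, norm_div, hn2, norm_mul, Complex.norm_of_nonneg (by positivity)] at hle
    have hbp : 0 < ‖b‖ := norm_pos_iff.2 hb0
    rw [div_le_iff₀ (by positivity)] at hle
    nlinarith [mul_pos hpos (pow_pos (sub_pos.2 hb1) 2)]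
  refine ⟨g, by rwa [hsurj] at hg, ?_, ?_, by have := hgh 0 h0; rwa [hh0] at this⟩
  · rw [← hsurj]
    rintro _ ⟨z, hz, rfl⟩ _ ⟨w, hw, rfl⟩ heq
    rw [hgh z hz, hgh w hw] at heq
    rw [heq]
  · rw [← hsurj]
    ext x
    constructor
    · rintro ⟨_, ⟨z, hz, rfl⟩, rfl⟩
      rwa [hgh z hz]
    · intro hx
      exact ⟨h x, ⟨x, hx, rfl⟩, hgh x hx⟩

end P4b

section P5
open scoped Topology

/-- The inverted complement of a set. -/
def invC (K : Set ℂ) : Set ℂ := {x | x = 0 ∨ x⁻¹ ∉ K}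

theorem isOpen_invC {K : Set ℂ} (hK : IsCompact K) : IsOpen (invC K) := by
  rw [isOpen_iff_mem_nhds]
  intro x hx
  by_cases h0 : x = 0
  · subst h0
    obtain ⟨M, hM0, hM⟩ := hK.isBounded.exists_pos_norm_le
    refine mem_of_superset (ball_mem_nhds 0 (inv_pos.2 hM0)) ?_
    intro y hy
    rw [mem_ball_zero_iff] at hy
    by_cases hy0 : y = 0
    · exact Or.inl hy0
    · refine Or.inr fun h => ?_
      have h1 := hM _ h
      rw [norm_inv] at h1
      have h2 := (lt_inv_comm₀ (norm_pos_iff.2 hy0) hM0).1 hy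
      linarith
  · have h1 : x⁻¹ ∉ K := hx.resolve_left h0
    have h2 := (continuousAt_inv₀ h0).preimage_mem_nhds (hK.isClosed.isOpen_compl.mem_nhds h1)
    exact mem_of_superset h2 fun y hy => Or.inr hy

theorem isClosed_invC {V : Set ℂ} (hV : IsOpen V) : IsClosed (invC V) := by
  have h : (invC V)ᶜ = {0}ᶜ ∩ (fun x : ℂ => x⁻¹) ⁻¹' V := by
    ext x; simp [invC]
  rw [← isOpen_compl_iff, h]
  exact (continuousOn_inv₀ (G₀ := ℂ)).isOpen_inter_preimage isOpen_compl_singleton hV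

theorem invC_bdd {V : Set ℂ} {ε : ℝ} (hε : 0 < ε) (hV : ball 0 ε ⊆ V) : invC V ⊆ closedBall 0 ε⁻¹ := by
  intro x hx
  rw [mem_closedBall_zero_iff]
  by_cases h0 : x = 0
  · rw [h0, norm_zero]; positivity
  · have h1 : x⁻¹ ∉ ball 0 ε := fun h => hx.resolve_left h0 (hV h)
    rw [mem_ball_zero_iff, not_lt, norm_inv] at h1
    exact (le_inv_comm₀ hε (norm_pos_iff.2 h0)).1 h1

noncomputable def rad (θ : ℝ → ℝ) (z : ℂ) : ℂ := ((θ ‖z‖ / ‖z‖ : ℝ) : ℂ) * z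

theorem norm_rad {θ : ℝ → ℝ} {z : ℂ} (hz : z ≠ 0) (hθ : 0 ≤ θ ‖z‖) : ‖rad θ z‖ = θ ‖z‖ := by
  have : 0 < ‖z‖ := norm_pos_iff.2 hz
  rw [rad, norm_mul, Complex.norm_of_nonneg (by positivity)]
  field_simp

theorem rad_cont {θ : ℝ → ℝ} (hθ : Continuous θ) {z : ℂ} (hz : z ≠ 0) : ContinuousAt (rad θ) z := by
  unfold rad
  refine ContinuousAt.mul ?_ continuousAt_id
  refine Complex.continuous_ofReal.continuousAt.comp ?_
  exact (hθ.comp continuous_norm).continuousAt.div continuous_norm.continuousAt (norm_ne_zero_iff.2 hz)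

open Classical in
noncomputable def Tm (f g : ℂ → ℂ) (r : ℝ) (θ : ℝ → ℝ) (x : ℂ) : ℂ :=
  if x ≠ 0 ∧ x⁻¹ ∈ f '' closedBall 0 r then (f (rad θ (g x⁻¹)))⁻¹ else x

theorem Tm_in {f g : ℂ → ℂ} {r : ℝ} {θ : ℝ → ℝ} {z : ℂ} (hz : ‖z‖ ≤ r) (hfz : f z ≠ 0) (hg : g (f z) = z) :
    Tm f g r θ (f z)⁻¹ = (f (rad θ z))⁻¹ := by
  rw [Tm, if_pos, inv_inv, hg]
  exact ⟨inv_ne_zero hfz, by rw [inv_inv]; exact ⟨z, by simpa using hz, rfl⟩⟩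

theorem Tm_out {f g : ℂ → ℂ} {r : ℝ} {θ : ℝ → ℝ} {x : ℂ} (hx : ¬ (x ≠ 0 ∧ x⁻¹ ∈ f '' closedBall 0 r)) :
    Tm f g r θ x = x := by
  rw [Tm, if_neg hx]

theorem Tm_cont {f g : ℂ → ℂ} {R r : ℝ} (hr : 0 < r) (hrR : r < R) (hf : DifferentiableOn ℂ f (ball 0 R))
    (hinj : InjOn f (ball 0 R)) (hf0 : f 0 = 0) (hfo : IsOpen (f '' ball 0 R))
    (hg : DifferentiableOn ℂ g (f '' ball 0 R)) (hgf : ∀ x ∈ ball (0:ℂ) R, g (f x) = x)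
    {θ : ℝ → ℝ} (hθ : Continuous θ) (hθr : θ r = r) {W : Set ℂ}
    (hW : ∀ z, z ≠ 0 → ‖z‖ ≤ r → (f z)⁻¹ ∈ W → 0 < θ ‖z‖ ∧ θ ‖z‖ ≤ r) : ContinuousOn (Tm f g r θ) W := by
  have hcb : closedBall (0:ℂ) r ⊆ ball 0 R := closedBall_subset_ball hrR
  have hK : IsCompact (f '' closedBall 0 r) :=
    (isCompact_closedBall 0 r).image_of_continuousOn (hf.continuousOn.mono hcb)
  have hbo : IsOpen (f '' ball 0 r) :=
    (inv_holo rfl isOpen_ball (hf.mono (ball_subset_ball hrR.le)) (hinj.mono (ball_subset_ball hrR.le))).1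
  have hne : ∀ z ∈ ball (0:ℂ) R, z ≠ 0 → f z ≠ 0 := fun z hz h0 h =>
    h0 (hinj hz (mem_ball_self (hr.trans hrR)) (h.trans hf0.symm))
  have hcover : W = (W ∩ (invC (f '' closedBall 0 r))ᶜ) ∪ (W ∩ invC (f '' ball 0 r)) := by
    ext x
    constructor
    · intro hx
      by_cases h : x ∈ invC (f '' ball 0 r)
      · exact Or.inr ⟨hx, h⟩
      · refine Or.inl ⟨hx, fun h' => h ?_⟩
        rcases h' with h' | h'
        · exact Or.inl h'
        · exact Or.inr fun h2 => h' (image_mono ball_subset_closedBall h2)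
    · rintro (h | h) <;> exact h.1
  have hAc : IsClosed (invC (f '' closedBall 0 r))ᶜ := (isOpen_invC hK).isClosed_compl
  have hBc : IsClosed (invC (f '' ball 0 r)) := isClosed_invC hbo
  have hTA : ∀ x ∈ (invC (f '' closedBall 0 r))ᶜ, Tm f g r θ x = (f (rad θ (g x⁻¹)))⁻¹ := by
    intro x hx
    rw [Tm, if_pos]
    simpa [invC] using hx
  have hTB : ∀ x ∈ invC (f '' ball 0 r), Tm f g r θ x = x := by
    intro x hx
    by_cases h : x ≠ 0 ∧ x⁻¹ ∈ f '' closedBall 0 r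
    · obtain ⟨h1, z, hz, hzx⟩ := h
      have h2 := hx.resolve_left h1
      have hzr : ‖z‖ = r := by
        refine le_antisymm (by simpa using hz) (not_lt.1 fun h => h2 ⟨z, by simpa using h, hzx⟩)
      have hx' : x = (f z)⁻¹ := by rw [hzx, inv_inv]
      rw [hx', Tm_in hzr.le (by rw [hzx]; exact inv_ne_zero h1) (hgf z (hcb hz)), rad, hzr, hθr, div_self hr.ne']
      simp
    · exact Tm_out h
  intro x hxW
  rw [hcover]
  refine ContinuousWithinAt.union ?_ ?_
  · by_cases hx : x ∈ (invC (f '' closedBall 0 r))ᶜ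
    · refine ContinuousWithinAt.congr (f := fun x => (f (rad θ (g x⁻¹)))⁻¹) ?_ (fun y hy => hTA y hy.2) (hTA x hx)
      have hx2 : x ≠ 0 ∧ x⁻¹ ∈ f '' closedBall 0 r := by simpa [invC] using hx
      obtain ⟨h1, z, hz, hzx⟩ := hx2
      have hgz : g x⁻¹ = z := by rw [← hzx, hgf z (hcb hz)]
      have hz0 : z ≠ 0 := by
        rintro rfl
        rw [hf0] at hzx
        exact inv_ne_zero h1 hzx.symm
      have hzr : ‖z‖ ≤ r := by simpa using hz
      obtain ⟨ht1, ht2⟩ := hW z hz0 hzr (by rw [hzx, inv_inv]; exact hxW)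
      have hnr := norm_rad hz0 ht1.le
      have hmem : rad θ z ∈ ball (0:ℂ) R := by
        rw [mem_ball_zero_iff, hnr]; linarith
      have hm0 : rad θ z ≠ 0 := by
        rw [← norm_pos_iff, hnr]; exact ht1
      have c1 : ContinuousAt (fun x : ℂ => x⁻¹) x := continuousAt_inv₀ h1
      have c2 : ContinuousAt g x⁻¹ := hg.continuousOn.continuousAt
        (hfo.mem_nhds (by rw [← hzx]; exact ⟨z, hcb hz, rfl⟩))
      have c3 : ContinuousAt (rad θ) (g x⁻¹) := by rw [hgz]; exact rad_cont hθ hz0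
      have c4 : ContinuousAt f (rad θ (g x⁻¹)) := by
        rw [hgz]; exact hf.continuousOn.continuousAt (isOpen_ball.mem_nhds hmem)
      have c5 : ContinuousAt (fun x : ℂ => x⁻¹) (f (rad θ (g x⁻¹))) := by
        rw [hgz]; exact continuousAt_inv₀ (hne _ hmem hm0)
      have d2 : ContinuousAt (fun x : ℂ => g x⁻¹) x := c2.comp c1
      have d3 : ContinuousAt (fun x : ℂ => rad θ (g x⁻¹)) x := ContinuousAt.comp (f := fun x : ℂ => g x⁻¹) c3 d2
      have d4 : ContinuousAt (fun x : ℂ => f (rad θ (g x⁻¹))) x :=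
        ContinuousAt.comp (f := fun x : ℂ => rad θ (g x⁻¹)) c4 d3
      exact (ContinuousAt.comp (f := fun x : ℂ => f (rad θ (g x⁻¹))) c5 d4).continuousWithinAt
    · exact continuousWithinAt_of_notMem_closure fun h =>
        hx (hAc.closure_subset (closure_mono inter_subset_right h))
  · by_cases hx : x ∈ invC (f '' ball 0 r)
    · exact ContinuousWithinAt.congr (f := fun x => x) continuousWithinAt_id (fun y hy => hTB y hy.2) (hTB x hx)
    · exact continuousWithinAt_of_notMem_closure fun h =>
        hx (hBc.closure_subset (closure_mono inter_subset_right h))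

/-- Riemann map for the inverted complement of a nice compact disc. -/
theorem exists_riemann {f : ℂ → ℂ} {ρ R : ℝ} (hρ : 0 < ρ) (hρR : ρ < R)
    (hf : DifferentiableOn ℂ f (ball 0 R)) (hinj : InjOn f (ball 0 R)) (hf0 : f 0 = 0) :
    ∃ g : ℂ → ℂ, DifferentiableOn ℂ g (ball 0 1) ∧ InjOn g (ball 0 1) ∧
      g '' ball 0 1 = invC (f '' closedBall 0 ρ) ∧ g 0 = 0 := by
  obtain ⟨r, hρr, hrR⟩ := exists_between hρR
  have hr : 0 < r := hρ.trans hρr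
  have hR : 0 < R := hr.trans hrR
  obtain ⟨hfo, ⟨g, hg, hgf⟩, -⟩ := inv_holo rfl isOpen_ball hf hinj
  have hcb : closedBall (0:ℂ) ρ ⊆ ball 0 R := closedBall_subset_ball hρR
  have hK : IsCompact (f '' closedBall 0 ρ) :=
    (isCompact_closedBall 0 ρ).image_of_continuousOn (hf.continuousOn.mono hcb)
  have hne : ∀ z ∈ ball (0:ℂ) R, z ≠ 0 → f z ≠ 0 := fun z hz h0 h =>
    h0 (hinj hz (mem_ball_self hR) (h.trans hf0.symm))
  set G := invC (f '' closedBall 0 ρ) with hGdef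
  have hbo : IsOpen (f '' ball 0 ρ) :=
    (inv_holo rfl isOpen_ball (hf.mono (ball_subset_ball hρR.le)) (hinj.mono (ball_subset_ball hρR.le))).1
  have hGb : Bornology.IsBounded G := by
    obtain ⟨ε, hε, hεf⟩ := Metric.isOpen_iff.1 hbo 0 ⟨0, mem_ball_self hρ, hf0⟩
    exact isBounded_closedBall.subset (invC_bdd hε (hεf.trans (image_mono ball_subset_closedBall)))
  let θ : ℝ → ℝ := fun t => ρ + (r - ρ) * t / r
  let η : ℝ → ℝ := fun t => r * (t - ρ) / (r - ρ)
  have hrρ : 0 < r - ρ := sub_pos.2 hρr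
  have hθc : Continuous θ := by fun_prop
  have hηc : Continuous η := by fun_prop
  have hθ1 : ∀ t, 0 < t → ρ < θ t := fun t ht => by
    have : 0 < (r - ρ) * t / r := by positivity
    simp only [θ]; linarith
  have hθ2 : ∀ t, t ≤ r → θ t ≤ r := fun t ht => by
    have : (r - ρ) * t / r ≤ r - ρ := by
      rw [div_le_iff₀ hr]; exact mul_le_mul_of_nonneg_left ht hrρ.le
    simp only [θ]; linarith
  have hη1 : ∀ t, ρ < t → 0 < η t := fun t ht => by
    have := sub_pos.2 ht
    simp only [η]; positivity
  have hη2 : ∀ t, t ≤ r → η t ≤ r := fun t ht => by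
    simp only [η]
    rw [div_le_iff₀ hrρ]; exact mul_le_mul_of_nonneg_left (by linarith) hr.le
  have hθη : ∀ t, θ (η t) = t := fun t => by
    simp only [θ, η]; field_simp; ring
  have hGz : ∀ z, ‖z‖ ≤ r → z ≠ 0 → (f z)⁻¹ ∈ G → ρ < ‖z‖ := by
    intro z hz hz0 hG
    by_contra hcon
    rcases hG with h | h
    · exact hne z (by simpa using hz.trans_lt hrR) hz0 (inv_eq_zero.1 h)
    · exact h ⟨z, by simpa using hcon, by rw [inv_inv]⟩
  set τ := Tm f g r θ with hτ
  set σ := Tm f g r η with hσ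
  have hτc : ContinuousOn τ univ := Tm_cont hr hrR hf hinj hf0 hfo hg hgf hθc (by simp only [θ]; field_simp; ring)
    fun z hz0 hz _ => ⟨hρ.trans (hθ1 _ (norm_pos_iff.2 hz0)), hθ2 _ hz⟩
  have hσc : ContinuousOn σ G := Tm_cont hr hrR hf hinj hf0 hfo hg hgf hηc (by simp only [η]; field_simp)
    fun z hz0 hz hG => ⟨hη1 _ (hGz z hz hz0 hG), hη2 _ hz⟩
  have hcase : ∀ x, (∃ z, z ≠ 0 ∧ ‖z‖ ≤ r ∧ x = (f z)⁻¹) ∨ ¬ (x ≠ 0 ∧ x⁻¹ ∈ f '' closedBall 0 r) := by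
    intro x
    by_cases h : x ≠ 0 ∧ x⁻¹ ∈ f '' closedBall 0 r
    · left
      obtain ⟨h1, z, hz, hzx⟩ := h
      refine ⟨z, ?_, by simpa using hz, by rw [hzx, inv_inv]⟩
      rintro rfl
      rw [hf0] at hzx
      exact inv_ne_zero h1 hzx.symm
    · exact Or.inr h
  have hmemR : ∀ z : ℂ, ‖z‖ ≤ r → z ∈ ball (0:ℂ) R := fun z hz => by simpa using hz.trans_lt hrR
  have hτG : ∀ x, τ x ∈ G := by
    intro x
    rcases hcase x with ⟨z, hz0, hz, rfl⟩ | h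
    · rw [hτ, Tm_in hz (hne z (hmemR z hz) hz0) (hgf z (hmemR z hz))]
      right
      rw [inv_inv]
      rintro ⟨w, hw, hwz⟩
      have h1 := hθ1 _ (norm_pos_iff.2 hz0)
      have h2 := norm_rad hz0 (hρ.trans h1).le
      have h3 := hinj (hcb hw) (hmemR _ (by rw [h2]; exact hθ2 _ hz)) hwz
      rw [mem_closedBall_zero_iff, h3, h2] at hw
      linarith
    · rw [hτ, Tm_out h]
      by_cases hx : x = 0
      · exact Or.inl hx
      · exact Or.inr fun h' => h ⟨hx, image_mono (closedBall_subset_closedBall hρr.le) h'⟩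
  have hτσ : ∀ x ∈ G, τ (σ x) = x := by
    intro x hx
    rcases hcase x with ⟨z, hz0, hz, rfl⟩ | h
    · rw [hσ, Tm_in hz (hne z (hmemR z hz) hz0) (hgf z (hmemR z hz))]
      have hzρ := hGz z hz hz0 hx
      have h1 := hη1 _ hzρ
      have h2 := norm_rad hz0 h1.le
      have h3 : ‖rad η z‖ ≤ r := by rw [h2]; exact hη2 _ hz
      have h4 : rad η z ≠ 0 := by rw [← norm_pos_iff, h2]; exact h1
      rw [hτ, Tm_in h3 (hne _ (hmemR _ h3) h4) (hgf _ (hmemR _ h3))]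
      congr 2
      rw [rad, h2, hθη, rad, ← mul_assoc, ← Complex.ofReal_mul]
      have : 0 < ‖z‖ := norm_pos_iff.2 hz0
      have e : ‖z‖ / η ‖z‖ * (η ‖z‖ / ‖z‖) = 1 := by field_simp
      rw [e]; simp
    · rw [hσ, Tm_out h, hτ, Tm_out h]
  refine rmt (isOpen_invC hK) ?_ hGb (Or.inl rfl) ?_
  · have : G = τ '' univ := by
      ext x
      exact ⟨fun hx => ⟨σ x, trivial, hτσ x hx⟩, by rintro ⟨y, -, rfl⟩; exact hτG y⟩
    rw [this]
    exact isPreconnected_univ.image _ hτc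
  · intro u hu hu0
    have hsc : IsSimplyConnected (univ : Set ℂ) := by
      have : ContractibleSpace (univ : Set ℂ) := Convex.contractibleSpace (convex_univ (𝕜 := ℝ)) ⟨0, trivial⟩
      exact (inferInstance : SimplyConnectedSpace (univ : Set ℂ))
    obtain ⟨v, hv, hvu⟩ := Complex.exists_continuousOn_pow_eq hsc isOpen_univ
      (g := fun x => u (τ x)) (hu.comp hτc fun x _ => hτG x)
      (by rintro ⟨x, -, hx⟩; exact hu0 _ (hτG x) hx) two_ne_zero
    refine ⟨fun x => v (σ x), hv.comp hσc (fun x _ => trivial), fun x hx => ?_⟩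
    rw [hvu, hτσ x hx]

end P5

section P6a
open scoped Topology

theorem schwarz_sub {F h : ℂ → ℂ} (hh : DifferentiableOn ℂ h (ball 0 1)) (hi : InjOn h (ball 0 1)) (hh0 : h 0 = 0)
    (hF : DifferentiableOn ℂ F (ball 0 1)) (hF0 : F 0 = 0) (hsub : F '' ball 0 1 ⊆ h '' ball 0 1) :
    ∃ φ : ℂ → ℂ, DifferentiableOn ℂ φ (ball 0 1) ∧ MapsTo φ (ball 0 1) (ball 0 1) ∧ φ 0 = 0 ∧
      (∀ z ∈ ball (0:ℂ) 1, F z = h (φ z)) ∧ (∀ z ∈ ball (0:ℂ) 1, ‖φ z‖ ≤ ‖z‖) ∧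
      deriv F 0 = deriv h 0 * deriv φ 0 ∧ ‖deriv φ 0‖ ≤ 1 := by
  obtain ⟨ho, ⟨g, hg, hgh⟩, -⟩ := inv_holo rfl isOpen_ball hh hi
  have h0 : (0:ℂ) ∈ ball (0:ℂ) 1 := mem_ball_self one_pos
  have hmaps : MapsTo (fun z => g (F z)) (ball 0 1) (ball 0 1) := by
    intro z hz
    obtain ⟨w, hw, hwz⟩ := hsub ⟨z, hz, rfl⟩
    simp only
    rw [← hwz, hgh w hw]; exact hw
  have hφ0 : g (F 0) = 0 := by
    have := hgh 0 h0
    rw [hh0] at this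
    rw [hF0, this]
  have hd : DifferentiableOn ℂ (fun z => g (F z)) (ball 0 1) := hg.comp hF fun z hz => hsub ⟨z, hz, rfl⟩
  have hFe : ∀ z ∈ ball (0:ℂ) 1, F z = h (g (F z)) := by
    intro z hz
    obtain ⟨w, hw, hwz⟩ := hsub ⟨z, hz, rfl⟩
    rw [← hwz, hgh w hw]
  have hnh := isOpen_ball.mem_nhds h0
  refine ⟨fun z => g (F z), hd, hmaps, hφ0, hFe, ?_, ?_, ?_⟩
  · intro z hz
    exact Complex.norm_le_norm_of_mapsTo_ball hd (hmaps.mono_right ball_subset_closedBall) hφ0 (by simpa using hz)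
  · have h1 : F =ᶠ[𝓝 0] fun z => h (g (F z)) := by filter_upwards [hnh] with z hz using hFe z hz
    rw [h1.deriv_eq]
    have h2 : HasDerivAt h (deriv h 0) (g (F 0)) := by
      rw [hφ0]; exact (hh.differentiableAt hnh).hasDerivAt
    exact (HasDerivAt.comp (h := fun z => g (F z)) 0 h2 (hd.differentiableAt hnh).hasDerivAt).deriv
  · refine Complex.norm_deriv_le_one_of_mapsTo_ball hd ?_ one_pos
    simp only [hφ0]
    exact hmaps.mono_right ball_subset_closedBall

theorem schwarz_deriv {F h : ℂ → ℂ} (hh : DifferentiableOn ℂ h (ball 0 1)) (hi : InjOn h (ball 0 1)) (hh0 : h 0 = 0)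
    (hF : DifferentiableOn ℂ F (ball 0 1)) (hF0 : F 0 = 0) (hsub : F '' ball 0 1 ⊆ h '' ball 0 1) :
    ‖deriv F 0‖ ≤ ‖deriv h 0‖ := by
  obtain ⟨φ, -, -, -, -, -, h1, h2⟩ := schwarz_sub hh hi hh0 hF hF0 hsub
  rw [h1, norm_mul]
  nlinarith [norm_nonneg (deriv h 0)]

theorem phi_near {φ : ℂ → ℂ} (hd : DifferentiableOn ℂ φ (ball 0 1)) (hm : MapsTo φ (ball 0 1) (ball 0 1))
    (h0 : φ 0 = 0) {β : ℝ} (hβ : deriv φ 0 = β) (hβ1 : β < 1) {r : ℝ} (hr : r < 1) {z : ℂ}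
    (hz : ‖z‖ ≤ r) : ‖φ z - z‖ ≤ (1 - β) * (1 + 2 / (1 - r)) := by
  have hnh : ball (0:ℂ) 1 ∈ 𝓝 (0:ℂ) := ball_mem_nhds _ one_pos
  have hzb : z ∈ ball (0:ℂ) 1 := by simpa using hz.trans_lt hr
  have hp : DifferentiableOn ℂ (dslope φ 0) (ball 0 1) := (Complex.differentiableOn_dslope hnh).2 hd
  have hp1 : ∀ w ∈ ball (0:ℂ) 1, ‖dslope φ 0 w‖ ≤ 1 := by
    intro w hw
    have := Complex.norm_dslope_le_div_of_mapsTo_ball (R₂ := 1) hd (by rw [h0]; exact hm.mono_right ball_subset_closedBall) hw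
    simpa using this
  have hbc := Complex.borelCaratheodory_zero (M := 1 - β) (R := 1) (f := fun w => dslope φ 0 w - β) (z := z)
    (by linarith) (hp.sub_const _) (by
      intro w hw
      have h1 := (Complex.re_le_norm _).trans (hp1 w hw)
      simp only [mem_ofPred_eq, Complex.sub_re, Complex.ofReal_re]
      linarith) one_pos hzb (by simp [dslope_same, hβ])
  have hz0 : 0 ≤ ‖z‖ := norm_nonneg z
  have h1r : 0 < 1 - r := by linarith
  have e1 : φ z - z = z * ((dslope φ 0 z - β) + (β - 1)) := by
    have := sub_smul_dslope φ 0 z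
    rw [h0, sub_zero, sub_zero, smul_eq_mul] at this
    linear_combination -this
  have e2 : ‖((β:ℂ) - 1)‖ = 1 - β := by
    rw [← Complex.ofReal_one, ← Complex.ofReal_sub, Complex.norm_real, Real.norm_eq_abs, abs_of_nonpos (by linarith)]
    ring
  have e3 : 2 * (1 - β) * ‖z‖ / (1 - ‖z‖) ≤ (1 - β) * (2 / (1 - r)) := by
    rw [mul_div_assoc', mul_comm (1 - β) 2]
    have hb : 0 ≤ 2 * (1 - β) := by linarith
    apply div_le_div₀ hb _ h1r (by linarith)
    nlinarith
  rw [e1, norm_mul]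
  have h3 : ‖(dslope φ 0 z - β) + ((β:ℂ) - 1)‖ ≤ (1 - β) * (1 + 2 / (1 - r)) := by
    refine (norm_add_le _ _).trans ?_
    rw [e2]
    linarith
  have h4 := norm_nonneg ((dslope φ 0 z - β) + ((β:ℂ) - 1))
  nlinarith

/-- Normalisation of the derivative of a Riemann map. -/
theorem rotate_map {g : ℂ → ℂ} (hd : DifferentiableOn ℂ g (ball 0 1)) (hi : InjOn g (ball 0 1)) (h0 : g 0 = 0) :
    ∃ g' : ℂ → ℂ, ∃ a : ℝ, DifferentiableOn ℂ g' (ball 0 1) ∧ InjOn g' (ball 0 1) ∧ g' 0 = 0 ∧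
      g' '' ball 0 1 = g '' ball 0 1 ∧ deriv g' 0 = a ∧ 0 < a := by
  have hne : deriv g 0 ≠ 0 := inj_deriv_ne_zero isOpen_ball hd hi (mem_ball_self one_pos)
  set d := deriv g 0 with hdd
  have hdp : 0 < ‖d‖ := norm_pos_iff.2 hne
  set c : ℂ := (‖d‖:ℂ) / d with hc
  have hcn : ‖c‖ = 1 := by rw [hc, norm_div]; simp [hdp.ne']
  have hc0 : c ≠ 0 := by rw [← norm_pos_iff, hcn]; exact one_pos
  have hmap : ∀ z, c * z ∈ ball (0:ℂ) 1 ↔ z ∈ ball (0:ℂ) 1 := by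
    intro z; simp [hcn]
  have hderiv : HasDerivAt (fun z => c * z) c 0 := by simpa using (hasDerivAt_id (0:ℂ)).const_mul c
  refine ⟨fun z => g (c * z), ‖d‖, ?_, ?_, by simp [h0], ?_, ?_, hdp⟩
  · exact hd.comp (differentiable_id.const_mul c).differentiableOn fun z hz => (hmap z).2 hz
  · intro z hz w hw h
    exact mul_left_cancel₀ hc0 (hi ((hmap z).2 hz) ((hmap w).2 hw) h)
  · ext y
    constructor
    · rintro ⟨z, hz, rfl⟩; exact ⟨c * z, (hmap z).2 hz, rfl⟩
    · rintro ⟨z, hz, rfl⟩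
      refine ⟨c⁻¹ * z, ?_, ?_⟩
      · rw [← hmap, mul_inv_cancel_left₀ hc0]; exact hz
      · simp only [mul_inv_cancel_left₀ hc0]
  · have h1 : HasDerivAt g d (c * 0) := by
      rw [mul_zero]
      exact (hd.differentiableAt (ball_mem_nhds _ one_pos)).hasDerivAt
    have h2 := HasDerivAt.comp (h := fun z => c * z) (0:ℂ) h1 hderiv
    have h3 : deriv (fun z => g (c * z)) 0 = d * c := h2.deriv
    rw [h3, hc]
    field_simp

end P6a

section P6b
open scoped Topology

theorem chain_surj {F : ℝ → ℂ → ℂ} {a : ℝ → ℝ}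
    (hd : ∀ s ∈ Ioc (0:ℝ) 1, DifferentiableOn ℂ (F s) (ball 0 1))
    (hi : ∀ s ∈ Ioc (0:ℝ) 1, InjOn (F s) (ball 0 1))
    (h0 : ∀ s ∈ Ioc (0:ℝ) 1, F s 0 = 0)
    (ha : ∀ s ∈ Ioc (0:ℝ) 1, deriv (F s) 0 = (a s : ℂ))
    (hap : ∀ s ∈ Ioc (0:ℝ) 1, 0 < a s)
    (hanti : ∀ s s', 0 < s → s ≤ s' → s' ≤ 1 → a s' ≤ a s)
    (hmono : ∀ s s', 0 < s → s ≤ s' → s' ≤ 1 → F s' '' ball 0 1 ⊆ F s '' ball 0 1)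
    (hclos : ∀ s s', 0 < s → s < s' → s' < 1 → closure (F s' '' ball 0 1) ⊆ F s '' ball 0 1)
    (hbig : ∀ M : ℝ, ∃ s ∈ Ioo (0:ℝ) 1, ball 0 M ⊆ F s '' ball 0 1)
    (hIntr : ∀ σ ∈ Ioc (0:ℝ) 1, ∀ V : Set ℂ, IsOpen V → (∀ s ∈ Ioo 0 σ, V ⊆ F s '' ball 0 1) → V ⊆ F σ '' ball 0 1)
    (hcpt : ∀ σ ∈ Ioo (0:ℝ) 1, ∀ K : Set ℂ, IsCompact K → K ⊆ F σ '' ball 0 1 →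
      ∃ s ∈ Ioo σ 1, K ⊆ F s '' ball 0 1)
    (hbdd : ∀ s ∈ Ioo (0:ℝ) 1, Bornology.IsBounded (F s '' ball 0 1))
    (ha1 : a 1 = 1) {v : ℝ} (hv : 1 < v) : ∃ s ∈ Ioc (0:ℝ) 1, a s = v := by
  have hnh : ball (0:ℂ) 1 ∈ 𝓝 (0:ℂ) := ball_mem_nhds _ one_pos
  have hnorm : ∀ s ∈ Ioc (0:ℝ) 1, ‖deriv (F s) 0‖ = a s := fun s hs => by
    rw [ha s hs, Complex.norm_of_nonneg (hap s hs).le]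
  let S : Set ℝ := {s | s ∈ Ioc (0:ℝ) 1 ∧ v ≤ a s}
  have hSb : BddAbove S := ⟨1, fun s hs => hs.1.2⟩
  have hSn : S.Nonempty := by
    obtain ⟨s, hs, hsM⟩ := hbig v
    have hs' : s ∈ Ioc (0:ℝ) 1 := ⟨hs.1, hs.2.le⟩
    refine ⟨s, hs', ?_⟩
    have hdv : HasDerivAt (fun z : ℂ => (v:ℂ) * z) v 0 := by simpa using (hasDerivAt_id (0:ℂ)).const_mul (v:ℂ)
    have h1 := schwarz_deriv (F := fun z => (v:ℂ) * z) (hd s hs') (hi s hs') (h0 s hs')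
      (differentiable_id.const_mul _).differentiableOn (by simp) (by
        rintro _ ⟨z, hz, rfl⟩
        apply hsM
        rw [mem_ball_zero_iff] at hz ⊢
        rw [norm_mul, Complex.norm_of_nonneg (by linarith)]
        nlinarith)
    rw [hnorm s hs', hdv.deriv, Complex.norm_of_nonneg (by linarith)] at h1
    exact h1
  set σ := sSup S with hσ
  obtain ⟨s₀, hs₀⟩ := hSn
  have hσ0 : 0 < σ := lt_of_lt_of_le hs₀.1.1 (le_csSup hSb hs₀)
  have hσ1 : σ ≤ 1 := csSup_le ⟨_, hs₀⟩ fun s hs => hs.1.2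
  have hσm : σ ∈ Ioc (0:ℝ) 1 := ⟨hσ0, hσ1⟩
  have hbelow : ∀ s ∈ Ioo 0 σ, v ≤ a s := by
    intro s hs
    obtain ⟨t, ht, hst⟩ := exists_lt_of_lt_csSup ⟨_, hs₀⟩ hs.2
    exact ht.2.trans (hanti s t hs.1 hst.le ht.1.2)
  have habove : ∀ s, σ < s → s ≤ 1 → a s < v := by
    intro s hs hs1
    by_contra hcon
    exact absurd (le_csSup hSb (show s ∈ S from ⟨⟨hσ0.trans hs, hs1⟩, not_lt.1 hcon⟩)) (not_le.2 hs)
  have hlow : v ≤ a σ := by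
    let t : ℕ → ℝ := fun n => σ * (1 - 1/2 * (1/((n:ℝ)+1)))
    have ht1 : ∀ n, σ/2 ≤ t n ∧ t n < σ := by
      intro n
      have h1 : 0 < 1/((n:ℝ)+1) := by positivity
      have h2 : 1/((n:ℝ)+1) ≤ 1 := by
        rw [div_le_one (by positivity)]
        have : (0:ℝ) ≤ n := Nat.cast_nonneg n
        linarith
      constructor
      · simp only [t]; nlinarith
      · simp only [t]; nlinarith
    have htm : ∀ n, t n ∈ Ioc (0:ℝ) 1 := fun n => ⟨by linarith [(ht1 n).1], by linarith [(ht1 n).2]⟩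
    have htl : Tendsto t atTop (𝓝 σ) := by
      have := ((tendsto_one_div_add_atTop_nhds_zero_nat (𝕜 := ℝ)).const_mul (1/2)).const_sub 1 |>.const_mul σ
      simpa [t] using this
    let u : Ultrafilter ℕ := hyperfilter ℕ
    have hu : (u : Filter ℕ) ≤ atTop := Nat.hyperfilter_le_atTop
    obtain ⟨B, hB⟩ := (hbdd (σ/2) ⟨by linarith, by linarith⟩).exists_norm_le
    have hdd : ∀ᶠ n in (u : Filter ℕ), DifferentiableOn ℂ (F (t n)) (ball 0 1) :=
      Eventually.of_forall fun n => hd _ (htm n)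
    obtain ⟨h, hh⟩ := montel u (f := fun n => F (t n)) (G := ball 0 1) hdd (by
      intro x hx
      obtain ⟨ρ, hρ, hρG⟩ := Metric.isOpen_iff.1 isOpen_ball x hx
      refine ⟨ρ, B, hρ, hρG, Eventually.of_forall fun n z hz => ?_⟩
      exact hB _ (hmono (σ/2) (t n) (by linarith) (ht1 n).1 (htm n).2 ⟨z, hρG hz, rfl⟩))
    have hm0 : (0:ℂ) ∈ ball (0:ℂ) 1 := mem_ball_self one_pos
    have hhd : DifferentiableOn ℂ h (ball 0 1) := hh.differentiableOn hdd isOpen_ball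
    have hder : Tendsto (fun n => ‖deriv (F (t n)) 0‖) u (𝓝 ‖deriv h 0‖) :=
      ((hh.deriv hdd isOpen_ball).tendsto_at hm0).norm
    have hge : v ≤ ‖deriv h 0‖ := ge_of_tendsto' hder fun n => by
      rw [hnorm _ (htm n)]
      exact hbelow _ ⟨(htm n).1, (ht1 n).2⟩
    have hinj : InjOn h (ball 0 1) := hurwitz isOpen_ball (convex_ball (0:ℂ) 1).isPreconnected hdd
      (Eventually.of_forall fun n => hi _ (htm n)) hh hm0 (norm_pos_iff.1 (by linarith))
    have hh0 : h 0 = 0 := by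
      have := hh.tendsto_at hm0
      simp only [h0 _ (htm _)] at this
      exact tendsto_nhds_unique this tendsto_const_nhds
    have hopen : IsOpen (h '' ball 0 1) := (inv_holo rfl isOpen_ball hhd hinj).1
    have hsub : h '' ball 0 1 ⊆ F σ '' ball 0 1 := by
      refine hIntr σ hσm _ hopen fun s hs => ?_
      obtain ⟨s', hs1, hs2⟩ := exists_between hs.2
      refine Subset.trans ?_ (hclos s s' hs.1 hs1 (by linarith))
      rintro _ ⟨z, hz, rfl⟩
      refine mem_closure_of_tendsto (hh.tendsto_at hz) ?_
      filter_upwards [hu (htl.eventually (lt_mem_nhds hs2))] with n hn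
      exact hmono s' (t n) (hs.1.trans hs1) (le_of_lt hn) (htm n).2 ⟨z, hz, rfl⟩
    have := schwarz_deriv (hd σ hσm) (hi σ hσm) (h0 σ hσm) hhd hh0 hsub
    rw [hnorm σ hσm] at this
    exact hge.trans this
  have hσlt : σ < 1 := by
    rcases hσ1.lt_or_eq with h | h
    · exact h
    · rw [h, ha1] at hlow; linarith
  refine ⟨σ, hσm, le_antisymm ?_ hlow⟩
  by_contra hcon
  rw [not_le] at hcon
  have hapσ := hap σ hσm
  set r := v / a σ with hr
  have hr0 : 0 < r := by rw [hr]; have : 0 < v := by linarith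
                         positivity
  have hr1 : r < 1 := by rw [hr, div_lt_one hapσ]; exact hcon
  have hcb : closedBall (0:ℂ) r ⊆ ball 0 1 := closedBall_subset_ball hr1
  obtain ⟨s, hs, hsK⟩ := hcpt σ ⟨hσ0, hσlt⟩ (F σ '' closedBall 0 r)
    ((isCompact_closedBall 0 r).image_of_continuousOn ((hd σ hσm).continuousOn.mono hcb)) (image_mono hcb)
  have hsm : s ∈ Ioc (0:ℝ) 1 := ⟨hσ0.trans hs.1, hs.2.le⟩
  have hrz : ∀ z ∈ ball (0:ℂ) 1, (r:ℂ) * z ∈ closedBall (0:ℂ) r := by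
    intro z hz
    rw [mem_ball_zero_iff] at hz
    rw [mem_closedBall_zero_iff, norm_mul, Complex.norm_of_nonneg hr0.le]
    nlinarith
  have hdr : HasDerivAt (fun z : ℂ => F σ ((r:ℂ) * z)) (a σ * r) 0 := by
    have e1 : HasDerivAt (fun z : ℂ => (r:ℂ) * z) r 0 := by simpa using (hasDerivAt_id (0:ℂ)).const_mul (r:ℂ)
    have e2 : HasDerivAt (F σ) (a σ) ((r:ℂ) * 0) := by
      rw [mul_zero, ← ha σ hσm]
      exact ((hd σ hσm).differentiableAt hnh).hasDerivAt
    exact HasDerivAt.comp (h := fun z : ℂ => (r:ℂ) * z) (0:ℂ) e2 e1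
  have := schwarz_deriv (F := fun z => F σ ((r:ℂ) * z)) (hd s hsm) (hi s hsm) (h0 s hsm)
    ((hd σ hσm).comp (differentiable_id.const_mul _).differentiableOn fun z hz => hcb (hrz z hz))
    (by simp [h0 σ hσm]) (by
      rintro _ ⟨z, hz, rfl⟩
      exact hsK ⟨_, hrz z hz, rfl⟩)
  rw [hnorm s hsm, hdr.deriv, norm_mul, Complex.norm_of_nonneg hapσ.le, Complex.norm_of_nonneg hr0.le] at this
  have h3 := habove s hs.1 hs.2.le
  have h4 : a σ * r = v := by rw [hr]; field_simp
  linarith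

theorem chain_exists {F : ℝ → ℂ → ℂ} {a : ℝ → ℝ}
    (hd : ∀ s ∈ Ioc (0:ℝ) 1, DifferentiableOn ℂ (F s) (ball 0 1))
    (hi : ∀ s ∈ Ioc (0:ℝ) 1, InjOn (F s) (ball 0 1))
    (h0 : ∀ s ∈ Ioc (0:ℝ) 1, F s 0 = 0)
    (ha : ∀ s ∈ Ioc (0:ℝ) 1, deriv (F s) 0 = (a s : ℂ))
    (hap : ∀ s ∈ Ioc (0:ℝ) 1, 0 < a s)
    (hmono : ∀ s s', 0 < s → s ≤ s' → s' ≤ 1 → F s' '' ball 0 1 ⊆ F s '' ball 0 1)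
    (hclos : ∀ s s', 0 < s → s < s' → s' < 1 → closure (F s' '' ball 0 1) ⊆ F s '' ball 0 1)
    (hbig : ∀ M : ℝ, ∃ s ∈ Ioo (0:ℝ) 1, ball 0 M ⊆ F s '' ball 0 1)
    (hIntr : ∀ σ ∈ Ioc (0:ℝ) 1, ∀ V : Set ℂ, IsOpen V → (∀ s ∈ Ioo 0 σ, V ⊆ F s '' ball 0 1) → V ⊆ F σ '' ball 0 1)
    (hcpt : ∀ σ ∈ Ioo (0:ℝ) 1, ∀ K : Set ℂ, IsCompact K → K ⊆ F σ '' ball 0 1 →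
      ∃ s ∈ Ioo σ 1, K ⊆ F s '' ball 0 1)
    (hbdd : ∀ s ∈ Ioo (0:ℝ) 1, Bornology.IsBounded (F s '' ball 0 1))
    (ha1 : a 1 = 1) :
    ∃ Φ : ℝ → ℂ → ℂ, Φ 1 = F 1 ∧ (∀ v, 1 ≤ v → DifferentiableOn ℂ (Φ v) (ball 0 1) ∧ InjOn (Φ v) (ball 0 1) ∧
      Φ v 0 = 0 ∧ deriv (Φ v) 0 = (v:ℂ)) ∧
      (∀ v v', 1 ≤ v → v ≤ v' → Φ v '' ball 0 1 ⊆ Φ v' '' ball 0 1) ∧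
      ∀ y : ℂ, ∃ v, 1 ≤ v ∧ y ∈ Φ v '' ball 0 1 := by
  have hnorm : ∀ s ∈ Ioc (0:ℝ) 1, ‖deriv (F s) 0‖ = a s := fun s hs => by
    rw [ha s hs, Complex.norm_of_nonneg (hap s hs).le]
  have hanti : ∀ s s', 0 < s → s ≤ s' → s' ≤ 1 → a s' ≤ a s := by
    intro s s' hs hss hs'
    have h1 : s ∈ Ioc (0:ℝ) 1 := ⟨hs, hss.trans hs'⟩
    have h2 : s' ∈ Ioc (0:ℝ) 1 := ⟨hs.trans_le hss, hs'⟩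
    have := schwarz_deriv (hd s h1) (hi s h1) (h0 s h1) (hd s' h2) (h0 s' h2) (hmono s s' hs hss hs')
    rwa [hnorm s h1, hnorm s' h2] at this
  have hex : ∀ v : ℝ, ∃ s, (v = 1 → s = 1) ∧ (1 ≤ v → s ∈ Ioc (0:ℝ) 1 ∧ a s = v) := by
    intro v
    by_cases h1 : v = 1
    · exact ⟨1, fun _ => rfl, fun _ => ⟨⟨one_pos, le_rfl⟩, by rw [ha1, h1]⟩⟩
    · by_cases h2 : 1 < v
      · obtain ⟨s, hs, hsv⟩ := chain_surj hd hi h0 ha hap hanti hmono hclos hbig hIntr hcpt hbdd ha1 h2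
        exact ⟨s, fun h => absurd h h1, fun _ => ⟨hs, hsv⟩⟩
      · exact ⟨0, fun h => absurd h h1, fun h => absurd (lt_of_le_of_ne h (Ne.symm h1)) h2⟩
  choose s hs1 hs2 using hex
  have hmono' : ∀ v v', 1 ≤ v → v ≤ v' → F (s v) '' ball 0 1 ⊆ F (s v') '' ball 0 1 := by
    intro v v' hv hvv
    rcases hvv.eq_or_lt with rfl | hlt
    · exact Subset.rfl
    · obtain ⟨h1, h2⟩ := hs2 v hv
      obtain ⟨h3, h4⟩ := hs2 v' (hv.trans hvv)
      refine hmono _ _ h3.1 ?_ h1.2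
      by_contra hcon
      have := hanti _ _ h1.1 (not_le.1 hcon).le h3.2
      rw [h2, h4] at this
      linarith
  refine ⟨fun v => F (s v), by simp only [hs1 1 rfl], fun v hv => ?_, hmono', fun y => ?_⟩
  · obtain ⟨h1, h2⟩ := hs2 v hv
    refine ⟨hd _ h1, hi _ h1, h0 _ h1, by rw [ha _ h1, h2]⟩
  · obtain ⟨t, ht, hty⟩ := hbig (‖y‖ + 1)
    have htm : t ∈ Ioc (0:ℝ) 1 := ⟨ht.1, ht.2.le⟩
    have hta := hap t htm
    obtain ⟨h1, h2⟩ := hs2 (a t + 1) (by linarith)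
    refine ⟨a t + 1, by linarith, ?_⟩
    refine hmono _ t h1.1 ?_ htm.2 (hty (by simp))
    by_contra hcon
    have := hanti _ _ htm.1 (not_le.1 hcon).le h1.2
    rw [h2] at this
    linarith

theorem chain_lip {Φ : ℝ → ℂ → ℂ}
    (hΦ : ∀ v, 1 ≤ v → DifferentiableOn ℂ (Φ v) (ball 0 1) ∧ InjOn (Φ v) (ball 0 1) ∧
      Φ v 0 = 0 ∧ deriv (Φ v) 0 = (v:ℂ))
    (hm : ∀ v v', 1 ≤ v → v ≤ v' → Φ v '' ball 0 1 ⊆ Φ v' '' ball 0 1)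
    {r V : ℝ} (hr0 : 0 ≤ r) (hr : r < 1) (hV : 1 ≤ V) :
    ∃ C, 0 ≤ C ∧ ∀ v v', 1 ≤ v → v ≤ v' → v' ≤ V → ∀ z : ℂ, ‖z‖ ≤ r → ‖Φ v z - Φ v' z‖ ≤ C * (v' - v) := by
  obtain ⟨ρ, hrρ, hρ1⟩ := exists_between hr
  obtain ⟨hVd, hVi, hV0, -⟩ := hΦ V hV
  obtain ⟨B, hB⟩ := (isCompact_closedBall (0:ℂ) ρ).exists_bound_of_continuousOn
    (hVd.continuousOn.mono (closedBall_subset_ball hρ1))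
  have hB0 : 0 ≤ B := (norm_nonneg _).trans (hB 0 (mem_closedBall_self (by linarith)))
  have hbd : ∀ v, 1 ≤ v → v ≤ V → ∀ z : ℂ, ‖z‖ ≤ ρ → ‖Φ v z‖ ≤ B := by
    intro v hv hvV z hz
    obtain ⟨h1, -, h3, -⟩ := hΦ v hv
    obtain ⟨φ, -, -, -, h4, h5, -⟩ := schwarz_sub hVd hVi hV0 h1 h3 (hm v V hv hvV)
    have hzb : z ∈ ball (0:ℂ) 1 := by simpa using hz.trans_lt hρ1
    rw [h4 z hzb]
    exact hB _ (by simpa using (h5 z hzb).trans hz)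
  have hδ : 0 < ρ - r := sub_pos.2 hrρ
  have hlip : ∀ v, 1 ≤ v → v ≤ V → ∀ x y : ℂ, ‖x‖ ≤ r → ‖y‖ ≤ r → ‖Φ v x - Φ v y‖ ≤ 2 * B / (ρ - r) * ‖x - y‖ := by
    intro v hv hvV x y hx hy
    obtain ⟨h1, -⟩ := hΦ v hv
    have hin : ∀ z ∈ closedBall (0:ℂ) r, ∀ w ∈ ball z (ρ - r), ‖w‖ ≤ ρ := by
      intro z hz w hw
      rw [mem_closedBall_zero_iff] at hz
      rw [mem_ball, dist_eq_norm] at hw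
      have := norm_add_le (w - z) z
      rw [sub_add_cancel] at this
      linarith
    refine (convex_closedBall (0:ℂ) r).norm_image_sub_le_of_norm_fderiv_le (𝕜 := ℂ)
      (fun z hz => ?_) ?_ (by simpa using hy) (by simpa using hx)
    · exact h1.differentiableAt (isOpen_ball.mem_nhds (by
        rw [mem_closedBall_zero_iff] at hz; simpa using hz.trans_lt hr))
    · intro z hz
      refine cauchy_fderiv hδ (h1.mono fun w hw => ?_) fun w hw => hbd v hv hvV w (hin z hz w hw)
      simpa using (hin z hz w hw).trans_lt hρ1
  have h1r : 0 < 1 - r := by linarith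
  refine ⟨2 * B / (ρ - r) * (1 + 2 / (1 - r)), by positivity, ?_⟩
  intro v v' hv hvv hvV z hz
  rcases hvv.eq_or_lt with rfl | hlt
  · simp
  obtain ⟨h1, -, h3, h4⟩ := hΦ v hv
  have hv' : 1 ≤ v' := hv.trans hvv
  obtain ⟨k1, k2, k3, k4⟩ := hΦ v' hv'
  obtain ⟨φ, p1, p2, p3, p4, p5, p6, -⟩ := schwarz_sub k1 k2 k3 h1 h3 (hm v v' hv hvv)
  have hzb : z ∈ ball (0:ℂ) 1 := by simpa using hz.trans_lt hr
  have hβ : deriv φ 0 = ((v / v' : ℝ) : ℂ) := by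
    rw [h4, k4] at p6
    have : (v':ℂ) ≠ 0 := by exact_mod_cast (by linarith : v' ≠ 0)
    push_cast
    rw [p6]; field_simp
  have hnear := phi_near p1 p2 p3 hβ (by rw [div_lt_one (by linarith)]; exact hlt) hr hz
  rw [p4 z hzb]
  refine (hlip v' hv' hvV _ _ ((p5 z hzb).trans hz) hz).trans ?_
  rw [mul_assoc]
  refine mul_le_mul_of_nonneg_left (hnear.trans ?_) (by positivity)
  rw [mul_comm]
  refine mul_le_mul_of_nonneg_left ?_ (by positivity)
  have hv'0 : 0 < v' := by linarith
  have : 1 - v / v' = (v' - v) / v' := by field_simp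
  rw [this]
  exact div_le_self (by linarith) hv'

end P6b

section P6c
open scoped Topology

theorem invC_anti {A B : Set ℂ} (h : A ⊆ B) : invC B ⊆ invC A := by
  rintro x (hx | hx)
  · exact Or.inl hx
  · exact Or.inr fun h' => hx (h h')

theorem chain_of_map {f : ℂ → ℂ} {R : ℝ} (hR : 1 < R) (hf : DifferentiableOn ℂ f (ball 0 R))
    (hinj : InjOn f (ball 0 R)) (hf0 : f 0 = 0) (hf1 : deriv f 0 = 1) :
    ∃ Φ : ℝ → ℂ → ℂ, Φ 1 = f ∧ (∀ v, 1 ≤ v → DifferentiableOn ℂ (Φ v) (ball 0 1) ∧ InjOn (Φ v) (ball 0 1) ∧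
      Φ v 0 = 0 ∧ deriv (Φ v) 0 = (v:ℂ)) ∧
      (∀ v v', 1 ≤ v → v ≤ v' → Φ v '' ball 0 1 ⊆ Φ v' '' ball 0 1) ∧
      ∀ y : ℂ, ∃ v, 1 ≤ v ∧ y ∈ Φ v '' ball 0 1 := by
  obtain ⟨g, hg, hgi, hgim, hg0⟩ := exists_riemann one_pos hR hf hinj hf0
  have hex : ∀ s : ℝ, ∃ G : ℂ → ℂ, ∃ a : ℝ, (s = 1 → G = f ∧ a = 1) ∧ (s ∈ Ioo (0:ℝ) 1 →
      DifferentiableOn ℂ G (ball 0 1) ∧ InjOn G (ball 0 1) ∧ G 0 = 0 ∧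
      G '' ball 0 1 = invC (g '' closedBall 0 s) ∧ deriv G 0 = a ∧ 0 < a) := by
    intro s
    by_cases hs1 : s = 1
    · exact ⟨f, 1, fun _ => ⟨rfl, rfl⟩, fun h => absurd h.2 (by simp [hs1])⟩
    by_cases hs : s ∈ Ioo (0:ℝ) 1
    · obtain ⟨G', h1, h2, h3, h4⟩ := exists_riemann hs.1 hs.2 hg hgi hg0
      obtain ⟨G, a, k1, k2, k3, k4, k5, k6⟩ := rotate_map h1 h2 h4
      exact ⟨G, a, fun h => absurd h hs1, fun _ => ⟨k1, k2, k3, by rw [k4, h3], k5, k6⟩⟩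
    · exact ⟨f, 1, fun h => absurd h hs1, fun h => absurd h hs⟩
  choose F a hF1 hF using hex
  have hone : F 1 = f := (hF1 1 rfl).1
  have ha1 : a 1 = 1 := (hF1 1 rfl).2
  have hcase : ∀ s ∈ Ioc (0:ℝ) 1, s = 1 ∨ s ∈ Ioo (0:ℝ) 1 := by
    intro s hs
    rcases hs.2.eq_or_lt with h | h
    · exact Or.inl h
    · exact Or.inr ⟨hs.1, h⟩
  have him : ∀ s ∈ Ioo (0:ℝ) 1, F s '' ball 0 1 = invC (g '' closedBall 0 s) := fun s hs => (hF s hs).2.2.2.1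
  have hb1R : ball (0:ℂ) 1 ⊆ ball 0 R := ball_subset_ball hR.le
  have hc1R : closedBall (0:ℂ) 1 ⊆ ball 0 R := closedBall_subset_ball hR
  have hgo : ∀ s, s ≤ 1 → IsOpen (g '' ball 0 s) := fun s hs =>
    (inv_holo rfl isOpen_ball (hg.mono (ball_subset_ball hs)) (hgi.mono (ball_subset_ball hs))).1
  have hgcont : ∀ w ∈ ball (0:ℂ) 1, ContinuousAt g w := fun w hw =>
    hg.continuousOn.continuousAt (isOpen_ball.mem_nhds hw)
  rw [← hone]
  refine chain_exists (F := F) (a := a) ?_ ?_ ?_ ?_ ?_ ?_ ?_ ?_ ?_ ?_ ?_ ha1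
  · intro s hs
    rcases hcase s hs with rfl | h
    · rw [hone]; exact hf.mono hb1R
    · exact (hF s h).1
  · intro s hs
    rcases hcase s hs with rfl | h
    · rw [hone]; exact hinj.mono hb1R
    · exact (hF s h).2.1
  · intro s hs
    rcases hcase s hs with rfl | h
    · rw [hone]; exact hf0
    · exact (hF s h).2.2.1
  · intro s hs
    rcases hcase s hs with rfl | h
    · rw [hone, ha1, hf1]; simp
    · exact (hF s h).2.2.2.2.1
  · intro s hs
    rcases hcase s hs with rfl | h
    · rw [ha1]; exact one_pos
    · exact (hF s h).2.2.2.2.2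
  · intro s s' hs hss hs'
    rcases hss.eq_or_lt with rfl | hlt
    · exact Subset.rfl
    rcases hs'.eq_or_lt with rfl | hlt'
    · rw [hone, him s ⟨hs, hlt⟩]
      rintro _ ⟨z, hz, rfl⟩
      by_cases h0 : f z = 0
      · exact Or.inl h0
      · refine Or.inr ?_
        rintro ⟨w, hw, hwz⟩
        have h1 : (f z)⁻¹ ∈ invC (f '' closedBall 0 1) := by
          rw [← hgim, ← hwz]
          exact ⟨w, closedBall_subset_ball hlt hw, rfl⟩
        rcases h1 with h1 | h1
        · exact h0 (inv_eq_zero.1 h1)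
        · rw [inv_inv] at h1
          exact h1 ⟨z, ball_subset_closedBall hz, rfl⟩
    · rw [him s ⟨hs, hlt.trans hlt'⟩, him s' ⟨hs.trans hlt, hlt'⟩]
      exact invC_anti (image_mono (closedBall_subset_closedBall hlt.le))
  · intro s s' hs hlt hs'
    rw [him s ⟨hs, hlt.trans hs'⟩, him s' ⟨hs.trans hlt, hs'⟩]
    refine Subset.trans (closure_minimal (invC_anti (image_mono ball_subset_closedBall)) (isClosed_invC (hgo s' hs'.le))) ?_
    exact invC_anti (image_mono (closedBall_subset_ball hlt))
  · intro M
    set M' := max M 1 with hM'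
    have hM'0 : 0 < M' := lt_of_lt_of_le one_pos (le_max_right _ _)
    have hev : ∀ᶠ w in 𝓝 (0:ℂ), ‖g w‖ < M'⁻¹ := by
      have h1 := (hgcont 0 (mem_ball_self one_pos)).norm
      have h2 : ‖g 0‖ < M'⁻¹ := by rw [hg0, norm_zero]; positivity
      exact h1.eventually (gt_mem_nhds h2)
    obtain ⟨δ, hδ, hδg⟩ := Metric.nhds_basis_closedBall.mem_iff.1 hev
    have hs : min δ (1/2) ∈ Ioo (0:ℝ) 1 := ⟨by positivity, lt_of_le_of_lt (min_le_right _ _) (by norm_num)⟩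
    refine ⟨min δ (1/2), hs, ?_⟩
    rw [him _ hs]
    intro y hy
    by_cases h0 : y = 0
    · exact Or.inl h0
    · refine Or.inr ?_
      rintro ⟨w, hw, hwy⟩
      have h1 : ‖g w‖ < M'⁻¹ := hδg (closedBall_subset_closedBall (min_le_left _ _) hw)
      rw [hwy, norm_inv, inv_lt_inv₀ (norm_pos_iff.2 h0) hM'0] at h1
      rw [mem_ball_zero_iff] at hy
      have := le_max_left M 1
      linarith
  · intro σ hσ V hV hVs
    intro y hy
    rcases hcase σ hσ with rfl | hσ'
    · have hVf : V ⊆ f '' closedBall 0 1 := by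
        intro y hy
        by_contra hcon
        have hy0 : y ≠ 0 := by
          rintro rfl
          exact hcon ⟨0, mem_closedBall_self zero_le_one, hf0⟩
        have h1 : y⁻¹ ∈ g '' ball 0 1 := by
          rw [hgim]; right; rwa [inv_inv]
        obtain ⟨w, hw, hwy⟩ := h1
        rw [mem_ball_zero_iff] at hw
        have hs : max ‖w‖ (1/2) ∈ Ioo (0:ℝ) 1 := ⟨by positivity, max_lt hw (by norm_num)⟩
        have h2 := hVs _ hs hy
        rw [him _ hs] at h2
        exact h2.resolve_left hy0 ⟨w, by simp, hwy⟩
      rw [hone]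
      obtain ⟨z, hz, rfl⟩ := hVf hy
      rw [mem_closedBall_zero_iff] at hz
      refine ⟨z, ?_, rfl⟩
      rw [mem_ball_zero_iff]
      refine lt_of_le_of_ne hz fun hz1 => ?_
      have hc : ContinuousAt (fun ε : ℝ => f (((1 + ε : ℝ) : ℂ) * z)) 0 := by
        refine ContinuousAt.comp (g := f) (f := fun ε : ℝ => ((1 + ε : ℝ) : ℂ) * z) ?_ (by fun_prop)
        refine hf.continuousOn.continuousAt (isOpen_ball.mem_nhds ?_)
        simpa using hz.trans_lt hR
      have hc2 : ContinuousAt (fun ε : ℝ => ((1 + ε : ℝ) : ℂ) * z) 0 := by fun_prop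
      have e1 : ∀ᶠ ε in 𝓝[>] (0:ℝ), f (((1 + ε : ℝ) : ℂ) * z) ∈ V :=
        nhdsWithin_le_nhds (hc.preimage_mem_nhds (hV.mem_nhds (by simpa using hy)))
      have e2 : ∀ᶠ ε in 𝓝[>] (0:ℝ), ((1 + ε : ℝ) : ℂ) * z ∈ ball (0:ℂ) R :=
        nhdsWithin_le_nhds (hc2.preimage_mem_nhds (isOpen_ball.mem_nhds (by simpa using hz.trans_lt hR)))
      obtain ⟨ε, h1, h2, h3⟩ := (e1.and (e2.and self_mem_nhdsWithin)).exists
      have h3' : 0 < ε := h3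
      obtain ⟨w, hw, hwe⟩ := hVf h1
      have h4 := hinj (hc1R hw) h2 hwe
      rw [mem_closedBall_zero_iff, h4, norm_mul, Complex.norm_of_nonneg (by linarith), hz1] at hw
      linarith
    · rw [him σ hσ']
      by_cases hy0 : y = 0
      · exact Or.inl hy0
      refine Or.inr ?_
      rintro ⟨w, hw, hwy⟩
      rw [mem_closedBall_zero_iff] at hw
      have hgw : g w ≠ 0 := by rw [hwy]; exact inv_ne_zero hy0
      have hc : ContinuousAt (fun ε : ℝ => g (((1 - ε : ℝ) : ℂ) * w)) 0 := by
        refine ContinuousAt.comp (g := g) (f := fun ε : ℝ => ((1 - ε : ℝ) : ℂ) * w) ?_ (by fun_prop)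
        refine hgcont _ ?_
        simpa using hw.trans_lt hσ'.2
      have hc2 : ContinuousAt (fun ε : ℝ => (g (((1 - ε : ℝ) : ℂ) * w))⁻¹) 0 := hc.inv₀ (by simpa using hgw)
      have e1 : ∀ᶠ ε in 𝓝[>] (0:ℝ), (g (((1 - ε : ℝ) : ℂ) * w))⁻¹ ∈ V :=
        nhdsWithin_le_nhds (hc2.preimage_mem_nhds (hV.mem_nhds (by simpa [hwy] using hy)))
      have e2 : ∀ᶠ ε in 𝓝[>] (0:ℝ), g (((1 - ε : ℝ) : ℂ) * w) ≠ 0 :=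
        nhdsWithin_le_nhds (hc.preimage_mem_nhds (isOpen_ne.mem_nhds (by simpa using hgw)))
      have e3 : ∀ᶠ ε in 𝓝[>] (0:ℝ), ε < 1 := nhdsWithin_le_nhds (gt_mem_nhds one_pos)
      obtain ⟨ε, h1, h2, h3, h4⟩ := (e1.and (e2.and (e3.and self_mem_nhdsWithin))).exists
      have h4' : 0 < ε := h4
      have hn : ‖((1 - ε : ℝ) : ℂ) * w‖ < σ := by
        rw [norm_mul, Complex.norm_of_nonneg (by linarith)]
        nlinarith [norm_nonneg w, hσ'.1]
      have hs : max ‖((1 - ε : ℝ) : ℂ) * w‖ (σ/2) ∈ Ioo (0:ℝ) σ :=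
        ⟨lt_max_of_lt_right (by linarith [hσ'.1]), max_lt hn (by linarith [hσ'.1])⟩
      have h5 := hVs _ hs h1
      rw [him _ ⟨hs.1, hs.2.trans hσ'.2⟩] at h5
      refine h5.resolve_left (inv_ne_zero h2) ⟨((1 - ε : ℝ) : ℂ) * w, ?_, by rw [inv_inv]⟩
      rw [mem_closedBall_zero_iff]
      exact le_max_left _ _
  · intro σ hσ K hK hKσ
    rw [him σ hσ] at hKσ
    obtain ⟨t, hσt, ht1⟩ := exists_between hσ.2
    have hA : IsCompact (closedBall (0:ℂ) t ∩ g ⁻¹' (invC K)ᶜ) := by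
      refine (isCompact_closedBall 0 t).of_isClosed_subset ?_ inter_subset_left
      exact (hg.continuousOn.mono (closedBall_subset_ball ht1)).preimage_isClosed_of_isClosed isClosed_closedBall
        (isOpen_invC hK).isClosed_compl
    have hAσ : ∀ w ∈ closedBall (0:ℂ) t ∩ g ⁻¹' (invC K)ᶜ, σ < ‖w‖ := by
      rintro w ⟨hw, hwK⟩
      by_contra hcon
      have h1 : g w ≠ 0 ∧ (g w)⁻¹ ∈ K := by simpa [invC] using hwK
      exact (hKσ h1.2).resolve_left (inv_ne_zero h1.1) ⟨w, by simpa using hcon, by rw [inv_inv]⟩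
    have hfin : ∀ s, σ < s → s ≤ t → (∀ w ∈ closedBall (0:ℂ) t ∩ g ⁻¹' (invC K)ᶜ, s < ‖w‖) →
        ∃ s ∈ Ioo σ 1, K ⊆ F s '' ball 0 1 := by
      intro s hs hst hw
      refine ⟨s, ⟨hs, hst.trans_lt ht1⟩, ?_⟩
      rw [him s ⟨hσ.1.trans hs, hst.trans_lt ht1⟩]
      intro x hx
      by_cases hx0 : x = 0
      · exact Or.inl hx0
      refine Or.inr ?_
      rintro ⟨w, hws, hwx⟩
      have h1 := hw w ⟨closedBall_subset_closedBall hst hws, by simp [invC, hwx, hx0, hx]⟩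
      rw [mem_closedBall_zero_iff] at hws
      linarith
    rcases (closedBall (0:ℂ) t ∩ g ⁻¹' (invC K)ᶜ).eq_empty_or_nonempty with he | hne
    · exact hfin t hσt le_rfl (by rw [he]; simp)
    · obtain ⟨w₀, hw₀, hmin⟩ := hA.exists_isMinOn hne continuous_norm.continuousOn
      obtain ⟨s, hs1, hs2⟩ := exists_between (hAσ w₀ hw₀)
      have hw₀t : ‖w₀‖ ≤ t := by simpa using hw₀.1
      exact hfin s hs1 (by linarith) fun w hw => hs2.trans_le (hmin hw)
  · intro s hs
    rw [him s hs]
    obtain ⟨ε, hε, hεg⟩ := Metric.isOpen_iff.1 (hgo s hs.2.le) 0 ⟨0, mem_ball_self hs.1, hg0⟩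
    exact isBounded_closedBall.subset (invC_bdd hε (hεg.trans (image_mono ball_subset_closedBall)))

end P6c

section P7
open scoped Topology

theorem memE_one (U : Set (En 1)) (hU : IsOpen U) (hcl : closure (Ball 1) ⊆ U) (f : En 1 → En 1)
    (hf : DifferentiableOn ℂ f U) (hinj : Set.InjOn f U) : MemE 1 f := by
  let ι : ℂ ≃ₗᵢ[ℂ] En 1 :=
    { toLinearEquiv := LinearEquiv.ofBijective
        { toFun := fun z => EuclideanSpace.single (0 : Fin 1) z
          map_add' := fun x y => by ext i; fin_cases i; simp
          map_smul' := fun x y => by ext i; fin_cases i; simp }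
        ⟨fun x y h => by
          have := congrArg (fun v : En 1 => v 0) h
          simpa using this, fun y => ⟨y 0, by ext i; fin_cases i; simp⟩⟩
      norm_map' := fun z => by
        change ‖(EuclideanSpace.single (0 : Fin 1) z : En 1)‖ = ‖z‖
        simp }
  obtain ⟨R, hR, hRU⟩ : ∃ R : ℝ, 1 < R ∧ ball (0 : En 1) R ⊆ U := by
    have h1 : IsCompact (closedBall (0 : En 1) 1) := isCompact_closedBall _ _
    have h2 : closedBall (0 : En 1) 1 ⊆ U := by
      rwa [Ball, closure_ball _ one_ne_zero] at hcl
    obtain ⟨δ, hδ, hδU⟩ := h1.exists_thickening_subset_open hU h2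
    refine ⟨δ + 1, by linarith, ?_⟩
    rwa [thickening_closedBall hδ zero_le_one] at hδU
  have hball : Ball 1 ⊆ U := subset_closure.trans hcl
  have hιb : ∀ z r, ι z ∈ ball (0 : En 1) r ↔ z ∈ ball (0 : ℂ) r := by
    intro z r; simp
  have hιs : ∀ x r, ι.symm x ∈ ball (0 : ℂ) r ↔ x ∈ ball (0 : En 1) r := by
    intro z r; simp
  set p : ℂ → ℂ := fun z => ι.symm (f (ι z)) with hp
  have hpd : DifferentiableOn ℂ p (ball 0 R) := by
    refine ι.symm.toContinuousLinearEquiv.differentiable.comp_differentiableOn ?_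
    exact hf.comp ι.toContinuousLinearEquiv.differentiable.differentiableOn fun z hz => hRU ((hιb z R).2 hz)
  have hpi : InjOn p (ball 0 R) := by
    intro z hz w hw h
    exact ι.injective (hinj (hRU ((hιb z R).2 hz)) (hRU ((hιb w R).2 hw)) (ι.symm.injective h))
  have h0R : (0:ℂ) ∈ ball (0:ℂ) R := mem_ball_self (by linarith)
  set b := p 0 with hb
  set c := deriv p 0 with hc
  have hc0 : c ≠ 0 := inj_deriv_ne_zero isOpen_ball hpd hpi h0R
  obtain ⟨Φ, hΦ1, hΦ, hΦm, hΦr⟩ := chain_of_map (f := fun z => c⁻¹ * (p z - b)) hR ((hpd.sub_const b).const_mul _)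
    (fun z hz w hw h => hpi hz hw (sub_left_injective (mul_left_cancel₀ (inv_ne_zero hc0) h)))
    (by simp [hb]) (by
      have h1 := ((hpd.differentiableAt (isOpen_ball.mem_nhds h0R)).hasDerivAt.sub_const b).const_mul c⁻¹
      rw [h1.deriv, ← hc, inv_mul_cancel₀ hc0])
  let F : ℝ → En 1 → En 1 := fun t x => ι (b + c * Φ (1 + t) (ι.symm x))
  have hF0 : F 0 = f := by
    funext x
    simp only [F, add_zero, hΦ1]
    rw [mul_inv_cancel_left₀ hc0, add_sub_cancel]
    simp [hp]
  have hFmem : ∀ t y, y ∈ F t '' Ball 1 ↔ c⁻¹ * (ι.symm y - b) ∈ Φ (1 + t) '' ball 0 1 := by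
    intro t y
    constructor
    · rintro ⟨x, hx, rfl⟩
      refine ⟨ι.symm x, (hιs x 1).2 hx, ?_⟩
      simp [F, hc0]
    · rintro ⟨z, hz, hzy⟩
      refine ⟨ι z, (hιb z 1).2 hz, ?_⟩
      simp only [F, LinearIsometryEquiv.symm_apply_apply]
      rw [hzy, mul_inv_cancel_left₀ hc0]
      simp
  refine ⟨⟨hf.mono hball, hinj.mono hball⟩, F, ⟨?_, ?_, ?_⟩, hF0, ?_⟩
  · intro t ht
    obtain ⟨h1, h2, -, -⟩ := hΦ (1 + t) (by linarith)
    constructor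
    · refine ι.toContinuousLinearEquiv.differentiable.comp_differentiableOn ?_
      refine DifferentiableOn.const_add _ (DifferentiableOn.const_mul ?_ _)
      exact h1.comp ι.symm.toContinuousLinearEquiv.differentiable.differentiableOn fun x hx => (hιs x 1).2 hx
    · intro x hx y hy h
      have h3 := mul_left_cancel₀ hc0 (add_left_cancel (ι.injective h))
      exact ι.symm.injective (h2 ((hιs x 1).2 hx) ((hιs y 1).2 hy) h3)
  · intro s t hs hst y hy
    rw [hFmem] at hy ⊢
    exact hΦm (1 + s) (1 + t) (by linarith) (by linarith) hy
  · intro K hKB hK T hT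
    obtain ⟨r, hr0, hr1, hKr⟩ : ∃ r : ℝ, 0 ≤ r ∧ r < 1 ∧ ∀ z ∈ K, ‖z‖ ≤ r := by
      rcases K.eq_empty_or_nonempty with rfl | hne
      · exact ⟨0, le_rfl, one_pos, by simp⟩
      · obtain ⟨z₀, hz₀, hmax⟩ := hK.exists_isMaxOn hne continuous_norm.continuousOn
        exact ⟨‖z₀‖, norm_nonneg _, by simpa [Ball] using hKB hz₀, fun z hz => hmax hz⟩
    obtain ⟨C, hC0, hC⟩ := chain_lip hΦ hΦm hr0 hr1 (V := 1 + T) (by linarith)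
    refine ⟨fun _ => ‖c‖ * C, fun _ => by positivity, continuous_const.integrableOn_Icc, ?_⟩
    intro z hz s t hs hst ht
    have h1 := hC (1 + s) (1 + t) (by linarith) (by linarith) (by linarith) (ι.symm z) (by simpa using hKr z hz)
    have h2 : ‖F s z - F t z‖ = ‖c‖ * ‖Φ (1 + s) (ι.symm z) - Φ (1 + t) (ι.symm z)‖ := by
      simp only [F]
      rw [← map_sub, LinearIsometryEquiv.norm_map, ← norm_mul]
      congr 1; ring
    rw [h2]
    simp only [integral_const, MeasurableSet.univ, measureReal_restrict_apply, univ_inter, Real.volume_real_Icc,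
      smul_eq_mul]
    rw [max_eq_left (by linarith)]
    have h3 : ‖c‖ * ‖Φ (1 + s) (ι.symm z) - Φ (1 + t) (ι.symm z)‖ ≤ ‖c‖ * (C * (1 + t - (1 + s))) :=
      mul_le_mul_of_nonneg_left h1 (norm_nonneg _)
    linarith
  · rw [eq_univ_iff_forall]
    intro y
    obtain ⟨v, hv, hvy⟩ := hΦr (c⁻¹ * (ι.symm y - b))
    simp only [ChainRange, mem_iUnion]
    refine ⟨v - 1, by simpa using hv, ?_⟩
    rw [hFmem]
    simpa using hvy

end P7

/-- If f is holomorphic and injective on an open neighborhood U of the closed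
unit ball and f(U) is a Runge domain, then f|𝔹ₙ belongs to E(𝔹ₙ). -/
theorem memE_of_runge_on_neighborhood (n : ℕ) (U : Set (En n)) (hU : IsOpen U)
    (hcl : closure (Ball n) ⊆ U) (f : En n → En n)
    (hf : DifferentiableOn ℂ f U) (hinj : Set.InjOn f U)
    (hRunge : RungeOn n (f '' U)) : MemE n f := by
  by_cases hn : n = 1
  · subst hn
    exact memE_one U hU hcl f hf hinj
  · exact memE_ne_one n hn U hU hcl f hf hinj hRunge

end
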